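/- Let n ≥ 3 and l ∈ {1,2}, and let K > 0 and M > 0. There exists a constant C > 0, depending only on n, K and M, with the following property: if u : ℝⁿ → ℝ is C⁴ on the open ball B₅, satisfies λ(D²u(x)) ∈ Γ₃ for every x ∈ B₅, solves σ₃(D²u(x)) = σ_l(D²u(x)) on B₅, is K-semi-convex on B₅ (every eigenvalue of D²u(x) is ≥ -K), and satisfies |u(x)| + |Du(x)| ≤ M on B₅, then the operator norm of D²u(0) is at most C. -/

import Mathlib

open scoped BigOperators
noncomputable section

/-- The `k`-th elementary symmetric function of `lam ∈ ℝⁿ`. -/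
def esymm (n k : ℕ) (lam : Fin n → ℝ) : ℝ :=
  ∑ s ∈ Finset.univ.powersetCard k, ∏ i ∈ s, lam i

/-- `σ_k` of a matrix: the `k`-th elementary symmetric function of its eigenvalues,
equivalently the sum of all `k×k` principal minors, read off from the characteristic
polynomial via `det (X•1 - A) = ∑ (-1)^k σ_k(A) X^(n-k)`. -/
def sigmaMat {n : ℕ} (k : ℕ) (A : Matrix (Fin n) (Fin n) ℝ) : ℝ :=
  (-1 : ℝ) ^ k * (Matrix.charpoly A).coeff (n - k)

/-- The Hessian matrix `D²u(x)`. -/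
def hess {n : ℕ} (u : EuclideanSpace ℝ (Fin n) → ℝ) (x : EuclideanSpace ℝ (Fin n)) :
    Matrix (Fin n) (Fin n) ℝ :=
  fun i j =>
    fderiv ℝ (fun y => fderiv ℝ u y (EuclideanSpace.single j 1)) x (EuclideanSpace.single i 1)

/-- Operator norm of a matrix acting on Euclidean space. -/
def opNorm {n : ℕ} (A : Matrix (Fin n) (Fin n) ℝ) : ℝ :=
  ‖Matrix.toEuclideanCLM (𝕜 := ℝ) A‖

set_option linter.unusedSectionVars false

namespace HessQuot

variable {ι : Type*} [DecidableEq ι]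

/-- Power sum over a finite set. -/
def ps (S : Finset ι) (x : ι → ℝ) (m : ℕ) : ℝ := ∑ i ∈ S, x i ^ m

/-- First three elementary symmetric functions, through power sums. -/
def f1 (S : Finset ι) (x : ι → ℝ) : ℝ := ps S x 1
def f2 (S : Finset ι) (x : ι → ℝ) : ℝ := (ps S x 1 ^ 2 - ps S x 2) / 2
def f3 (S : Finset ι) (x : ι → ℝ) : ℝ :=
  (ps S x 1 ^ 3 - 3 * ps S x 1 * ps S x 2 + 2 * ps S x 3) / 6

lemma ps_erase {S : Finset ι} {i : ι} (hi : i ∈ S) (x : ι → ℝ) (m : ℕ) :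
    ps S x m = x i ^ m + ps (S.erase i) x m := by
  unfold ps; rw [Finset.add_sum_erase S (fun i => x i ^ m) hi]

lemma f1_eq_sum (S : Finset ι) (x : ι → ℝ) : f1 S x = ∑ i ∈ S, x i := by
  simp [f1, ps]

lemma f1_erase {S : Finset ι} {i : ι} (hi : i ∈ S) (x : ι → ℝ) :
    f1 S x = x i + f1 (S.erase i) x := by
  unfold f1; rw [ps_erase hi, pow_one]

lemma f2_erase {S : Finset ι} {i : ι} (hi : i ∈ S) (x : ι → ℝ) :
    f2 S x = x i * f1 (S.erase i) x + f2 (S.erase i) x := by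
  unfold f1 f2; rw [ps_erase hi, ps_erase hi]; ring

lemma f3_erase {S : Finset ι} {i : ι} (hi : i ∈ S) (x : ι → ℝ) :
    f3 S x = x i * f2 (S.erase i) x + f3 (S.erase i) x := by
  unfold f2 f3; rw [ps_erase hi, ps_erase hi, ps_erase hi]; ring

lemma sq_sum_eq (S : Finset ι) (x : ι → ℝ) : ∑ i ∈ S, x i ^ 2 = f1 S x ^ 2 - 2 * f2 S x := by
  unfold f1 f2 ps; ring

lemma sq_le_of_mem {S : Finset ι} {i : ι} (hi : i ∈ S) (x : ι → ℝ) :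
    x i ^ 2 ≤ f1 S x ^ 2 - 2 * f2 S x := by
  rw [← sq_sum_eq]
  exact Finset.single_le_sum (f := fun i => x i ^ 2) (fun i _ => sq_nonneg _) hi

lemma two_f2_le (S : Finset ι) (x : ι → ℝ) : 2 * f2 S x ≤ f1 S x ^ 2 := by
  have : 0 ≤ ∑ i ∈ S, x i ^ 2 := Finset.sum_nonneg fun i _ => sq_nonneg _
  rw [sq_sum_eq] at this; linarith

lemma ps_four_le (S : Finset ι) (x : ι → ℝ) : ps S x 4 ≤ ps S x 2 ^ 2 := by
  unfold ps
  rw [sq, Finset.sum_mul]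
  refine Finset.sum_le_sum fun i hi => ?_
  have := Finset.single_le_sum (f := fun i => x i ^ 2) (fun i _ => sq_nonneg _) hi
  have h2 := mul_le_mul_of_nonneg_left this (sq_nonneg (x i))
  calc x i ^ 4 = x i ^ 2 * x i ^ 2 := by ring
    _ ≤ _ := h2

lemma newton_identity (S : Finset ι) (x : ι → ℝ) :
    4 * f2 S x ^ 2 - 6 * f1 S x * f3 S x =
      ∑ i ∈ S, (x i * (f1 S x - x i)) ^ 2 + (ps S x 2 ^ 2 - ps S x 4) := by
  have : ∑ i ∈ S, (x i * (f1 S x - x i)) ^ 2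
      = f1 S x ^ 2 * ps S x 2 - 2 * f1 S x * ps S x 3 + ps S x 4 := by
    unfold ps
    rw [Finset.mul_sum, Finset.mul_sum, ← Finset.sum_sub_distrib, ← Finset.sum_add_distrib]
    exact Finset.sum_congr rfl fun i _ => by ring
  rw [this]; unfold f1 f2 f3; ring

/-- A weak form of Newton's inequality. -/
lemma newton (S : Finset ι) (x : ι → ℝ) : 3 * (f1 S x * f3 S x) ≤ 2 * f2 S x ^ 2 := by
  have h := newton_identity S x
  have h1 := ps_four_le S x
  have h2 : 0 ≤ ∑ i ∈ S, (x i * (f1 S x - x i)) ^ 2 :=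
    Finset.sum_nonneg fun i _ => sq_nonneg _
  nlinarith

lemma sum_mul_compl (S : Finset ι) (x : ι → ℝ) :
    ∑ i ∈ S, x i * (f1 S x - x i) = 2 * f2 S x := by
  have : ∑ i ∈ S, x i * (f1 S x - x i) = f1 S x * ps S x 1 - ps S x 2 := by
    unfold ps
    rw [Finset.mul_sum, ← Finset.sum_sub_distrib]
    exact Finset.sum_congr rfl fun i _ => by ring
  rw [this]; unfold f1 f2; ring

lemma newton_card (S : Finset ι) (x : ι → ℝ) :
    3 * S.card * (f1 S x * f3 S x) ≤ 2 * (S.card - 1) * f2 S x ^ 2 := by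
  have h := newton_identity S x
  have h1 := ps_four_le S x
  have h2 := sq_sum_le_card_mul_sum_sq (s := S) (f := fun i => x i * (f1 S x - x i))
  rw [sum_mul_compl] at h2
  have h3 : (0 : ℝ) ≤ S.card := Nat.cast_nonneg _
  have h4 := mul_nonneg h3 (sub_nonneg.2 h1)
  have h5 := congrArg (fun z => (S.card : ℝ) * z) h
  nlinarith

lemma f2_card (S : Finset ι) (x : ι → ℝ) :
    2 * S.card * f2 S x ≤ (S.card - 1) * f1 S x ^ 2 := by
  have h2 := sq_sum_le_card_mul_sum_sq (s := S) (f := x)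
  rw [sq_sum_eq, ← f1_eq_sum] at h2
  nlinarith

/-- In `Γ₂`, the trace dominates each entry. -/
lemma abs_lt_f1 {S : Finset ι} {x : ι → ℝ} (h1 : 0 < f1 S x) (h2 : 0 < f2 S x) {i : ι}
    (hi : i ∈ S) : |x i| < f1 S x := by
  have := sq_le_of_mem hi x
  exact abs_lt_of_sq_lt_sq (by linarith) h1.le

lemma f1_erase_pos {S : Finset ι} {x : ι → ℝ} (h1 : 0 < f1 S x) (h2 : 0 < f2 S x) {i : ι}
    (hi : i ∈ S) : 0 < f1 (S.erase i) x := by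
  have := abs_lt_f1 h1 h2 hi
  have h3 := f1_erase hi x
  have := le_abs_self (x i)
  linarith

lemma f2_erase_pos {S : Finset ι} {x : ι → ℝ} (h1 : 0 < f1 S x) (h2 : 0 < f2 S x)
    (h3 : 0 < f3 S x) {i : ι} (hi : i ∈ S) : 0 < f2 (S.erase i) x := by
  have p := f1_erase_pos h1 h2 hi
  have e2 := f2_erase hi x
  have e3 := f3_erase hi x
  have nw := newton (S.erase i) x
  by_contra hneg
  push Not at hneg
  set a := x i
  set p1 := f1 (S.erase i) x
  set p2 := f2 (S.erase i) x
  set p3 := f3 (S.erase i) x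
  have ha : 0 < a := by
    by_contra h; push Not at h; nlinarith
  have h5 : -(a * p2) ≤ p3 := by linarith
  have h6 : p1 * -(a * p2) < p1 * p3 := mul_lt_mul_of_pos_left (by linarith) p
  have h7 : 0 ≤ (a * p1 + p2) * (-p2) := mul_nonneg (by linarith) (by linarith)
  nlinarith [sq_nonneg p2]

lemma f1_erase_erase_pos {S : Finset ι} {x : ι → ℝ} (h1 : 0 < f1 S x) (h2 : 0 < f2 S x)
    (h3 : 0 < f3 S x) {i j : ι} (hi : i ∈ S) (hj : j ∈ S) (hij : j ≠ i) :
    0 < f1 ((S.erase i).erase j) x :=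
  f1_erase_pos (f1_erase_pos h1 h2 hi) (f2_erase_pos h1 h2 h3 hi) (Finset.mem_erase.2 ⟨hij, hj⟩)

/-- Elementary symmetric functions of a translate. -/
lemma f1_add (S : Finset ι) (x : ι → ℝ) (c : ℝ) :
    f1 S (fun i => x i + c) = f1 S x + S.card * c := by
  simp [f1_eq_sum, Finset.sum_add_distrib]

lemma ps_two_add (S : Finset ι) (x : ι → ℝ) (c : ℝ) :
    ps S (fun i => x i + c) 2 = ps S x 2 + 2 * c * ps S x 1 + S.card * c ^ 2 := by
  have : (S.card : ℝ) * c ^ 2 = ∑ _i ∈ S, c ^ 2 := by simp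
  rw [this]; unfold ps
  rw [Finset.mul_sum, ← Finset.sum_add_distrib, ← Finset.sum_add_distrib]
  exact Finset.sum_congr rfl fun i _ => by ring

lemma ps_three_add (S : Finset ι) (x : ι → ℝ) (c : ℝ) :
    ps S (fun i => x i + c) 3 =
      ps S x 3 + 3 * c * ps S x 2 + 3 * c ^ 2 * ps S x 1 + S.card * c ^ 3 := by
  have : (S.card : ℝ) * c ^ 3 = ∑ _i ∈ S, c ^ 3 := by simp
  rw [this]; unfold ps
  rw [Finset.mul_sum, Finset.mul_sum, ← Finset.sum_add_distrib, ← Finset.sum_add_distrib,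
    ← Finset.sum_add_distrib]
  exact Finset.sum_congr rfl fun i _ => by ring

lemma f2_add (S : Finset ι) (x : ι → ℝ) (c : ℝ) :
    f2 S (fun i => x i + c) =
      f2 S x + (S.card - 1) * c * f1 S x + S.card * (S.card - 1) / 2 * c ^ 2 := by
  have h := f1_add S x c
  unfold f1 at h
  unfold f2 f1
  rw [h, ps_two_add]; ring

lemma f3_add (S : Finset ι) (x : ι → ℝ) (c : ℝ) :
    f3 S (fun i => x i + c) =
      f3 S x + (S.card - 2) * c * f2 S x + (S.card - 1) * (S.card - 2) / 2 * c ^ 2 * f1 S x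
        + S.card * (S.card - 1) * (S.card - 2) / 6 * c ^ 3 := by
  have h := f1_add S x c
  unfold f1 at h
  unfold f3 f2 f1
  rw [h, ps_two_add, ps_three_add]; ring

section nonneg
variable {S : Finset ι} {x : ι → ℝ}

lemma f1_nonneg (h : ∀ i ∈ S, 0 ≤ x i) : 0 ≤ f1 S x := by
  rw [f1_eq_sum]; exact Finset.sum_nonneg h

lemma f2_nonneg (h : ∀ i ∈ S, 0 ≤ x i) : 0 ≤ f2 S x := by
  induction S using Finset.induction_on with
  | empty => simp [f2, ps]
  | insert a s ha ih =>
    have h1 := f2_erase (Finset.mem_insert_self a s) x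
    rw [Finset.erase_insert ha] at h1
    have h2 := ih fun i hi => h i (Finset.mem_insert_of_mem hi)
    have h3 := f1_nonneg (S := s) fun i hi => h i (Finset.mem_insert_of_mem hi)
    have h4 := h a (Finset.mem_insert_self a s)
    rw [h1]; positivity

lemma f3_nonneg (h : ∀ i ∈ S, 0 ≤ x i) : 0 ≤ f3 S x := by
  induction S using Finset.induction_on with
  | empty => simp [f3, ps]
  | insert a s ha ih =>
    have h1 := f3_erase (Finset.mem_insert_self a s) x
    rw [Finset.erase_insert ha] at h1
    have h2 := ih fun i hi => h i (Finset.mem_insert_of_mem hi)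
    have h3 := f2_nonneg (S := s) fun i hi => h i (Finset.mem_insert_of_mem hi)
    have h4 := h a (Finset.mem_insert_self a s)
    rw [h1]; positivity

lemma one_le_prod' (h : ∀ i ∈ S, 1 ≤ x i) : 1 ≤ ∏ i ∈ S, x i := by
  induction S using Finset.induction_on with
  | empty => simp
  | insert a s ha ih =>
    rw [Finset.prod_insert ha]
    exact one_le_mul_of_one_le_of_one_le (h a (Finset.mem_insert_self a s))
      (ih fun i hi => h i (Finset.mem_insert_of_mem hi))

lemma f1_le_prod (h : ∀ i ∈ S, 1 ≤ x i) : f1 S x ≤ S.card * ∏ i ∈ S, x i := by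
  induction S using Finset.induction_on with
  | empty => simp [f1, ps]
  | insert a s ha ih =>
    have h1 := f1_erase (Finset.mem_insert_self a s) x
    rw [Finset.erase_insert ha] at h1
    have h2 := ih fun i hi => h i (Finset.mem_insert_of_mem hi)
    have h3 := one_le_prod' (S := s) fun i hi => h i (Finset.mem_insert_of_mem hi)
    have h4 := h a (Finset.mem_insert_self a s)
    rw [h1, Finset.prod_insert ha, Finset.card_insert_of_notMem ha]
    push_cast
    have h5 : x a ≤ x a * ∏ i ∈ s, x i := le_mul_of_one_le_right (by linarith) h3
    have h6 : (s.card : ℝ) * ∏ i ∈ s, x i ≤ x a * (s.card * ∏ i ∈ s, x i) :=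
      le_mul_of_one_le_left (by positivity) h4
    nlinarith

lemma f2_le_prod (h : ∀ i ∈ S, 1 ≤ x i) : f2 S x ≤ S.card ^ 2 * ∏ i ∈ S, x i := by
  induction S using Finset.induction_on with
  | empty => simp [f2, ps]
  | insert a s ha ih =>
    have h1 := f2_erase (Finset.mem_insert_self a s) x
    rw [Finset.erase_insert ha] at h1
    have h2 := ih fun i hi => h i (Finset.mem_insert_of_mem hi)
    have h3 := one_le_prod' (S := s) fun i hi => h i (Finset.mem_insert_of_mem hi)
    have h7 := f1_le_prod (S := s) fun i hi => h i (Finset.mem_insert_of_mem hi)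
    have h4 := h a (Finset.mem_insert_self a s)
    rw [h1, Finset.prod_insert ha, Finset.card_insert_of_notMem ha]
    push_cast
    have h5 : x a * f1 s x ≤ x a * (s.card * ∏ i ∈ s, x i) :=
      mul_le_mul_of_nonneg_left h7 (by linarith)
    have h6 : (s.card : ℝ) ^ 2 * ∏ i ∈ s, x i ≤ x a * (s.card ^ 2 * ∏ i ∈ s, x i) :=
      le_mul_of_one_le_left (by positivity) h4
    have h8 : 0 ≤ x a * (s.card * ∏ i ∈ s, x i) := by positivity
    have h9 : 0 ≤ x a * (∏ i ∈ s, x i) := by positivity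
    nlinarith

end nonneg

end HessQuot

namespace HessQuot

variable {ι : Type*} [DecidableEq ι]

/-- Points of `Γ₃` on the level set `σ₃ = α σ₁ + β`, with entries bounded below by `1 - κ`. -/
structure Adm (α β κ : ℝ) (S : Finset ι) (x : ι → ℝ) : Prop where
  pos1 : 0 < f1 S x
  pos2 : 0 < f2 S x
  pos3 : 0 < f3 S x
  eqn : f3 S x = α * f1 S x + β
  low : ∀ i ∈ S, 1 ≤ x i + κ

/-- Derivative of `σ₃ - α σ₁` in the `i`-th eigenvalue. -/
def gG (α : ℝ) (S : Finset ι) (x : ι → ℝ) (i : ι) : ℝ := f2 (S.erase i) x - α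

/-- Scalar relations between one entry `a` and the symmetric functions of the others. -/
structure Split (α β κ a s1 s2 s3 : ℝ) : Prop where
  s1pos : 0 < s1
  s2pos : 0 < s2
  newt : 3 * (s1 * s3) ≤ 2 * s2 ^ 2
  macl : 2 * s2 ≤ s1 ^ 2
  eqn : a * s2 + s3 = α * (a + s1) + β
  low : 1 ≤ a + κ
  tr : 0 < a + s1
  e2ge : 3 * α ≤ a * s1 + s2

section
variable {α β κ : ℝ} (hα : 0 < α) (hβ : 0 ≤ β) (hκ : 0 ≤ κ) {S : Finset ι} {x : ι → ℝ}

include hα hβ in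
lemma Adm.f2_sq (h : Adm α β κ S x) : 3 * α * f1 S x ^ 2 ≤ 2 * f2 S x ^ 2 := by
  have h1 := newton S x
  rw [h.eqn] at h1
  nlinarith [h.pos1, mul_nonneg h.pos1.le hβ]

include hα hβ in
lemma Adm.f2_ge (h : Adm α β κ S x) : 3 * α ≤ f2 S x := by
  have h1 := h.f2_sq hα hβ
  have h2 := two_f2_le S x
  have h3 := h.pos2
  by_contra hc
  push Not at hc
  nlinarith [mul_le_mul_of_nonneg_left h2 hα.le, mul_pos h3 (sub_pos.2 hc)]

include hα hβ in
lemma Adm.f1_le (h : Adm α β κ S x) : f1 S x ≤ (1 + 1 / α) * f2 S x := by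
  have h1 := h.f2_sq hα hβ
  have h2 := h.pos2
  refine abs_le_of_sq_le_sq' ?_ (by positivity) |>.2
  have h4 : f1 S x ^ 2 ≤ (2 / (3 * α)) * f2 S x ^ 2 := by
    rw [div_mul_eq_mul_div, le_div_iff₀ (by positivity)]; linarith
  refine h4.trans ?_
  rw [mul_pow]
  gcongr
  have : (2 : ℝ) / (3 * α) = (2 / 3) * (1 / α) := by field_simp
  rw [this]
  have : 0 < 1 / α := by positivity
  nlinarith

include hα hβ in
lemma Adm.f1_sq_ge (h : Adm α β κ S x) : 6 * α ≤ f1 S x ^ 2 := by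
  linarith [two_f2_le S x, h.f2_ge hα hβ]

include hα hβ in
lemma Adm.split (h : Adm α β κ S x) {i : ι} (hi : i ∈ S) :
    Split α β κ (x i) (f1 (S.erase i) x) (f2 (S.erase i) x) (f3 (S.erase i) x) where
  s1pos := f1_erase_pos h.pos1 h.pos2 hi
  s2pos := f2_erase_pos h.pos1 h.pos2 h.pos3 hi
  newt := newton _ _
  macl := two_f2_le _ _
  eqn := by rw [← f3_erase hi, ← f1_erase hi]; exact h.eqn
  low := h.low i hi
  tr := by rw [← f1_erase hi]; exact h.pos1
  e2ge := by rw [← f2_erase hi]; exact h.f2_ge hα hβ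

end

namespace Split
variable {α β κ a s1 s2 s3 : ℝ} (h : Split α β κ a s1 s2 s3) (hα : 0 < α) (hβ : 0 ≤ β)
  (hκ : 0 ≤ κ)
include h hα hβ

lemma s3_le : 3 * s3 ≤ s2 * s1 := by
  have h1 := h.newt
  have h2 := mul_le_mul_of_nonneg_left h.macl h.s2pos.le
  have h3 : s1 * (3 * s3) ≤ s1 * (s2 * s1) := by nlinarith
  exact le_of_mul_le_mul_left h3 h.s1pos

lemma G_nonpos (ha : a ≤ 0) : 2 / 3 * (a * s1 + s2) ≤ s2 - α := by
  have := h.e2ge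
  have := mul_nonneg (neg_nonneg.2 ha) h.s1pos.le
  linarith

lemma G_key : 2 * α * s1 ≤ (s2 - α) * (3 * a + s1) := by
  have h1 := h.s3_le hα hβ
  have h2 := h.eqn
  nlinarith

lemma G_pos : 0 < s2 - α := by
  rcases le_or_gt a 0 with ha | ha
  · have := h.G_nonpos hα hβ ha
    have := h.e2ge
    linarith
  · have h1 := h.G_key hα hβ
    have h2 : 0 < 2 * α * s1 := by have := h.s1pos; positivity
    have h3 : 0 < 3 * a + s1 := by have := h.s1pos; positivity
    by_contra hc
    push Not at hc
    nlinarith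

lemma s1_sq : 2 * α < s1 ^ 2 := by
  have := h.G_pos hα hβ
  have := h.macl
  linarith

lemma G_mul : (s2 - α) * a = α * s1 + β - s3 := by
  have := h.eqn
  linarith

/-- Lower bound for the linearised coefficients in terms of the trace. -/
lemma G_lower : min α (α * √(2 * α) / 2) ≤ (s2 - α) * (a + s1) * (1 + 1 / √ α) := by
  have hs : 0 < √ α := Real.sqrt_pos.2 hα
  have hss : √ α * √ α = α := Real.mul_self_sqrt hα.le
  have htr := h.tr
  have hG := h.G_pos hα hβ
  rcases le_or_gt a 0 with ha | ha
  · have h1 := h.G_nonpos hα hβ ha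
    have h2 := h.e2ge
    have h3 : α ≤ s2 - α := by linarith
    have h4 : √ α ≤ a + s1 := by
      apply Real.sqrt_le_iff.2 ⟨htr.le, ?_⟩
      have := h.macl
      nlinarith [sq_nonneg a]
    refine (min_le_left _ _).trans ?_
    have h5 : 1 ≤ (a + s1) * (1 + 1 / √α) := by
      have : (a + s1) * (1 + 1 / √α) = (a + s1) + (a + s1) / √ α := by ring
      have h6 : 1 ≤ (a + s1) / √ α := by rwa [le_div_iff₀ hs, one_mul]
      linarith
    rw [mul_assoc]
    nlinarith
  · refine (min_le_right _ _).trans ?_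
    have h1 := h.G_key hα hβ
    have h2 : √(2 * α) ≤ s1 := Real.sqrt_le_iff.2 ⟨h.s1pos.le, (h.s1_sq hα hβ).le⟩
    have h3 : 0 ≤ √(2 * α) := Real.sqrt_nonneg _
    have h4 : α * √(2 * α) ≤ α * s1 := mul_le_mul_of_nonneg_left h2 hα.le
    have h5 : (s2 - α) * (3 * a + s1) ≤ (s2 - α) * (3 * (a + s1)) := by
      apply mul_le_mul_of_nonneg_left _ hG.le; linarith [h.s1pos]
    have h6 : 0 ≤ (s2 - α) * (a + s1) * (1 / √ α) := by positivity
    nlinarith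

include hκ in
/-- `σ₂ ≲ G_i ω_i²`. -/
lemma G_omega : min (1 / 8) (α / 24) * min 1 α * (a * s1 + s2)
    ≤ (s2 - α) * (a + κ) ^ 2 := by
  have hs1 := h.s1pos
  have hG := h.G_pos hα hβ
  have hlow := h.low
  have he2 := h.e2ge
  set e2 := a * s1 + s2 with he2d
  have he2p : 0 < e2 := by linarith
  have hw : 1 ≤ (a + κ) ^ 2 := by nlinarith
  have hc2 : 0 ≤ min (1 : ℝ) α := by positivity
  have hc1 : 0 ≤ min (1 / 8 : ℝ) (α / 24) := by positivity
  have hcle : min (1 / 8) (α / 24) * min 1 α ≤ 1 / 6 := by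
    calc _ ≤ (1 / 8 : ℝ) * 1 := mul_le_mul (min_le_left _ _) (min_le_left _ _) hc2 (by norm_num)
      _ ≤ _ := by norm_num
  have easy : 1 / 6 * e2 ≤ s2 - α →
      min (1 / 8) (α / 24) * min 1 α * e2 ≤ (s2 - α) * (a + κ) ^ 2 := by
    intro h1
    have h2 : min (1 / 8) (α / 24) * min 1 α * e2 ≤ 1 / 6 * e2 :=
      mul_le_mul_of_nonneg_right hcle he2p.le
    nlinarith
  rcases le_or_gt a 0 with ha | ha
  · exact easy (by linarith [h.G_nonpos hα hβ ha])
  rcases le_or_gt (e2 / 2) s2 with h2 | h2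
  · exact easy (by linarith)
  have has1 : e2 ≤ 2 * (a * s1) := by linarith
  have hcle2 : min (1 / 8) (α / 24) * min 1 α ≤ α / 24 := by
    calc _ ≤ (α / 24 : ℝ) * 1 := mul_le_mul (min_le_right _ _) (min_le_left _ _) hc2 (by positivity)
      _ = _ := by ring
  have hcle3 : min (1 / 8) (α / 24) * min 1 α ≤ min 1 α / 8 := by
    calc _ ≤ (1 / 8 : ℝ) * min 1 α := mul_le_mul_of_nonneg_right (min_le_left _ _) hc2
      _ = _ := by ring
  have hk := h.G_key hα hβ
  have hww : a ^ 2 ≤ (a + κ) ^ 2 := by nlinarith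
  have hww' : a ≤ (a + κ) ^ 2 := by nlinarith
  have key : ∀ c : ℝ, min (1 / 8) (α / 24) * min 1 α ≤ c →
      c * 2 * (a * s1) ≤ (s2 - α) * (a + κ) ^ 2 →
      min (1 / 8) (α / 24) * min 1 α * e2 ≤ (s2 - α) * (a + κ) ^ 2 := by
    intro c hc hc'
    refine le_trans ?_ hc'
    have hc0 : 0 ≤ c := le_trans (mul_nonneg hc1 hc2) hc
    calc _ ≤ c * e2 := mul_le_mul_of_nonneg_right hc he2p.le
      _ ≤ c * (2 * (a * s1)) := mul_le_mul_of_nonneg_left has1 hc0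
      _ = _ := by ring
  have gen : α * s1 / 2 ≤ (s2 - α) * a → 
      min (1 / 8) (α / 24) * min 1 α * e2 ≤ (s2 - α) * (a + κ) ^ 2 := by
    intro h3
    refine key (α / 24) hcle2 ?_
    have h4 : (s2 - α) * a ^ 2 ≤ (s2 - α) * (a + κ) ^ 2 := mul_le_mul_of_nonneg_left hww hG.le
    have h5 := mul_le_mul_of_nonneg_right h3 ha.le
    have h6 : 0 ≤ α * s1 * a := by positivity
    nlinarith
  rcases le_or_gt s1 a with h3 | h3
  · apply gen
    nlinarith
  · by_cases h4 : α * s1 / 2 ≤ (s2 - α) * a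
    · exact gen h4
    push Not at h4
    have hGm := h.G_mul hα hβ
    have h5 : α / 2 ≤ s2 - α := by
      have : (s2 - α) * (3 * a + s1) ≤ (s2 - α) * (4 * s1) :=
        mul_le_mul_of_nonneg_left (by linarith) hG.le
      have h6 : 2 * α * s1 ≤ 4 * (s2 - α) * s1 := by linarith
      have := le_of_mul_le_mul_right h6 hs1
      linarith
    set G := s2 - α
    have h6 : s2 ≤ 3 * G := by linarith
    have h7 : 3 * (s1 * s3) ≤ 18 * G ^ 2 := by
      have := h.newt
      have := h.s2pos
      nlinarith
    have h8 : α * s1 ^ 2 ≤ 12 * G ^ 2 := by nlinarith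
    have h9 : min 1 α / 4 * s1 ≤ G := by
      have hm : min 1 α ^ 2 ≤ α := by
        calc min 1 α ^ 2 = min 1 α * min 1 α := sq _
          _ ≤ 1 * α := mul_le_mul (min_le_left _ _) (min_le_right _ _) hc2 zero_le_one
          _ = α := one_mul _
      have h10 : (min 1 α * s1) ^ 2 ≤ (4 * G) ^ 2 := by
        have := mul_le_mul_of_nonneg_right hm (sq_nonneg s1)
        nlinarith
      have := abs_le_of_sq_le_sq' h10 (by positivity) |>.2
      linarith
    refine key (min 1 α / 8) hcle3 ?_
    have h10 : G * a ≤ G * (a + κ) ^ 2 := mul_le_mul_of_nonneg_left hww' hG.le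
    have h11 := mul_le_mul_of_nonneg_right h9 ha.le
    nlinarith

end Split
end HessQuot

namespace HessQuot

variable {ι : Type*} [DecidableEq ι]

lemma nat_falling_nonneg (m : ℕ) : 0 ≤ (m : ℝ) * (m - 1) ∧ 0 ≤ ((m : ℝ) - 1) * (m - 2) := by
  rcases m with _ | _ | m
  · norm_num
  · norm_num
  · push_cast
    constructor
    · have : (0 : ℝ) ≤ m := Nat.cast_nonneg m
      nlinarith
    · have : (0 : ℝ) ≤ m := Nat.cast_nonneg m
      nlinarith

lemma f1_shift_nonneg {κ : ℝ} {S : Finset ι} {x : ι → ℝ} (h : ∀ i ∈ S, 1 ≤ x i + κ) :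
    0 ≤ f1 S x + S.card * κ := by
  rw [← f1_add]; exact f1_nonneg fun i hi => by linarith [h i hi]

lemma f2_shift_ge {κ : ℝ} (hκ : 0 ≤ κ) {S : Finset ι} {x : ι → ℝ} (h : ∀ i ∈ S, 1 ≤ x i + κ) :
    -(S.card * κ * (f1 S x + S.card * κ)) ≤ f2 S x := by
  have h1 : 0 ≤ f2 S (fun i => x i + κ) := f2_nonneg fun i hi => by linarith [h i hi]
  have h2 := f1_shift_nonneg h
  have h3 := f2_add S x κ
  obtain ⟨h4, -⟩ := nat_falling_nonneg S.card
  have h5 := mul_nonneg h4 (sq_nonneg κ)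
  have h6 := mul_nonneg hκ h2
  nlinarith

lemma f3_shift_ge {κ : ℝ} (hκ : 0 ≤ κ) {S : Finset ι} {x : ι → ℝ} (h : ∀ i ∈ S, 1 ≤ x i + κ) :
    -(S.card * κ * f2 S (fun i => x i + κ) + S.card ^ 3 * κ ^ 3) ≤ f3 S x := by
  have h1 : 0 ≤ f2 S (fun i => x i + κ) := f2_nonneg fun i hi => by linarith [h i hi]
  have h1' : 0 ≤ f3 S (fun i => x i + κ) := f3_nonneg fun i hi => by linarith [h i hi]
  have h2 := f1_shift_nonneg h
  have h3 := f3_add S (fun i => x i + κ) (-κ)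
  rw [f1_add] at h3
  have h7 : (fun i => x i + κ + -κ) = x := by ext; ring
  rw [h7] at h3
  obtain ⟨h4, h5⟩ := nat_falling_nonneg S.card
  have h6 := mul_nonneg hκ h1
  have h8 := mul_nonneg (mul_nonneg h5 (sq_nonneg κ)) h2
  have hk3 : 0 ≤ κ ^ 3 := by positivity
  have hm : (0 : ℝ) ≤ S.card := Nat.cast_nonneg _
  have h9 : (S.card : ℝ) * (S.card - 1) * (S.card - 2) / 6 * κ ^ 3 ≤ S.card ^ 3 * κ ^ 3 := by
    apply mul_le_mul_of_nonneg_right _ hk3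
    nlinarith [mul_nonneg hm hm, mul_nonneg hm (mul_nonneg hm hm), mul_nonneg hm h4,
      sq_nonneg ((S.card:ℝ)-1)]
  rw [h3]
  nlinarith

lemma two_f2_shift_le {κ : ℝ} {S : Finset ι} {x : ι → ℝ} :
    2 * f2 S (fun i => x i + κ) ≤ (f1 S x + S.card * κ) ^ 2 := by
  rw [← f1_add]; exact two_f2_le _ _

lemma shift_le_f1 {κ : ℝ} {S : Finset ι} {x : ι → ℝ} (h : ∀ i ∈ S, 1 ≤ x i + κ) {i : ι}
    (hi : i ∈ S) : x i + κ ≤ f1 S x + S.card * κ := by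
  rw [← f1_add, f1_eq_sum]
  exact Finset.single_le_sum (f := fun i => x i + κ) (fun i hi => by linarith [h i hi]) hi

lemma abs_ps_le {S : Finset ι} {x : ι → ℝ} {X : ℝ} (h : ∀ i ∈ S, |x i| ≤ X) (m : ℕ) :
    |ps S x m| ≤ S.card * X ^ m := by
  unfold ps
  refine (Finset.abs_sum_le_sum_abs _ _).trans ?_
  rw [← nsmul_eq_mul]
  refine Finset.sum_le_card_nsmul _ _ _ fun i hi => ?_
  rw [abs_pow]; exact pow_le_pow_left₀ (abs_nonneg _) (h i hi) m

lemma abs_f_le {S : Finset ι} {x : ι → ℝ} {X : ℝ} (h : ∀ i ∈ S, |x i| ≤ X) (hX : 0 ≤ X) :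
    |f1 S x| ≤ S.card * X ∧ |f2 S x| ≤ (S.card * X) ^ 2 + S.card * X ^ 2 ∧
    |f3 S x| ≤ (S.card * X) ^ 3 + 3 * (S.card * X * (S.card * X ^ 2)) + 2 * (S.card * X ^ 3) := by
  have h1 := abs_ps_le h 1
  have h2 := abs_ps_le h 2
  have h3 := abs_ps_le h 3
  rw [pow_one] at h1
  have q1 : |ps S x 1 ^ 2| ≤ (S.card * X) ^ 2 := by
    rw [abs_pow]; exact pow_le_pow_left₀ (abs_nonneg _) h1 2
  have q2 : |ps S x 1 ^ 3| ≤ (S.card * X) ^ 3 := by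
    rw [abs_pow]; exact pow_le_pow_left₀ (abs_nonneg _) h1 3
  have q3 : |ps S x 1 * ps S x 2| ≤ S.card * X * (S.card * X ^ 2) := by
    rw [abs_mul]; exact mul_le_mul h1 h2 (abs_nonneg _) (by positivity)
  refine ⟨h1, ?_, ?_⟩
  · unfold f2
    rw [abs_le] at *
    constructor <;> linarith
  · unfold f3
    rw [abs_le] at *
    constructor <;> linarith

section
variable {α β κ : ℝ} (hα : 0 < α) (hβ : 0 ≤ β) (hκ : 0 ≤ κ) (S : Finset ι)

/-- What is left after removing the two distinguished indices `k`, `j` is bounded. -/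
structure Tail (α C : ℝ) (R : Finset ι) (x : ι → ℝ) (X : ℝ) : Prop where
  pos : 0 < f1 R x
  small : f1 R x * X ≤ C
  sq_le : f1 R x ^ 2 ≤ α
  bdd : ∀ i ∈ R, |x i| ≤ C
  b2 : |f2 R x| ≤ C
  b3 : |f3 R x| ≤ C

set_option maxHeartbeats 1000000 in
include hα hβ hκ in
/-- If the second largest entry is large, then all remaining ones are under control. -/
lemma exists_tail (C0 : ℝ) (hC0 : 1 ≤ C0) :
    ∃ X0 C : ℝ, 1 ≤ X0 ∧ 1 ≤ C ∧ ∀ x : ι → ℝ, Adm α β κ S x → ∀ k ∈ S, ∀ j ∈ S, j ≠ k →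
      (∀ i ∈ S, i ≠ k → x i ≤ x j) → x j ≤ C0 * x k → X0 ≤ x j →
      Tail α C ((S.erase k).erase j) x (x j) := by
  obtain ⟨m, hm⟩ : ∃ m : ℝ, m = (S.card : ℝ) := ⟨_, rfl⟩
  have hm0 : 0 ≤ m := hm ▸ Nat.cast_nonneg _
  obtain ⟨A1, hA1⟩ : ∃ t : ℝ, t = α + m * κ * (1 + m * κ) := ⟨_, rfl⟩
  obtain ⟨A2, hA2⟩ : ∃ t : ℝ, t = α + β + m * κ * (1 + m * κ) ^ 2 + m ^ 3 * κ ^ 3 := ⟨_, rfl⟩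
  obtain ⟨B, hB⟩ : ∃ t : ℝ, t = (1 + C0) * A1 + A2 * ((1 + m) * C0) := ⟨_, rfl⟩
  have hmk : 0 ≤ m * κ := mul_nonneg hm0 hκ
  have hA1p : 0 < A1 := by rw [hA1]; positivity
  have hA2p : 0 < A2 := by rw [hA2]; positivity
  have hBp : 0 < B := by rw [hB]; positivity
  obtain ⟨Y, hY⟩ : ∃ t : ℝ, t = 1 + (m + 1) * κ := ⟨_, rfl⟩
  have hYp : 1 ≤ Y := by rw [hY]; linarith
  refine ⟨1 + 2 * B + 2 * B / α, 2 * B + Y + ((m * Y) ^ 2 + m * Y ^ 2) +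
    ((m * Y) ^ 3 + 3 * (m * Y * (m * Y ^ 2)) + 2 * (m * Y ^ 3)), ?_, ?_, ?_⟩
  · have : 0 ≤ 2 * B / α := by positivity
    linarith
  · have : 0 ≤ ((m * Y) ^ 2 + m * Y ^ 2) := by positivity
    have : 0 ≤ ((m * Y) ^ 3 + 3 * (m * Y * (m * Y ^ 2)) + 2 * (m * Y ^ 3)) := by positivity
    linarith
  intro x h k hk j hj hjk hmax hjz hX
  set R := (S.erase k).erase j with hR
  have hjk' : j ∈ S.erase k := Finset.mem_erase.2 ⟨hjk, hj⟩
  have hcard : (R.card : ℝ) ≤ m := by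
    rw [hm]; exact_mod_cast (Finset.card_le_card ((Finset.erase_subset _ _).trans
      (Finset.erase_subset _ _)))
  have hRS : ∀ i ∈ R, i ∈ S := fun i hi => Finset.mem_of_mem_erase (Finset.mem_of_mem_erase hi)
  have hlow : ∀ i ∈ R, 1 ≤ x i + κ := fun i hi => h.low i (hRS i hi)
  have hp : 0 < f1 R x := f1_erase_erase_pos h.pos1 h.pos2 h.pos3 hk hj hjk
  have heq : x k * x j * f1 R x + (x k + x j) * f2 R x + f3 R x
      = α * (x k + x j + f1 R x) + β := by
    have := h.eqn
    rw [f3_erase hk, f3_erase hjk', f2_erase hjk', f1_erase hk, f1_erase hjk'] at this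
    linarith
  have hf2 := f2_shift_ge hκ hlow
  have hf3 := f3_shift_ge hκ hlow
  have hf3' := two_f2_shift_le (κ := κ) (S := R) (x := x)
  have hf1 := f1_shift_nonneg hlow
  have hp1m : f1 R x ≤ m * x j := by
    rw [f1_eq_sum]
    have h1 : ∑ i ∈ R, x i ≤ R.card • x j := Finset.sum_le_card_nsmul _ _ _ fun i hi =>
      hmax i (hRS i hi) (Finset.ne_of_mem_erase (Finset.mem_of_mem_erase hi))
    rw [nsmul_eq_mul] at h1
    have h2B : 0 ≤ 2 * B / α := by positivity
    exact h1.trans (mul_le_mul_of_nonneg_right hcard (by linarith))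
  have hc0 : (0 : ℝ) ≤ R.card := Nat.cast_nonneg _
  generalize ep1 : f1 R x = p1 at *
  generalize ep2 : f2 R x = p2 at *
  generalize ep3 : f3 R x = p3 at *
  generalize x j = y at *
  generalize x k = z at *
  generalize ec : (R.card : ℝ) = c at *
  have h2B : 0 ≤ 2 * B / α := by positivity
  have hy1 : 1 ≤ y := by linarith
  have hz : 0 < z := by
    by_contra hz; push Not at hz
    have := mul_nonneg (by linarith : 0 ≤ C0) (neg_nonneg.2 hz)
    linarith
  have hck : c * κ ≤ m * κ := mul_le_mul_of_nonneg_right hcard hκ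
  have hck0 : 0 ≤ c * κ := mul_nonneg hc0 hκ
  have hq1 : p1 + c * κ ≤ (1 + m * κ) * (1 + p1) := by
    have := mul_nonneg hmk hp.le
    linarith
  have hq2 : α - p2 ≤ A1 * (1 + p1) := by
    have : c * κ * (p1 + c * κ) ≤ m * κ * ((1 + m * κ) * (1 + p1)) :=
      mul_le_mul hck hq1 hf1 hmk
    have h2 := mul_pos hα hp
    rw [hA1]
    linarith
  have hq3 : α * p1 + β - p3 ≤ A2 * (1 + p1) ^ 2 := by
    have h1 : (p1 + c * κ) ^ 2 ≤ ((1 + m * κ) * (1 + p1)) ^ 2 := pow_le_pow_left₀ hf1 hq1 2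
    have h2 : c * κ * f2 R (fun i => x i + κ) ≤ m * κ * ((1 + m * κ) * (1 + p1)) ^ 2 := by
      apply mul_le_mul hck _ (f2_nonneg fun i hi => by linarith [hlow i hi]) hmk
      have := sq_nonneg ((1 + m * κ) * (1 + p1))
      linarith
    have h3 : c ^ 3 * κ ^ 3 ≤ m ^ 3 * κ ^ 3 := by
      rw [← mul_pow, ← mul_pow]; exact pow_le_pow_left₀ hck0 hck 3
    have h4 : 1 ≤ (1 + p1) ^ 2 := by nlinarith
    have h5 : m ^ 3 * κ ^ 3 ≤ m ^ 3 * κ ^ 3 * (1 + p1) ^ 2 :=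
      le_mul_of_one_le_right (by positivity) h4
    have h6 : α * p1 + β ≤ (α + β) * (1 + p1) ^ 2 := by
      have t1 := mul_nonneg hα.le hp.le
      have t2 := mul_nonneg hβ hp.le
      have t3 := mul_nonneg hα.le (sq_nonneg p1)
      have t4 := mul_nonneg hβ (sq_nonneg p1)
      linarith
    rw [hA2]
    linarith
  have hmain : y * p1 ≤ B * (1 + p1) := by
    have e : z * (y * p1) = (z + y) * (α - p2) + (α * p1 + β - p3) := by linarith
    have h1 : (z + y) * (α - p2) ≤ (z + y) * (A1 * (1 + p1)) :=
      mul_le_mul_of_nonneg_left hq2 (by linarith)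
    have h2 : (z + y) * (A1 * (1 + p1)) ≤ ((1 + C0) * z) * (A1 * (1 + p1)) :=
      mul_le_mul_of_nonneg_right (by linarith) (by positivity)
    have h3 : 1 + p1 ≤ (1 + m) * C0 * z := by
      have : (1 + m) * y ≤ (1 + m) * (C0 * z) := mul_le_mul_of_nonneg_left hjz (by linarith)
      linarith
    have h4 : A2 * (1 + p1) ^ 2 ≤ A2 * ((1 + m) * C0 * z * (1 + p1)) := by
      apply mul_le_mul_of_nonneg_left _ hA2p.le
      rw [sq]
      exact mul_le_mul_of_nonneg_right h3 (by linarith)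
    have h5 : z * (y * p1) ≤ z * (B * (1 + p1)) := by
      rw [hB]; linarith
    exact le_of_mul_le_mul_left h5 hz
  have hyB : 2 * B ≤ y := by linarith
  have hsmall : p1 * y ≤ 2 * B := by
    have := mul_nonneg (sub_nonneg.2 hyB) hp.le
    linarith
  have hp1 : p1 ≤ 1 := by
    by_contra hcon; push Not at hcon
    have := mul_pos (sub_pos.2 hcon) (by linarith : 0 < y)
    linarith
  subst ep1 ep2 ep3 ec
  have hbd : ∀ i ∈ R, |x i| ≤ Y := by
    intro i hi
    have h1 := shift_le_f1 hlow hi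
    have h2 := hlow i hi
    have h3 : R.card * κ ≤ m * κ := hck
    have h4 : x i + κ ≤ f1 R x + R.card * κ := h1
    rw [abs_le, hY]
    constructor <;> linarith
  obtain ⟨-, g2, g3⟩ := abs_f_le hbd (by linarith)
  have P1 : 0 ≤ ((m * Y) ^ 2 + m * Y ^ 2) := by positivity
  have P2 : 0 ≤ ((m * Y) ^ 3 + 3 * (m * Y * (m * Y ^ 2)) + 2 * (m * Y ^ 3)) := by positivity
  have hY0 : 0 ≤ Y := by linarith
  have m1 : (R.card * Y) ^ 2 + R.card * Y ^ 2 ≤ (m * Y) ^ 2 + m * Y ^ 2 := by gcongr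
  have m2 : (R.card * Y) ^ 3 + 3 * (R.card * Y * (R.card * Y ^ 2)) + 2 * (R.card * Y ^ 3)
      ≤ (m * Y) ^ 3 + 3 * (m * Y * (m * Y ^ 2)) + 2 * (m * Y ^ 3) := by gcongr
  refine ⟨hp, by linarith, ?_, fun i hi => (hbd i hi).trans (by linarith), by linarith,
    by linarith⟩
  have h1 : 2 * B / α ≤ y := by linarith
  rw [div_le_iff₀ hα] at h1
  have h2 : f1 R x * y ≤ α * y := by linarith
  have h3 := le_of_mul_le_mul_right h2 (by linarith)
  nlinarith

end
end HessQuot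

namespace HessQuot

variable {ι : Type*} [DecidableEq ι]

lemma prod_le_const_pow {S : Finset ι} {x : ι → ℝ} {X : ℝ} (h0 : ∀ i ∈ S, 0 ≤ x i)
    (h : ∀ i ∈ S, x i ≤ X) : ∏ i ∈ S, x i ≤ X ^ S.card := by
  rw [← Finset.prod_const]; exact Finset.prod_le_prod h0 h

section
variable {α β κ : ℝ} (hα : 0 < α) (hβ : 0 ≤ β) (hκ : 0 ≤ κ) (S : Finset ι)

lemma e2_scalar {C z y p1 p2 e2 : ℝ} (hz : 1 ≤ z) (hy : 1 ≤ y)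
    (hp1 : 0 < p1) (hp2 : -C ≤ p2) (he : e2 = z * (y + p1) + (y * p1 + p2)) : z * y ≤ e2 + C := by
  have : 0 ≤ z * p1 := by positivity
  have : 0 ≤ y * p1 := by positivity
  rw [he]; linarith

lemma shift_mul_le {κ z y : ℝ} (hκ : 0 ≤ κ) (hz : 1 ≤ z) (hy : 1 ≤ y) :
    (z + κ) * (y + κ) ≤ (1 + κ) ^ 2 * (z * y) := by
  have h1 : z + κ ≤ (1 + κ) * z := by nlinarith
  have h2 : y + κ ≤ (1 + κ) * y := by nlinarith
  calc (z + κ) * (y + κ) ≤ ((1 + κ) * z) * ((1 + κ) * y) :=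
        mul_le_mul h1 h2 (by linarith) (by positivity)
    _ = _ := by ring

include hα hβ hκ in
/-- The determinant of the shifted matrix is controlled by `σ₂`. -/
lemma exists_prod_le (hS : 2 ≤ S.card) :
    ∃ C : ℝ, 1 ≤ C ∧ ∀ x : ι → ℝ, Adm α β κ S x → ∏ i ∈ S, (x i + κ) ≤ C * f2 S x := by
  obtain ⟨X0, C, hX0, hC, H⟩ := exists_tail hα hβ hκ S 1 le_rfl
  refine ⟨1 + (1 + κ) ^ 2 * (1 + C / (3 * α)) * (C + κ) ^ (S.card) +
    (1 + 1 / α + κ / (3 * α)) * (X0 + κ) ^ (S.card - 1), ?_, ?_⟩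
  · have h1 : 0 ≤ (1 + κ) ^ 2 * (1 + C / (3 * α)) * (C + κ) ^ (S.card) := by positivity
    have h2 : 0 ≤ (1 + 1 / α + κ / (3 * α)) * (X0 + κ) ^ (S.card - 1) := by positivity
    linarith
  intro x h
  have hf2 := h.f2_ge hα hβ
  have hf1 := h.f1_le hα hβ
  obtain ⟨k, hk, hkmax⟩ := S.exists_max_image x (Finset.card_pos.1 (by omega))
  obtain ⟨j, hj, hjmax⟩ := (S.erase k).exists_max_image x
    (Finset.card_pos.1 (by rw [Finset.card_erase_of_mem hk]; omega))
  have hjk := Finset.ne_of_mem_erase hj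
  have hjS := Finset.mem_of_mem_erase hj
  have hmax : ∀ i ∈ S, i ≠ k → x i ≤ x j := fun i hi hik => hjmax i (Finset.mem_erase.2 ⟨hik, hi⟩)
  have hw : ∀ i ∈ S, 0 ≤ x i + κ := fun i hi => by linarith [h.low i hi]
  have hk0 := hw k hk
  have hfk : x k ≤ f1 S x := (le_abs_self _).trans (abs_lt_f1 h.pos1 h.pos2 hk).le
  rw [← Finset.mul_prod_erase S _ hk]
  have T1 : 0 ≤ (1 + κ) ^ 2 * (1 + C / (3 * α)) * (C + κ) ^ (S.card) * f2 S x := by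
    have := h.pos2; positivity
  have T2 : 0 ≤ (1 + 1 / α + κ / (3 * α)) * (X0 + κ) ^ (S.card - 1) * f2 S x := by
    have := h.pos2; positivity
  have hC0 : ∀ t : ℝ, 0 ≤ t → t ≤ t / (3 * α) * f2 S x := by
    intro t ht
    rw [div_mul_eq_mul_div, le_div_iff₀ (by positivity)]
    nlinarith
  have h0 := h.pos2
  rcases le_or_gt X0 (x j) with hx | hx
  · obtain ⟨hp, hsm, hsq, hbdd, hb2, hb3⟩ := H x h k hk j hjS hjk hmax
      (by rw [one_mul]; exact hkmax j hjS) hx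
    have hy : 1 ≤ x j := hX0.trans hx
    have hz : 1 ≤ x k := hy.trans (hkmax j hjS)
    have he : f2 S x = x k * (x j + f1 ((S.erase k).erase j) x)
        + (x j * f1 ((S.erase k).erase j) x + f2 ((S.erase k).erase j) x) := by
      rw [f2_erase hk, f1_erase hj, f2_erase hj]
    have h1 := e2_scalar hz hy hp (abs_le.1 hb2).1 he
    have h2 := shift_mul_le hκ hz hy
    rw [← Finset.mul_prod_erase (S.erase k) _ hj]
    have h3 : ∏ i ∈ (S.erase k).erase j, (x i + κ) ≤ (C + κ) ^ S.card := by
      refine (prod_le_const_pow (X := C + κ) (fun i hi => hw i (Finset.mem_of_mem_erase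
        (Finset.mem_of_mem_erase hi))) fun i hi => ?_).trans ?_
      · linarith [(abs_le.1 (hbdd i hi)).2]
      · exact pow_le_pow_right₀ (by linarith) (Finset.card_le_card
          ((Finset.erase_subset _ _).trans (Finset.erase_subset _ _)))
    have h4 : x k * x j ≤ (1 + C / (3 * α)) * f2 S x := by
      have := hC0 C (by linarith)
      linarith
    have h5 : (x k + κ) * (x j + κ) ≤ (1 + κ) ^ 2 * ((1 + C / (3 * α)) * f2 S x) :=
      h2.trans (mul_le_mul_of_nonneg_left h4 (by positivity))
    have h6 : (x k + κ) * ((x j + κ) * ∏ i ∈ (S.erase k).erase j, (x i + κ)) ≤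
        (1 + κ) ^ 2 * ((1 + C / (3 * α)) * f2 S x) * (C + κ) ^ S.card := by
      rw [← mul_assoc]
      refine mul_le_mul h5 h3 (Finset.prod_nonneg fun i hi => hw i (Finset.mem_of_mem_erase
        (Finset.mem_of_mem_erase hi))) (by positivity)
    refine h6.trans ?_
    linarith
  · have h3 : ∏ i ∈ S.erase k, (x i + κ) ≤ (X0 + κ) ^ (S.card - 1) := by
      rw [← Finset.card_erase_of_mem hk]
      refine prod_le_const_pow (fun i hi => hw i (Finset.mem_of_mem_erase hi)) fun i hi => ?_
      linarith [hjmax i hi]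
    have h4 : x k + κ ≤ (1 + 1 / α + κ / (3 * α)) * f2 S x := by
      have := hC0 κ hκ
      linarith
    have h6 := mul_le_mul h4 h3 (Finset.prod_nonneg fun i hi => hw i (Finset.mem_of_mem_erase hi))
      (by positivity)
    refine h6.trans ?_
    linarith

lemma gomega_le_scalar {α β κ a s1 s2 s3 C1 C2 m P e2 : ℝ} (hα : 0 < α) (hβ : 0 ≤ β)
    (hκ : 0 ≤ κ) (hC1 : 0 ≤ C1) (hC2 : 0 ≤ C2) (hm : 0 ≤ m)
    (h : Split α β κ a s1 s2 s3) (he : e2 = a * s1 + s2) (hC : a + s1 ≤ C1 * e2)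
    (hP : (a + κ) * P ≤ C2 * e2) (h3 : -(m * κ * (m ^ 2 * P) + m ^ 3 * κ ^ 3) ≤ s3) (hP0 : 0 ≤ P) :
    (s2 - α) * (a + κ) ^ 2 ≤ (κ ^ 2 * (1 + κ * C1 + κ ^ 2 / (3 * α)) + 2 * κ ^ 2 +
      2 * (α + β * C1 + m ^ 3 * κ * C2 + m ^ 3 * κ ^ 3 * C1)) * e2 := by
  have hG := h.G_pos hα hβ
  have hs1 := h.s1pos
  have hs2 := h.s2pos
  have he2 : 0 < e2 := by have := h.e2ge; linarith
  have hlow := h.low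
  have P1 : 0 ≤ κ ^ 2 * (1 + κ * C1 + κ ^ 2 / (3 * α)) * e2 := by positivity
  have P2 : 0 ≤ κ ^ 2 * e2 := by positivity
  have P3 : 0 ≤ (α + β * C1 + m ^ 3 * κ * C2 + m ^ 3 * κ ^ 3 * C1) * e2 := by positivity
  rcases le_or_gt a 0 with ha | ha
  · have h1 : (a + κ) ^ 2 ≤ κ ^ 2 := pow_le_pow_left₀ (by linarith) (by linarith) 2
    have h2 : s2 - α ≤ (1 + κ * C1 + κ ^ 2 / (3 * α)) * e2 := by
      have h5 : -a * (a + s1) ≤ κ * (C1 * e2) :=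
        mul_le_mul (by linarith) hC h.tr.le hκ
      have h6 : a ^ 2 ≤ κ ^ 2 := by nlinarith
      have h7 : κ ^ 2 ≤ κ ^ 2 / (3 * α) * e2 := by
        rw [div_mul_eq_mul_div, le_div_iff₀ (by positivity), he]
        exact mul_le_mul_of_nonneg_left h.e2ge (sq_nonneg _)
      linarith
    have h3 : (s2 - α) * (a + κ) ^ 2 ≤ ((1 + κ * C1 + κ ^ 2 / (3 * α)) * e2) * κ ^ 2 :=
      mul_le_mul h2 h1 (sq_nonneg _) (by positivity)
    linarith
  · have has : 0 < a * s1 := by positivity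
    have hG2 : s2 - α ≤ e2 := by linarith
    have h1 : (a + κ) ^ 2 ≤ 2 * a ^ 2 + 2 * κ ^ 2 := by nlinarith [sq_nonneg (a - κ)]
    have h2 : (s2 - α) * (a + κ) ^ 2 ≤ (s2 - α) * (2 * a ^ 2 + 2 * κ ^ 2) :=
      mul_le_mul_of_nonneg_left h1 hG.le
    have h4 := h.G_mul hα hβ
    have h5 : a * (-s3) ≤ (m ^ 3 * κ * C2 + m ^ 3 * κ ^ 3 * C1) * e2 := by
      have q1 : a * (-s3) ≤ a * (m * κ * (m ^ 2 * P) + m ^ 3 * κ ^ 3) :=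
        mul_le_mul_of_nonneg_left (by linarith) ha.le
      have q2 : m ^ 3 * κ * (a * P) ≤ m ^ 3 * κ * (C2 * e2) := by
        apply mul_le_mul_of_nonneg_left _ (by positivity)
        nlinarith [mul_nonneg hκ hP0]
      have q3 : m ^ 3 * κ ^ 3 * a ≤ m ^ 3 * κ ^ 3 * (C1 * e2) :=
        mul_le_mul_of_nonneg_left (by linarith) (by positivity)
      linarith
    have h6 : (s2 - α) * a ^ 2 ≤
        (α + β * C1 + m ^ 3 * κ * C2 + m ^ 3 * κ ^ 3 * C1) * e2 := by
      have e : (s2 - α) * a ^ 2 = α * (a * s1) + β * a + a * (-s3) := by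
        rw [sq, ← mul_assoc, h4]; ring
      have q1 : α * (a * s1) ≤ α * e2 := mul_le_mul_of_nonneg_left (by linarith) hα.le
      have q2 : β * a ≤ β * (C1 * e2) := mul_le_mul_of_nonneg_left (by linarith) hβ
      rw [e]; linarith
    have h7 : (s2 - α) * κ ^ 2 ≤ e2 * κ ^ 2 := mul_le_mul_of_nonneg_right hG2 (sq_nonneg _)
    linarith

include hα hβ hκ in
/-- `G_i ω_i² ≲ σ₂`. -/
lemma exists_gomega_le (hS : 2 ≤ S.card) :
    ∃ C : ℝ, 1 ≤ C ∧ ∀ x : ι → ℝ, Adm α β κ S x → ∀ i ∈ S,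
      gG α S x i * (x i + κ) ^ 2 ≤ C * f2 S x := by
  obtain ⟨C2, hC2, H⟩ := exists_prod_le hα hβ hκ S hS
  obtain ⟨m, hm⟩ : ∃ m : ℝ, m = (S.card : ℝ) := ⟨_, rfl⟩
  have hm0 : 0 ≤ m := hm ▸ Nat.cast_nonneg _
  refine ⟨1 + (κ ^ 2 * (1 + κ * (1 + 1 / α) + κ ^ 2 / (3 * α)) + 2 * κ ^ 2 +
    2 * (α + β * (1 + 1 / α) +
    m ^ 3 * κ * C2 + m ^ 3 * κ ^ 3 * (1 + 1 / α))), ?_, ?_⟩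
  · have : 0 ≤ (κ ^ 2 * (1 + κ * (1 + 1 / α) + κ ^ 2 / (3 * α)) + 2 * κ ^ 2 +
    2 * (α + β * (1 + 1 / α) +
      m ^ 3 * κ * C2 + m ^ 3 * κ ^ 3 * (1 + 1 / α))) := by positivity
    linarith
  intro x h i hi
  have hP := H x h
  rw [← Finset.mul_prod_erase S _ hi] at hP
  have hlow : ∀ j ∈ S.erase i, 1 ≤ x j + κ := fun j hj => h.low j (Finset.mem_of_mem_erase hj)
  have hP0 : 0 ≤ ∏ j ∈ S.erase i, (x j + κ) :=
    Finset.prod_nonneg fun j hj => by linarith [hlow j hj]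
  have h3 := f3_shift_ge hκ hlow
  have h2 := f2_le_prod hlow
  have hc : ((S.erase i).card : ℝ) ≤ m := by
    rw [hm]; exact_mod_cast Finset.card_le_card (Finset.erase_subset _ _)
  have hc0 : (0 : ℝ) ≤ (S.erase i).card := Nat.cast_nonneg _
  have h3' : -(m * κ * (m ^ 2 * ∏ j ∈ S.erase i, (x j + κ)) + m ^ 3 * κ ^ 3)
      ≤ f3 (S.erase i) x := by
    have h4 : f2 (S.erase i) (fun j => x j + κ) ≤ m ^ 2 * ∏ j ∈ S.erase i, (x j + κ) := by
      refine h2.trans ?_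
      gcongr
    refine le_trans ?_ h3
    have h5 : (S.erase i).card * κ * f2 (S.erase i) (fun j => x j + κ) ≤
      m * κ * (m ^ 2 * ∏ j ∈ S.erase i, (x j + κ)) := by
      apply mul_le_mul _ h4 (f2_nonneg fun j hj => by linarith [hlow j hj]) (by positivity)
      gcongr
    have h6 : ((S.erase i).card : ℝ) ^ 3 * κ ^ 3 ≤ m ^ 3 * κ ^ 3 := by gcongr
    linarith
  have := gomega_le_scalar hα hβ hκ (C1 := 1 + 1 / α) (C2 := C2) (m := m) (by positivity)
    (by linarith) hm0 (h.split hα hβ hi) (f2_erase hi x)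
    (by rw [← f1_erase hi]; exact h.f1_le hα hβ) hP h3' hP0
  unfold gG
  have := h.pos2
  linarith

end

lemma s1omega_scalar {α β κ a s1 s2 s3 C1 e2 : ℝ} (hα : 0 < α) 
    (hκ : 0 ≤ κ) (h : Split α β κ a s1 s2 s3) (he : e2 = a * s1 + s2) (hC : a + s1 ≤ C1 * e2) :
    s1 * (a + κ) ≤ (1 + κ * C1 + κ ^ 2 / (3 * α)) * e2 := by
  have h1 := h.low
  have h2 := h.s2pos
  have h3 := h.e2ge
  have h4 : κ ^ 2 ≤ κ ^ 2 / (3 * α) * e2 := by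
    rw [div_mul_eq_mul_div, le_div_iff₀ (by positivity), he]
    exact mul_le_mul_of_nonneg_left h3 (sq_nonneg _)
  have h5 : κ * s1 ≤ κ * (C1 * e2 + κ) := mul_le_mul_of_nonneg_left (by linarith) hκ
  nlinarith

section
variable {α β κ : ℝ} (hα : 0 < α) (hβ : 0 ≤ β) (hκ : 0 ≤ κ) (S : Finset ι)

include hα hβ hκ in
/-- `σ₂ ≲ G_i ω_i²`. -/
lemma exists_gomega_ge :
    ∃ c : ℝ, 0 < c ∧ ∀ x : ι → ℝ, Adm α β κ S x → ∀ i ∈ S,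
      c * f2 S x ≤ gG α S x i * (x i + κ) ^ 2 := by
  refine ⟨min (1 / 8) (α / 24) * min 1 α, by positivity, fun x h i hi => ?_⟩
  have := (h.split hα hβ hi).G_omega hα hβ hκ
  rw [f2_erase hi]; exact this

include hα hβ in
lemma Adm.gG_pos {x : ι → ℝ} {S : Finset ι} (h : Adm α β κ S x) {i : ι} (hi : i ∈ S) :
    0 < gG α S x i :=
  (h.split hα hβ hi).G_pos hα hβ

include hα hβ hκ in
/-- `σ₁(λ|i)² ≲ σ₂ G_i`. -/
lemma exists_compl_sq_le :
    ∃ C : ℝ, 1 ≤ C ∧ ∀ x : ι → ℝ, Adm α β κ S x → ∀ i ∈ S,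
      f1 (S.erase i) x ^ 2 ≤ C * f2 S x * gG α S x i := by
  obtain ⟨c, hc, H⟩ := exists_gomega_ge hα hβ hκ S
  set D := (1 + κ * (1 + 1 / α) + κ ^ 2 / (3 * α)) with hD
  refine ⟨1 + D ^ 2 / c, by have : 0 ≤ D ^ 2 / c := by positivity
                            linarith, fun x h i hi => ?_⟩
  have h1 := H x h i hi
  have h2 := s1omega_scalar hα hκ (h.split hα hβ hi) (f2_erase hi x)
    (by rw [← f1_erase hi]; exact h.f1_le hα hβ)
  rw [← hD] at h2
  have hG := h.gG_pos hα hβ hi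
  have hs := (h.split hα hβ hi).s1pos
  have hw := h.low i hi
  have he := h.pos2
  generalize f1 (S.erase i) x = s at *
  generalize x i + κ = w at *
  generalize f2 S x = e at *
  generalize gG α S x i = G at *
  have h3 : (s * w) ^ 2 ≤ (D * e) ^ 2 := pow_le_pow_left₀ (by positivity) h2 2
  have h4 : c * e * s ^ 2 ≤ G * (D ^ 2 * e ^ 2) := by
    calc c * e * s ^ 2 ≤ G * w ^ 2 * s ^ 2 := mul_le_mul_of_nonneg_right h1 (sq_nonneg _)
      _ = G * (s * w) ^ 2 := by ring
      _ ≤ G * (D * e) ^ 2 := mul_le_mul_of_nonneg_left h3 hG.le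
      _ = _ := by ring
  have h5 : s ^ 2 ≤ D ^ 2 / c * e * G := by
    rw [div_mul_eq_mul_div, div_mul_eq_mul_div, le_div_iff₀ hc]
    have : e * (s ^ 2 * c) ≤ e * (D ^ 2 * e * G) := by linarith
    exact le_of_mul_le_mul_left this he
  have : 0 ≤ e * G := by positivity
  linarith

include hα hβ in
/-- `1 ≲ σ₁ G_i`. -/
lemma exists_trace_gG_ge :
    ∃ c : ℝ, 0 < c ∧ ∀ x : ι → ℝ, Adm α β κ S x → ∀ i ∈ S,
      c ≤ f1 S x * gG α S x i := by
  have h0 : 0 < √α := Real.sqrt_pos.2 hα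
  refine ⟨min α (α * √(2 * α) / 2) / (1 + 1 / √ α), by positivity, fun x h i hi => ?_⟩
  rw [div_le_iff₀ (by positivity)]
  have := (h.split hα hβ hi).G_lower hα hβ
  rw [← f1_erase hi] at this
  unfold gG
  linarith

end
end HessQuot

namespace HessQuot

variable {ι : Type*} [DecidableEq ι]

/-- Mixed moments of two functions. -/
def mom (S : Finset ι) (x y : ι → ℝ) (a b : ℕ) : ℝ := ∑ i ∈ S, x i ^ a * y i ^ b

lemma mom_erase {S : Finset ι} {i : ι} (hi : i ∈ S) (x y : ι → ℝ) (a b : ℕ) :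
    mom S x y a b = x i ^ a * y i ^ b + mom (S.erase i) x y a b := by
  unfold mom; rw [Finset.add_sum_erase S (fun i => x i ^ a * y i ^ b) hi]

lemma ps_eq_mom (S : Finset ι) (x y : ι → ℝ) (m : ℕ) : ps S x m = mom S x y m 0 := by
  simp [ps, mom]

/-- First and second variations of `σ₂` and `σ₃` at `x` in direction `y`. -/
def d2 (S : Finset ι) (x y : ι → ℝ) : ℝ := f1 S x * mom S x y 0 1 - mom S x y 1 1
def h2 (S : Finset ι) (x y : ι → ℝ) : ℝ := mom S x y 0 1 ^ 2 - mom S x y 0 2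
def d3 (S : Finset ι) (x y : ι → ℝ) : ℝ :=
  f2 S x * mom S x y 0 1 - f1 S x * mom S x y 1 1 + mom S x y 2 1
def h3 (S : Finset ι) (x y : ι → ℝ) : ℝ :=
  f1 S x * (mom S x y 0 1 ^ 2 - mom S x y 0 2) - 2 * mom S x y 0 1 * mom S x y 1 1
    + 2 * mom S x y 1 2

lemma gG_eq {S : Finset ι} {i : ι} (hi : i ∈ S) (α : ℝ) (x : ι → ℝ) :
    gG α S x i = f2 S x - x i * (f1 S x - x i) - α := by
  unfold gG
  have h1 := f1_erase hi x
  have h2 := f2_erase hi x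
  rw [h2, h1]; ring

lemma sum_gG_mul (S : Finset ι) (α : ℝ) (x y : ι → ℝ) :
    ∑ i ∈ S, gG α S x i * y i = d3 S x y - α * mom S x y 0 1 := by
  unfold d3
  have : d3 S x y - α * mom S x y 0 1 = ∑ i ∈ S, (f2 S x * (x i ^ 0 * y i ^ 1)
      - f1 S x * (x i ^ 1 * y i ^ 1) + x i ^ 2 * y i ^ 1 - α * (x i ^ 0 * y i ^ 1)) := by
    unfold d3 mom
    rw [Finset.sum_sub_distrib, Finset.sum_add_distrib, Finset.sum_sub_distrib, Finset.mul_sum,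
      Finset.mul_sum, Finset.mul_sum]
  unfold d3 at this
  rw [this]
  exact Finset.sum_congr rfl fun i hi => by rw [gG_eq hi]; ring

/-- Concavity of `σ₂ / σ₁`. -/
lemma concave_two_one (S : Finset ι) (x y : ι → ℝ) :
    f1 S x ^ 2 * h2 S x y ≤ 2 * f1 S x * mom S x y 0 1 * d2 S x y
      - 2 * f2 S x * mom S x y 0 1 ^ 2 := by
  have h : ∑ i ∈ S, (f1 S x * y i - mom S x y 0 1 * x i) ^ 2 =
      f1 S x ^ 2 * mom S x y 0 2 - 2 * f1 S x * mom S x y 0 1 * mom S x y 1 1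
        + mom S x y 0 1 ^ 2 * mom S x y 2 0 := by
    generalize f1 S x = c
    generalize mom S x y 0 1 = d
    unfold mom
    rw [Finset.mul_sum, Finset.mul_sum, Finset.mul_sum, ← Finset.sum_sub_distrib,
      ← Finset.sum_add_distrib]
    exact Finset.sum_congr rfl fun i _ => by ring
  have h0 : 0 ≤ ∑ i ∈ S, (f1 S x * y i - mom S x y 0 1 * x i) ^ 2 :=
    Finset.sum_nonneg fun i _ => sq_nonneg _
  have h1 : mom S x y 2 0 = f1 S x ^ 2 - 2 * f2 S x := by
    rw [← ps_eq_mom]; unfold f1 f2; ring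
  rw [h, h1] at h0
  unfold h2 d2
  linarith

lemma concave_term {a u p P s S' s'' : ℝ} (hp : 0 < p) (he : 0 < a * p + s)
    (hs : p ^ 2 * s'' ≤ 2 * p * P * S' - 2 * s * P ^ 2) :
    (2 * u * S' + a * s'') * (a * p + s) ^ 2 ≤ (a * p + s) * (a * s) * (2 * u * P + s'')
      + 2 * (u * p + a * P + S') * ((a * p + s) * (u * s + a * S')
        - a * s * (u * p + a * P + S')) := by
  have h1 := mul_nonneg (mul_nonneg (sq_nonneg a) he.le) (sub_nonneg.2 hs)
  have h2 := sq_nonneg (u * s * p - a * (S' * p - s * P))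
  refine le_of_mul_le_mul_left ?_ hp
  have e : p * ((a * p + s) * (a * s) * (2 * u * P + s'')
      + 2 * (u * p + a * P + S') * ((a * p + s) * (u * s + a * S')
        - a * s * (u * p + a * P + S'))) - p * ((2 * u * S' + a * s'') * (a * p + s) ^ 2) =
      a ^ 2 * (a * p + s) * (2 * p * P * S' - 2 * s * P ^ 2 - p ^ 2 * s'')
        + 2 * (u * s * p - a * (S' * p - s * P)) ^ 2 := by ring
  linarith

/-- Concavity of `σ₃ / σ₂`. -/
lemma concave_three_two {S : Finset ι} {x : ι → ℝ} (y : ι → ℝ) (h1 : 0 < f1 S x)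
    (hf2 : 0 < f2 S x) :
    f2 S x ^ 2 * h3 S x y ≤ f2 S x * f3 S x * h2 S x y
      + 2 * d2 S x y * (f2 S x * d3 S x y - f3 S x * d2 S x y) := by
  have key : ∀ i ∈ S,
      (2 * y i * (d2 S x y - y i * (f1 S x - x i) - x i * (mom S x y 0 1 - y i))
        + x i * (h2 S x y - 2 * y i * (mom S x y 0 1 - y i))) * f2 S x ^ 2 ≤
      f2 S x * (x i * (f2 S x - x i * (f1 S x - x i))) * h2 S x y
      + 2 * d2 S x y * (f2 S x * (y i * (f2 S x - x i * (f1 S x - x i))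
        + x i * (d2 S x y - y i * (f1 S x - x i) - x i * (mom S x y 0 1 - y i)))
        - x i * (f2 S x - x i * (f1 S x - x i)) * d2 S x y) := by
    intro i hi
    have c := concave_two_one (S.erase i) x y
    have e1 : f1 (S.erase i) x = f1 S x - x i := by rw [f1_erase hi x]; ring
    have e2 : f2 (S.erase i) x = f2 S x - x i * (f1 S x - x i) := by
      rw [f2_erase hi x, f1_erase hi x]; ring
    have et : mom (S.erase i) x y 0 1 = mom S x y 0 1 - y i := by
      rw [mom_erase hi x y]; ring
    have el : mom (S.erase i) x y 1 1 = mom S x y 1 1 - x i * y i := by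
      rw [mom_erase hi x y]; ring
    have ew : mom (S.erase i) x y 0 2 = mom S x y 0 2 - y i ^ 2 := by
      rw [mom_erase hi x y]; ring
    have ed : d2 (S.erase i) x y = d2 S x y - y i * (f1 S x - x i)
        - x i * (mom S x y 0 1 - y i) := by
      unfold d2; rw [e1, et, el]; ring
    have eh : h2 (S.erase i) x y = h2 S x y - 2 * y i * (mom S x y 0 1 - y i) := by
      unfold h2; rw [et, ew]; ring
    rw [e1, e2, et, ed, eh] at c
    have hp : 0 < f1 S x - x i := by rw [← e1]; exact f1_erase_pos h1 hf2 hi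
    have := concave_term (a := x i) (u := y i) hp (by ring_nf; linarith) c
    convert this using 1 <;> ring
  have hsum := Finset.sum_le_sum key
  have L : ∑ i ∈ S, (2 * y i * (d2 S x y - y i * (f1 S x - x i) - x i * (mom S x y 0 1 - y i))
        + x i * (h2 S x y - 2 * y i * (mom S x y 0 1 - y i))) * f2 S x ^ 2 =
      3 * (f2 S x ^ 2 * h3 S x y) := by
    have : ∀ i ∈ S, (2 * y i * (d2 S x y - y i * (f1 S x - x i) - x i * (mom S x y 0 1 - y i))
        + x i * (h2 S x y - 2 * y i * (mom S x y 0 1 - y i))) * f2 S x ^ 2 =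
        (2 * f2 S x ^ 2 * d2 S x y) * (x i ^ 0 * y i ^ 1)
        - (2 * f2 S x ^ 2 * f1 S x) * (x i ^ 0 * y i ^ 2)
        + (6 * f2 S x ^ 2) * (x i ^ 1 * y i ^ 2)
        - (4 * f2 S x ^ 2 * mom S x y 0 1) * (x i ^ 1 * y i ^ 1)
        + (f2 S x ^ 2 * h2 S x y) * (x i ^ 1 * y i ^ 0) := fun i _ => by ring
    rw [Finset.sum_congr rfl this, Finset.sum_add_distrib, Finset.sum_sub_distrib,
      Finset.sum_add_distrib, Finset.sum_sub_distrib, ← Finset.mul_sum, ← Finset.mul_sum,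
      ← Finset.mul_sum, ← Finset.mul_sum, ← Finset.mul_sum]
    change 2 * f2 S x ^ 2 * d2 S x y * mom S x y 0 1 - 2 * f2 S x ^ 2 * f1 S x * mom S x y 0 2
      + 6 * f2 S x ^ 2 * mom S x y 1 2 - 4 * f2 S x ^ 2 * mom S x y 0 1 * mom S x y 1 1
      + f2 S x ^ 2 * h2 S x y * mom S x y 1 0 = _
    rw [← ps_eq_mom, ← f1]
    unfold h3 d2 h2
    ring
  have Rr : ∑ i ∈ S, (f2 S x * (x i * (f2 S x - x i * (f1 S x - x i))) * h2 S x y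
      + 2 * d2 S x y * (f2 S x * (y i * (f2 S x - x i * (f1 S x - x i))
        + x i * (d2 S x y - y i * (f1 S x - x i) - x i * (mom S x y 0 1 - y i)))
        - x i * (f2 S x - x i * (f1 S x - x i)) * d2 S x y)) =
      3 * (f2 S x * f3 S x * h2 S x y
      + 2 * d2 S x y * (f2 S x * d3 S x y - f3 S x * d2 S x y)) := by
    have : ∀ i ∈ S, f2 S x * (x i * (f2 S x - x i * (f1 S x - x i))) * h2 S x y
      + 2 * d2 S x y * (f2 S x * (y i * (f2 S x - x i * (f1 S x - x i))
        + x i * (d2 S x y - y i * (f1 S x - x i) - x i * (mom S x y 0 1 - y i)))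
        - x i * (f2 S x - x i * (f1 S x - x i)) * d2 S x y) =
        (f2 S x * h2 S x y - 2 * d2 S x y ^ 2) * f2 S x * (x i ^ 1 * y i ^ 0)
        - (f2 S x * h2 S x y - 2 * d2 S x y ^ 2) * f1 S x * (x i ^ 2 * y i ^ 0)
        + (f2 S x * h2 S x y - 2 * d2 S x y ^ 2) * (x i ^ 3 * y i ^ 0)
        + 2 * d2 S x y * f2 S x * f2 S x * (x i ^ 0 * y i ^ 1)
        - 4 * d2 S x y * f2 S x * f1 S x * (x i ^ 1 * y i ^ 1)
        + 6 * d2 S x y * f2 S x * (x i ^ 2 * y i ^ 1)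
        + 2 * d2 S x y * f2 S x * d2 S x y * (x i ^ 1 * y i ^ 0)
        - 2 * d2 S x y * f2 S x * mom S x y 0 1 * (x i ^ 2 * y i ^ 0) := fun i _ => by ring
    rw [Finset.sum_congr rfl this, Finset.sum_sub_distrib, Finset.sum_add_distrib,
      Finset.sum_add_distrib, Finset.sum_sub_distrib, Finset.sum_add_distrib,
      Finset.sum_add_distrib, Finset.sum_sub_distrib, ← Finset.mul_sum, ← Finset.mul_sum,
      ← Finset.mul_sum, ← Finset.mul_sum, ← Finset.mul_sum, ← Finset.mul_sum, ← Finset.mul_sum,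
      ← Finset.mul_sum]
    change (f2 S x * h2 S x y - 2 * d2 S x y ^ 2) * f2 S x * mom S x y 1 0
        - (f2 S x * h2 S x y - 2 * d2 S x y ^ 2) * f1 S x * mom S x y 2 0
        + (f2 S x * h2 S x y - 2 * d2 S x y ^ 2) * mom S x y 3 0
        + 2 * d2 S x y * f2 S x * f2 S x * mom S x y 0 1
        - 4 * d2 S x y * f2 S x * f1 S x * mom S x y 1 1
        + 6 * d2 S x y * f2 S x * mom S x y 2 1
        + 2 * d2 S x y * f2 S x * d2 S x y * mom S x y 1 0
        - 2 * d2 S x y * f2 S x * mom S x y 0 1 * mom S x y 2 0 = _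
    rw [← ps_eq_mom, ← ps_eq_mom, ← ps_eq_mom]
    have g1 : ps S x 1 = f1 S x := rfl
    have g2 : ps S x 2 = f1 S x ^ 2 - 2 * f2 S x := by unfold f1 f2; ring
    have g3 : ps S x 3 = f1 S x ^ 3 - 3 * f1 S x * f2 S x + 3 * f3 S x := by
      unfold f1 f2 f3; ring
    rw [g1, g2, g3]
    have g4 : mom S x y 2 1 = d3 S x y - f2 S x * mom S x y 0 1 + f1 S x * mom S x y 1 1 := by
      unfold d3; ring
    have g5 : mom S x y 1 1 = f1 S x * mom S x y 0 1 - d2 S x y := by unfold d2; ring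
    rw [g4, g5]
    ring
  rw [L, Rr] at hsum
  linarith

/-- Concavity of `√(σ₃ / σ₁)`, in the form used on level sets of `σ₃ - α σ₁`. -/
lemma concave_level_scalar {α e1 e2 e3 t D2 D3 H2 H3 : ℝ} (h1 : 0 < e1) (h2 : 0 < e2)
    (h3 : 0 < e3) (hα : 0 ≤ α) (hle : α * e1 ≤ e3) (hD : D3 = α * t)
    (c2 : e1 ^ 2 * H2 ≤ 2 * e1 * t * D2 - 2 * e2 * t ^ 2)
    (c3 : e2 ^ 2 * H3 ≤ e2 * e3 * H2 + 2 * D2 * (e2 * D3 - e3 * D2)) : H3 ≤ 0 := by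
  have a1 : e1 ^ 2 * (e2 ^ 2 * H3) ≤ e2 * e3 * (2 * e1 * t * D2 - 2 * e2 * t ^ 2)
      + e1 ^ 2 * (2 * D2 * (e2 * D3 - e3 * D2)) := by
    have := mul_le_mul_of_nonneg_left c3 (sq_nonneg e1)
    have := mul_le_mul_of_nonneg_left c2 (mul_pos h2 h3).le
    linarith
  have a2 : 0 ≤ t ^ 2 * ((e3 - α * e1) * (3 * e3 + α * e1)) := by
    have := mul_pos h1 h2
    have q : 0 ≤ α * e1 := mul_nonneg hα h1.le
    have : 0 ≤ e3 - α * e1 := by linarith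
    positivity
  have a3 := sq_nonneg (2 * e1 * e3 * D2 - (e1 * e2 * D3 + e2 * e3 * t))
  have a4 : e3 * (e1 ^ 2 * (e2 ^ 2 * H3)) ≤ 0 := by
    have := mul_le_mul_of_nonneg_left a1 h3.le
    subst hD
    have a5 := mul_nonneg (sq_nonneg e2) a2
    nlinarith
  by_contra hc
  push Not at hc
  have : 0 < e3 * (e1 ^ 2 * (e2 ^ 2 * H3)) := by positivity
  linarith

lemma h3_nonpos {α : ℝ} (hα : 0 ≤ α) {S : Finset ι} {x y : ι → ℝ} (h1 : 0 < f1 S x)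
    (hf2 : 0 < f2 S x) (hf3 : 0 < f3 S x) (hle : α * f1 S x ≤ f3 S x)
    (hy : ∑ i ∈ S, gG α S x i * y i = 0) : h3 S x y ≤ 0 := by
  rw [sum_gG_mul] at hy
  exact concave_level_scalar h1 hf2 hf3 hα hle (by linarith) (concave_two_one S x y)
    (concave_three_two y h1 hf2)

end HessQuot

namespace HessQuot

lemma sq_div_le_of_split {P F N M : ℝ} (hM : 0 < M) (hN : (199 / 200) * M ≤ N) :
    (26 / 25) * (P + F) ^ 2 / N ≤ (21 / 20) * (P ^ 2 / M) + 270 * (F ^ 2 / M) := by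
  have hN0 : 0 < N := by linarith
  have e : ((21 / 20) * (P ^ 2 / M) + 270 * (F ^ 2 / M)) =
    ((21 / 20) * P ^ 2 + 270 * F ^ 2) / M := by ring
  rw [e, div_le_div_iff₀ hN0 hM]
  have h1 : (26 / 25) * (P + F) ^ 2 ≤ (199 / 200) * ((21 / 20) * P ^ 2 + 270 * F ^ 2) := by
    nlinarith [sq_nonneg (P - 200 * F), sq_nonneg P, sq_nonneg F]
  have h2 := mul_le_mul_of_nonneg_right h1 hM.le
  have h3 : 0 ≤ (21 / 20) * P ^ 2 + 270 * F ^ 2 := by positivity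
  have h4 := mul_le_mul_of_nonneg_left hN h3
  linarith

lemma add_sq_le_three (a b c : ℝ) : (a + b + c) ^ 2 ≤ 3 * (a ^ 2 + b ^ 2 + c ^ 2) := by
  nlinarith [sq_nonneg (a - b), sq_nonneg (a - c), sq_nonneg (b - c)]

lemma pow_bound_le {C x a : ℝ} (k : ℕ) (hk : k ≤ 8) (hC : 1 ≤ C) (hx : 100000 * C ^ 8 ≤ x)
    (ha : a ≤ 100000 * C ^ k) : a ≤ x :=
  ha.trans ((by gcongr : (100000 : ℝ) * C ^ k ≤ 100000 * C ^ 8).trans hx)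

section
variable {α β C ψ x p1 p2 p3 ν γ : ℝ}

lemma nu_bounds (hC : 1 ≤ C) (hCα : 1 ≤ C * α) (hαC : α ≤ C) (hp1 : p1 ^ 2 ≤ α)
    (hp2 : |p2| ≤ C) (h2 : 2 * p2 ≤ p1 ^ 2) (hν : ν = α - p2) :
    α / 2 ≤ ν ∧ ν ≤ 2 * C ∧ 1 ≤ 2 * C * ν := by
  have := abs_le.1 hp2
  have h3 : α / 2 ≤ ν := by linarith
  have := mul_le_mul_of_nonneg_left h3 (zero_le_one.trans hC)
  exact ⟨h3, by linarith, by linarith⟩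

lemma star_denominator_bounds {N : ℝ} (hC : 1 ≤ C) (hν2 : ν ≤ 2 * C) (hν3 : 1 ≤ 2 * C * ν)
    (hγ : |γ| ≤ 3 * C ^ 2) (hNdef : N = x * ν + γ) (hx : 100000 * C ^ 8 ≤ x) :
    (199 / 200) * (x * ν) ≤ N ∧ N ≤ 3 * C * x ∧ 270 * (18 * C ^ 5) ≤ x * ν := by
  have hC0 : 0 < C := by linarith
  have hx0 : 0 < x := lt_of_lt_of_le (by positivity) hx
  have hγ' := abs_le.1 hγ
  have hxν : x ≤ 2 * C * (x * ν) := by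
    have := mul_le_mul_of_nonneg_left hν3 hx0.le
    linarith
  refine ⟨?_, ?_, ?_⟩
  · have h3 : 2 * C * (600 * C ^ 2) ≤ 2 * C * (x * ν) := by
      refine le_trans (pow_bound_le 3 (by norm_num) hC hx ?_) hxν
      have := pow_pos hC0 3
      linarith
    have h4 : 600 * C ^ 2 ≤ x * ν := le_of_mul_le_mul_left h3 (by positivity)
    linarith
  · have : 3 * C ≤ x := pow_bound_le 1 (by norm_num) hC hx (by linarith)
    have h1 := mul_le_mul_of_nonneg_left this hC0.le
    have h2 := mul_le_mul_of_nonneg_left hν2 hx0.le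
    linarith
  · have h3 : 2 * C * (270 * (18 * C ^ 5)) ≤ 2 * C * (x * ν) := by
      refine le_trans (pow_bound_le 6 (by norm_num) hC hx ?_) hxν
      have := pow_pos hC0 6
      linarith
    exact le_of_mul_le_mul_left h3 (by positivity)

lemma star_error_bound {t E E2 v : ℝ} (hC : 1 ≤ C) (hp1 : p1 ^ 2 ≤ C) (hv : 0 ≤ v)
    (hA0 : 0 ≤ x * p1 - ν) (hA1 : x * p1 - ν ≤ C) (ht : t ^ 2 ≤ C * v) (hE2 : E2 ^ 2 ≤ C ^ 5 * v)
    (hEC : E ^ 2 ≤ 4 * C * v) : (p1 * E - E2 - (x * p1 - ν) * t) ^ 2 ≤ 18 * C ^ 5 * v := by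
  have a1 := add_sq_le_three (p1 * E) (-E2) (-((x * p1 - ν) * t))
  have a2 : p1 ^ 2 * E ^ 2 ≤ C * (4 * C * v) := by gcongr
  have a3 : (x * p1 - ν) ^ 2 * t ^ 2 ≤ C ^ 2 * (C * v) := by gcongr
  have a4 : C ^ 2 ≤ C ^ 5 := pow_le_pow_right₀ hC (by norm_num)
  have a5 : C ^ 3 ≤ C ^ 5 := pow_le_pow_right₀ hC (by norm_num)
  have a6 := mul_le_mul_of_nonneg_right a4 hv
  have a7 := mul_le_mul_of_nonneg_right a5 hv
  have e : (p1 * E - E2 - (x * p1 - ν) * t) ^ 2 =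
    (p1 * E + -E2 + -((x * p1 - ν) * t)) ^ 2 := by ring
  have e' : (p1 * E) ^ 2 + (-E2) ^ 2 + (-((x * p1 - ν) * t)) ^ 2 =
    p1 ^ 2 * E ^ 2 + E2 ^ 2 + (x * p1 - ν) ^ 2 * t ^ 2 := by ring
  rw [e]
  rw [e'] at a1
  linarith

lemma star_fraction_bound {yj F E v N : ℝ} (hx : 0 < x) (hν : 0 < ν) (hv : 0 ≤ v)
    (hN : (199 / 200) * (x * ν) ≤ N) (hF : F ^ 2 ≤ 18 * C ^ 5 * v)
    (hxν : 270 * (18 * C ^ 5) ≤ x * ν) (hE : E ^ 2 ≤ 2 * ν * v) (hp : ν ≤ x * p1) :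
    (26 / 25) * (ν * yj + x * E + F) ^ 2 / N ≤
      (8 / 5) * (p1 * yj ^ 2) + 2 * (yj * E) + (23 / 10) * (x * v) + v := by
  have hM : 0 < x * ν := by positivity
  have b1 := sq_div_le_of_split (P := ν * yj + x * E) (F := F) hM hN
  have b2 : 270 * (F ^ 2 / (x * ν)) ≤ v := by
    rw [← mul_div_assoc, div_le_iff₀ hM]
    have := mul_le_mul_of_nonneg_right hxν hv
    linarith
  obtain ⟨a, ha⟩ : ∃ a, a = yj ^ 2 / x := ⟨_, rfl⟩
  obtain ⟨e, he⟩ : ∃ e, e = x * E ^ 2 / ν := ⟨_, rfl⟩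
  have ha0 : 0 ≤ a := by rw [ha]; positivity
  have b3 : (ν * yj + x * E) ^ 2 / (x * ν) = ν * a + 2 * (yj * E) + e := by
    rw [ha, he]; field_simp; ring
  have b4 : e ≤ 2 * (x * v) := by
    rw [he, div_le_iff₀ hν]
    have := mul_le_mul_of_nonneg_left hE hx.le
    linarith
  have b5 : 0 ≤ ν * a - 2 * (yj * E) + e := by
    have : ν * a - 2 * (yj * E) + e = (ν * yj - x * E) ^ 2 / (x * ν) := by
      rw [ha, he]; field_simp; ring
    rw [this]; positivity
  have b6 : ν * a ≤ p1 * yj ^ 2 := by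
    rw [ha, ← mul_div_assoc, div_le_iff₀ hx]
    have := mul_le_mul_of_nonneg_right hp (sq_nonneg yj)
    linarith
  have := mul_nonneg hν.le ha0
  rw [b3] at b1
  refine b1.trans ?_
  have hxv := mul_nonneg hx.le hv
  linarith

lemma star_large_scalar {yj t E E2 v m A' N : ℝ} (hC : 1 ≤ C) (hCα : 1 ≤ C * α) (hαC : α ≤ C)
    (hp : 0 < p1) (hpx : p1 * x ≤ C) (hp1 : p1 ^ 2 ≤ α) (hp2 : |p2| ≤ C)
    (h2 : 2 * p2 ≤ p1 ^ 2) (hν : ν = α - p2) (hγ : |γ| ≤ 3 * C ^ 2) (hv : 0 ≤ v)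
    (ht : t ^ 2 ≤ C * v) (hE : E ^ 2 ≤ (p1 ^ 2 - 2 * p2) * v) (hE2 : E2 ^ 2 ≤ C ^ 5 * v)
    (hm : |m| ≤ C * v) (hψ : x ≤ 3 * ψ) (hNdef : N = x * ν + γ) (heq : (x * p1 - ν) * ψ = N)
    (hA' : A' = p1 * yj + x * t + (p1 * t - E)) (hx : 100000 * C ^ 8 ≤ x) :
    0 ≤ 2 * p1 * yj ^ 2 + 3 * x * v + 3 * p1 * v - 4 * m - x * t ^ 2 + 2 * t * E - t ^ 2 * p1
      + 2 * yj * (E - p1 * t)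
      - (26 / 25) * (ν * yj + x * E + (p1 * E - E2 - (x * p1 - ν) * t)) ^ 2 / N
      + (23 / 50) * (ψ ^ 2 / N) * A' ^ 2 := by
  obtain ⟨hν1, hν2, hν3⟩ := nu_bounds hC hCα hαC hp1 hp2 h2 hν
  obtain ⟨hN1, hN2, hN3⟩ := star_denominator_bounds hC hν2 hν3 hγ hNdef hx
  have hC0 : 0 < C := by linarith
  have hC2 : C ≤ C ^ 2 := le_self_pow₀ hC (by norm_num)
  have hx1 : 100000 ≤ x := pow_bound_le 0 (by norm_num) hC hx (by norm_num)
  have hx130 : 130 * C ^ 2 ≤ x :=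
    pow_bound_le 2 (by norm_num) hC hx (by have := pow_pos hC0 2; linarith)
  have hx300 : 300 * C ≤ x := pow_bound_le 1 (by norm_num) hC hx (by linarith)
  have hx0 : 0 < x := by linarith
  have hα : 0 < α := pos_of_mul_pos_right (by linarith : 0 < C * α) hC0.le
  have hν0 : 0 < ν := by linarith
  have hψ0 : 0 < ψ := by linarith
  have hM : 0 < x * ν := by positivity
  have hN0 : 0 < N := by linarith
  have hA0 : 0 < x * p1 - ν := pos_of_mul_pos_left (heq ▸ hN0) hψ0.le
  have hpC : p1 ≤ C := (le_mul_of_one_le_right hp.le (by linarith)).trans hpx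
  have hE' : E ^ 2 ≤ 2 * ν * v :=
    hE.trans (mul_le_mul_of_nonneg_right (by linarith) hv)
  have hEC : E ^ 2 ≤ 4 * C * v :=
    hE'.trans (mul_le_mul_of_nonneg_right (by linarith) hv)
  have hF := star_error_bound hC (hp1.trans hαC) hv hA0.le (by linarith) ht hE2 hEC
  have b1 := star_fraction_bound (p1 := p1) (yj := yj) hx0 hν0 hv hN1 hF hN3 hE' (by linarith)
  have hyp : 0 ≤ p1 * yj ^ 2 := by positivity
  -- the term `2 yj p1 t`
  have c1 : 2 * (yj * (p1 * t)) ≤ (1 / 10) * (p1 * yj ^ 2) + v := by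
    have h3 : 10 * (p1 * t ^ 2) ≤ v := by
      have h5 : 10 * (p1 * t ^ 2) * x ≤ v * x := by
        have h7 : 10 * (p1 * x) * t ^ 2 ≤ 10 * C * (C * v) := by gcongr
        have h8 := mul_le_mul_of_nonneg_left hx130 hv
        have h9 : 0 ≤ v * C ^ 2 := by positivity
        linarith
      exact le_of_mul_le_mul_right h5 hx0
    have h4 := mul_nonneg hp.le (sq_nonneg (yj - 10 * t))
    linarith
  -- the term `x t²`
  have c2 : x * t ^ 2 ≤ 3 / x * A' ^ 2 + (1 / 100) * (p1 * yj ^ 2) + v := by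
    have h3 : x ^ 2 * t ^ 2 ≤ 3 * (A' ^ 2 + (-(p1 * yj)) ^ 2 + (-(p1 * t - E)) ^ 2) := by
      have : x * t = A' + -(p1 * yj) + -(p1 * t - E) := by rw [hA']; ring
      rw [← mul_pow, this]
      exact add_sq_le_three _ _ _
    have h4 : 3 * (p1 * t - E) ^ 2 ≤ x * v := by
      have h5 : p1 ^ 2 * t ^ 2 ≤ C * (C * v) := by gcongr; exact hp1.trans hαC
      have h6 := mul_le_mul_of_nonneg_right hC2 hv
      have h7 := sq_nonneg (p1 * t + E)
      have h8 := mul_le_mul_of_nonneg_right hx130 hv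
      have h9 : 0 ≤ C ^ 2 * v := by positivity
      linarith
    have h5 : 3 * (p1 * yj) ^ 2 ≤ x * ((1 / 100) * (p1 * yj ^ 2)) := by
      have : 300 * p1 ≤ x := by linarith
      have := mul_le_mul_of_nonneg_right this hyp
      linarith
    have h6 : x * (x * t ^ 2) ≤ x * (3 / x * A' ^ 2 + (1 / 100) * (p1 * yj ^ 2) + v) := by
      have : x * (3 / x * A' ^ 2) = 3 * A' ^ 2 := by field_simp
      linarith
    exact le_of_mul_le_mul_left h6 hx0
  have c3 : 3 / x * A' ^ 2 ≤ (23 / 50) * (ψ ^ 2 / N) * A' ^ 2 := by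
    refine mul_le_mul_of_nonneg_right ?_ (sq_nonneg _)
    rw [← mul_div_assoc, div_le_div_iff₀ hx0 hN0]
    have h3 : x ^ 2 ≤ 9 * ψ ^ 2 := by
      have := pow_le_pow_left₀ hx0.le hψ 2
      linarith
    have h6 : (300 * C) * x ≤ x * x * x := by
      have h5 : 300 * C * x ≤ x * x := by gcongr
      have h6 := mul_le_mul_of_nonneg_left (by linarith : 1 ≤ x) (mul_nonneg hx0.le hx0.le)
      linarith
    have := mul_le_mul_of_nonneg_right h3 hx0.le
    linarith
  -- remaining errors
  have d1 : 0 ≤ 3 * p1 * v := by positivity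
  have d2 : 4 * m ≤ 4 * (C * v) := by linarith [(abs_le.1 hm).2]
  have d3 : -(5 * (C * v)) ≤ 2 * t * E := by
    have := sq_nonneg (t + E)
    linarith
  have d4 : t ^ 2 * p1 ≤ C * v * C := by gcongr
  have d5 : 4 * (C * v) + 5 * (C * v) + C * v * C + 3 * v ≤ (1 / 10) * (x * v) := by
    have h3 : 9 * C + C * C + 3 ≤ 13 * C ^ 2 := by linarith
    have h4 := mul_le_mul_of_nonneg_right h3 hv
    have h5 := mul_le_mul_of_nonneg_right hx130 hv
    linarith
  have hxv : 0 ≤ x * v := by positivity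
  have e1 : 2 * yj * (E - p1 * t) = 2 * (yj * E) - 2 * (yj * (p1 * t)) := by ring
  have e2 : 2 * p1 * yj ^ 2 = 2 * (p1 * yj ^ 2) := by ring
  rw [e1, e2]
  linarith

end
end HessQuot

namespace HessQuot

variable {ι : Type*} [DecidableEq ι]

lemma star_reduce {ψ A α yk A' Nn w s Y η d l : ℝ} (hψ : 0 < ψ) (hA : 0 < A)
    (hyk : A * yk = Nn - ψ * A') (hη : w - s ^ 2 = η + 2 * (A + α) * Y ^ 2 - 2 * Y * A')
    (hΦ : 0 ≤ 3 * d - l - (26 / 25) * Nn ^ 2 / (A * ψ) + (23 / 50) * (ψ ^ 2 / (A * ψ)) * A' ^ 2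
      + ψ * η + 2 * α * ψ * Y ^ 2) :
    (51 / 50) * A * yk ^ 2 ≤ ψ * (-(2 * yk * A' + ψ * (s ^ 2 - w)) + (d - l) + 2 * d) := by
  have h1 : yk = (Nn - ψ * A') / A := by rw [eq_div_iff hA.ne']; linarith
  have h2 : η = w - s ^ 2 - 2 * (A + α) * Y ^ 2 + 2 * Y * A' := by linarith
  have h3 : ψ * (-(2 * yk * A' + ψ * (s ^ 2 - w)) + (d - l) + 2 * d) - (51 / 50) * A * yk ^ 2 =
    ψ * (3 * d - l - (26 / 25) * Nn ^ 2 / (A * ψ) + (23 / 50) * (ψ ^ 2 / (A * ψ)) * A' ^ 2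
      + ψ * η + 2 * α * ψ * Y ^ 2) + (1 / 50) * (ψ * A' + Nn) ^ 2 / A
      + ψ ^ 2 * (2 * A * Y - A') ^ 2 / (2 * A) := by
    rw [h1, h2]; field_simp; ring
  have h4 : 0 ≤ ψ * (3 * d - l - (26 / 25) * Nn ^ 2 / (A * ψ)
      + (23 / 50) * (ψ ^ 2 / (A * ψ)) * A' ^ 2
      + ψ * η + 2 * α * ψ * Y ^ 2) := mul_nonneg hψ.le hΦ
  have h5 : 0 ≤ (1 / 50) * (ψ * A' + Nn) ^ 2 / A := by positivity
  have h6 : 0 ≤ ψ ^ 2 * (2 * A * Y - A') ^ 2 / (2 * A) := by positivity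
  linarith

lemma star_small_scalar {ψ N A' α Nn w Y η d l K1 K2 K3 c0 m : ℝ} (hd : 0 ≤ d)
    (hl : l ≤ K1 * w) (hN : Nn ^ 2 ≤ K2 * w) (hc0 : 0 < c0) (hcN : c0 ≤ N) (hη0 : 0 ≤ η)
    (hw : w ≤ 2 * η + 2 * K3 * Y ^ 2) (hK1 : 0 ≤ K1) (hK2 : 0 ≤ K2) (hK3 : 1 ≤ K3) (hw0 : 0 ≤ w)
    (hm1 : m ≤ 1) (hm2 : m ≤ 2 * α) (hψ0 : 0 ≤ ψ)
    (hψ : 2 * K3 * (K1 + 2 * K2 / c0) ≤ m * ψ) :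
    0 ≤ 3 * d - l - (26 / 25) * Nn ^ 2 / N + (23 / 50) * (ψ ^ 2 / N) * A' ^ 2
      + ψ * η + 2 * α * ψ * Y ^ 2 := by
  have hN0 : 0 < N := hc0.trans_le hcN
  have h1 : (26 / 25) * Nn ^ 2 / N ≤ 2 * K2 / c0 * w := by
    have : 2 * K2 / c0 * w = (2 * K2 * w) / c0 := by ring
    rw [this]
    exact div_le_div₀ (by positivity) (by nlinarith [sq_nonneg Nn]) hc0 hcN
  have h2 : 0 ≤ (23 / 50) * (ψ ^ 2 / N) * A' ^ 2 := by positivity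
  have hK : 0 ≤ K1 + 2 * K2 / c0 := by positivity
  have h3 : (K1 + 2 * K2 / c0) * w ≤ (2 * K3 * (K1 + 2 * K2 / c0)) * (η + Y ^ 2) := by
    have a1 := mul_le_mul_of_nonneg_left hw hK
    have a2 := mul_nonneg (mul_nonneg hK hη0) (sub_nonneg.2 hK3)
    linarith
  have h4 := mul_le_mul_of_nonneg_right hψ (add_nonneg hη0 (sq_nonneg Y))
  have h5 := mul_le_mul_of_nonneg_right hm1 (mul_nonneg hψ0 hη0)
  have h6 := mul_le_mul_of_nonneg_right hm2 (mul_nonneg hψ0 (sq_nonneg Y))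
  linarith

lemma mom_sq_le (S : Finset ι) (x y : ι → ℝ) (a : ℕ) :
    mom S x y a 1 ^ 2 ≤ mom S x y (2 * a) 0 * mom S x y 0 2 := by
  have := Finset.sum_mul_sq_le_sq_mul_sq S (fun i => x i ^ a) y
  unfold mom
  simpa [← pow_mul, mul_comm a 2] using this

lemma mom_le_of_bdd {S : Finset ι} {x : ι → ℝ} {B : ℝ} (hB : ∀ i ∈ S, |x i| ≤ B) (y : ι → ℝ)
    (a b : ℕ) : |mom S x y a (2 * b)| ≤ B ^ a * mom S x y 0 (2 * b) := by
  unfold mom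
  refine (Finset.abs_sum_le_sum_abs _ _).trans ?_
  rw [Finset.mul_sum]
  refine Finset.sum_le_sum fun i hi => ?_
  rw [abs_mul, abs_pow, pow_mul (y i), abs_pow, abs_of_nonneg (sq_nonneg (y i)), pow_zero, one_mul]
  have := hB i hi
  gcongr

lemma mom_zero_two_nonneg (S : Finset ι) (x y : ι → ℝ) : 0 ≤ mom S x y 0 2 := by
  unfold mom; exact Finset.sum_nonneg fun i _ => by positivity

lemma sum_sub_mul_sq (S : Finset ι) (x y : ι → ℝ) (c : ℝ) :
    ∑ i ∈ S, (c - x i) * y i ^ 2 = c * mom S x y 0 2 - mom S x y 1 2 := by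
  unfold mom
  rw [Finset.mul_sum, ← Finset.sum_sub_distrib]
  exact Finset.sum_congr rfl fun i _ => by ring

lemma sum_sub_smul_sq (S : Finset ι) (x y : ι → ℝ) (c : ℝ) :
    ∑ i ∈ S, (y i - c * x i) ^ 2 =
      mom S x y 0 2 - 2 * c * mom S x y 1 1 + c ^ 2 * mom S x y 2 0 := by
  unfold mom
  rw [Finset.mul_sum, Finset.mul_sum, ← Finset.sum_sub_distrib, ← Finset.sum_add_distrib]
  exact Finset.sum_congr rfl fun i _ => by ring

lemma mom_two_zero (S : Finset ι) (x y : ι → ℝ) :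
    mom S x y 2 0 = f1 S x ^ 2 - 2 * f2 S x := by
  rw [← sq_sum_eq]; simp [mom]

section
variable {α β κ : ℝ} (hα : 0 < α) (hβ : 0 ≤ β) (hκ : 0 ≤ κ) (S : Finset ι)

/-- The form to be estimated, after singling out the index `k`. -/
lemma star_of_phi {x y : ι → ℝ} {k : ι} {S : Finset ι} (hk : k ∈ S) (hψ : 0 < x k)
    (hA : 0 < gG α S x k) (hs1 : 0 < f1 (S.erase k) x)
    (hy : ∑ i ∈ S, gG α S x i * y i = 0)
    (hΦ : ∀ w s l m Y A' Nn : ℝ, w = mom (S.erase k) x y 0 2 → s = mom (S.erase k) x y 0 1 →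
      l = mom (S.erase k) x y 1 1 → m = mom (S.erase k) x y 1 2 → Y = s / f1 (S.erase k) x →
      A' = f1 (S.erase k) x * s - l →
      Nn = f1 (S.erase k) x * l - mom (S.erase k) x y 2 1 - gG α S x k * s →
      0 ≤ 3 * (f1 (S.erase k) x * w - m) - (m - 2 * s * l + s ^ 2 * f1 (S.erase k) x)
        - (26 / 25) * Nn ^ 2 / (gG α S x k * x k)
        + (23 / 50) * (x k ^ 2 / (gG α S x k * x k)) * A' ^ 2
        + x k * (∑ i ∈ S.erase k, (y i - Y * x i) ^ 2) + 2 * α * x k * Y ^ 2) :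
    (51 / 50) * gG α S x k * y k ^ 2 ≤
      x k * (-h3 S x y + 2 * ∑ i ∈ S.erase k, (f1 S x - x k - x i) * y i ^ 2) := by
  have h := hΦ _ _ _ _ _ _ _ rfl rfl rfl rfl rfl rfl rfl
  have e1 := f1_erase hk x
  have e2 := f2_erase hk x
  have hs : f1 S x - x k = f1 (S.erase k) x := by rw [e1]; ring
  rw [hs, sum_sub_mul_sq]
  have hg : f2 (S.erase k) x = gG α S x k + α := by unfold gG; ring
  rw [sum_gG_mul] at hy
  have key := star_reduce (yk := y k) (w := mom (S.erase k) x y 0 2)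
    (s := mom (S.erase k) x y 0 1) hψ hA ?_ ?_ h
  · convert key using 2
    unfold h3
    rw [e1, mom_erase hk x y 0 1, mom_erase hk x y 0 2, mom_erase hk x y 1 1, mom_erase hk x y 1 2]
    ring
  · unfold d3 at hy
    rw [e1, e2, mom_erase hk x y 0 1, mom_erase hk x y 1 1, mom_erase hk x y 2 1, hg] at hy
    linear_combination hy
  · rw [sum_sub_smul_sq, mom_two_zero, hg]
    have : mom (S.erase k) x y 0 1 / f1 (S.erase k) x * f1 (S.erase k) x =
      mom (S.erase k) x y 0 1 := div_mul_cancel₀ _ hs1.ne'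
    generalize mom (S.erase k) x y 0 1 / f1 (S.erase k) x = Y at *
    rw [← this]; ring

end
end HessQuot

namespace HessQuot

variable {ι : Type*} [DecidableEq ι]

section
variable {α β κ : ℝ} (hα : 0 < α) (hβ : 0 ≤ β) (hκ : 0 ≤ κ) (S : Finset ι)

lemma mom_even_le {S : Finset ι} {x : ι → ℝ} {B : ℝ} (hB : ∀ i ∈ S, |x i| ≤ B) (y : ι → ℝ)
    (a : ℕ) : mom S x y (2 * a) 0 ≤ S.card * B ^ (2 * a) := by
  unfold mom
  rw [← nsmul_eq_mul]
  refine Finset.sum_le_card_nsmul _ _ _ fun i hi => ?_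
  rw [pow_zero, mul_one, pow_mul, ← sq_abs, pow_mul]
  have := hB i hi
  gcongr

lemma mom_sq_le_of_bdd {S : Finset ι} {x : ι → ℝ} {B : ℝ} (hB : ∀ i ∈ S, |x i| ≤ B) (y : ι → ℝ)
    (a : ℕ) : mom S x y a 1 ^ 2 ≤ S.card * B ^ (2 * a) * mom S x y 0 2 :=
  (mom_sq_le S x y a).trans
    (mul_le_mul_of_nonneg_right (mom_even_le hB y a) (mom_zero_two_nonneg S x y))

lemma two_mul_le_sq_add {n B w s l : ℝ} (hB : 1 ≤ B)
    (hs : s ^ 2 ≤ n * w) (hl : l ^ 2 ≤ n * B ^ 2 * w) : -2 * s * l ≤ B * (2 * n * w) := by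
  have hB0 : 0 < B := by linarith
  have h1 := sq_nonneg (B * s + l)
  have h2 : B * (-2 * s * l) ≤ B * (B * (2 * n * w)) := by
    have := mul_le_mul_of_nonneg_left hs (sq_nonneg B)
    nlinarith
  exact le_of_mul_le_mul_left h2 hB0

include hα hβ hκ in
/-- The case in which all entries but the `k`-th are bounded. -/
lemma exists_star_bounded (X0 : ℝ) : ∃ Ψ : ℝ, 1 ≤ Ψ ∧ ∀ x : ι → ℝ, Adm α β κ S x →
    ∀ k ∈ S, Ψ ≤ x k →
    (∀ i ∈ S, i ≠ k → x i ≤ X0) → ∀ y : ι → ℝ, ∑ i ∈ S, gG α S x i * y i = 0 →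
    (51 / 50) * gG α S x k * y k ^ 2 ≤
      x k * (-h3 S x y + 2 * ∑ i ∈ S.erase k, (f1 S x - x k - x i) * y i ^ 2) := by
  obtain ⟨B, hB⟩ : ∃ B : ℝ, B = 1 + |X0| + κ := ⟨_, rfl⟩
  obtain ⟨n, hn⟩ : ∃ n : ℝ, n = 1 + (S.card : ℝ) := ⟨_, rfl⟩
  have hB1 : 1 ≤ B := by rw [hB]; have := abs_nonneg X0; linarith
  have hn1 : 1 ≤ n := by rw [hn]; have : (0:ℝ) ≤ S.card := Nat.cast_nonneg _; linarith
  obtain ⟨m, hm⟩ : ∃ m : ℝ, m = min 1 (2 * α) := ⟨_, rfl⟩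
  have hm0 : 0 < m := by rw [hm]; exact lt_min one_pos (by linarith)
  have hm1 : m ≤ 1 := by rw [hm]; exact min_le_left _ _
  have hm2 : m ≤ 2 * α := by rw [hm]; exact min_le_right _ _
  obtain ⟨K1, hK1⟩ : ∃ t : ℝ, t = 4 * B * n ^ 2 := ⟨_, rfl⟩
  obtain ⟨K2, hK2⟩ : ∃ t : ℝ, t = 9 * n ^ 5 * B ^ 4 := ⟨_, rfl⟩
  obtain ⟨c0, hc0⟩ : ∃ t : ℝ, t = α * m / 3 := ⟨_, rfl⟩
  have hc0p : 0 < c0 := by rw [hc0]; positivity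
  have hK1p : 0 ≤ K1 := by rw [hK1]; positivity
  have hK2p : 0 ≤ K2 := by rw [hK2]; positivity
  have hK3 : 1 ≤ n * B ^ 2 := one_le_mul_of_one_le_of_one_le hn1 (one_le_pow₀ hB1)
  refine ⟨1 + n * B + 2 * (n * B ^ 2) * (K1 + 2 * K2 / c0) / m, ?_, ?_⟩
  · have : 0 ≤ n * B + 2 * (n * B ^ 2) * (K1 + 2 * K2 / c0) / m := by positivity
    linarith
  intro x hx k hk hψ hX y hy
  have hnB : 0 ≤ n * B := by positivity
  have hterm : 0 ≤ 2 * (n * B ^ 2) * (K1 + 2 * K2 / c0) / m := by positivity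
  have hψ0 : 0 < x k := by linarith
  have hψ1 : n * B ≤ x k := by linarith
  have hψ2 : 2 * (n * B ^ 2) * (K1 + 2 * K2 / c0) ≤ m * x k := by
    rw [← div_le_iff₀' hm0]; linarith
  clear hψ
  have sp := hx.split hα hβ hk
  have hA : 0 < gG α S x k := hx.gG_pos hα hβ hk
  refine star_of_phi hk hψ0 hA sp.s1pos hy ?_
  have hbd : ∀ i ∈ S.erase k, |x i| ≤ B := fun i hi => by
    have h1 := hX i (Finset.mem_of_mem_erase hi) (Finset.ne_of_mem_erase hi)
    have h2 := hx.low i (Finset.mem_of_mem_erase hi)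
    have h3 := le_abs_self X0
    have := abs_nonneg X0
    rw [abs_le, hB]; constructor <;> linarith
  have hcard : ((S.erase k).card : ℝ) ≤ n := by
    have : ((S.erase k).card : ℝ) ≤ S.card := by exact_mod_cast Finset.card_erase_le
    linarith
  have hs1 : f1 (S.erase k) x ≤ n * B := by
    rw [f1_eq_sum]
    calc ∑ i ∈ S.erase k, x i ≤ (S.erase k).card • B :=
          Finset.sum_le_card_nsmul _ _ _ fun i hi => (abs_le.1 (hbd i hi)).2
      _ ≤ n * B := by rw [nsmul_eq_mul]; gcongr
  have hD : 0 ≤ ∑ i ∈ S.erase k, (f1 (S.erase k) x - x i) * y i ^ 2 := by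
    refine Finset.sum_nonneg fun i hi => mul_nonneg ?_ (sq_nonneg _)
    have := f1_erase_pos sp.s1pos sp.s2pos hi
    rw [f1_erase hi x]; linarith
  rw [sum_sub_mul_sq] at hD
  intro w s l mm Y A' Nn hw hs hl hmm hY hA' hNn
  have hw0 : 0 ≤ w := hw ▸ mom_zero_two_nonneg _ _ _
  have hgen : ∀ a, mom (S.erase k) x y a 1 ^ 2 ≤ n * B ^ (2 * a) * w := fun a => by
    rw [hw]
    refine (mom_sq_le_of_bdd hbd y a).trans ?_
    have := mom_zero_two_nonneg (S.erase k) x y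
    gcongr
  have hs2 : s ^ 2 ≤ n * w := by rw [hs]; simpa using hgen 0
  have hl2 : l ^ 2 ≤ n * B ^ 2 * w := by rw [hl]; simpa using hgen 1
  have hq2 : mom (S.erase k) x y 2 1 ^ 2 ≤ n * B ^ 4 * w := by simpa using hgen 2
  have hmm2 : mm ≤ B * w := by
    have := (abs_le.1 (mom_le_of_bdd hbd y 1 1)).2
    rw [hmm, hw]; simpa using this
  have hA2 : gG α S x k ≤ n ^ 2 * B ^ 2 := by
    have h1 := sp.macl
    have h2 : f1 (S.erase k) x ^ 2 ≤ (n * B) ^ 2 := pow_le_pow_left₀ sp.s1pos.le hs1 2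
    have : 0 ≤ (n * B) ^ 2 := sq_nonneg _
    rw [gG, ← mul_pow]; linarith
  have hwn : w ≤ n * w := le_mul_of_one_le_left hw0 hn1
  refine star_small_scalar (K1 := K1) (K2 := K2) (K3 := n * B ^ 2) (c0 := c0) (m := m) ?_ ?_ ?_
    hc0p ?_ ?_ ?_ hK1p hK2p hK3 hw0 hm1 hm2 hψ0.le hψ2
  · rw [hw, hmm]; exact hD
  · have h1 : s ^ 2 * f1 (S.erase k) x ≤ (n * w) * (n * B) := by
      have := sp.s1pos.le
      gcongr
    have h2 := two_mul_le_sq_add hB1 hs2 hl2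
    have h3 : n * (B * w) ≤ n * (n * (B * w)) := by
      have : 0 ≤ n * (B * w) := by positivity
      exact le_mul_of_one_le_left this hn1
    have h4 : B * w ≤ n * (B * w) := le_mul_of_one_le_left (by positivity) hn1
    rw [hK1]
    linarith
  · have a1 := add_sq_le_three (f1 (S.erase k) x * l) (-mom (S.erase k) x y 2 1)
      (-(gG α S x k * s))
    have e : f1 (S.erase k) x * l + -mom (S.erase k) x y 2 1 + -(gG α S x k * s) = Nn := by
      rw [hNn]; ring
    rw [e] at a1
    have a2 : f1 (S.erase k) x ^ 2 * l ^ 2 ≤ (n * B) ^ 2 * (n * B ^ 2 * w) := by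
      have := sp.s1pos.le
      gcongr
    have a3 : gG α S x k ^ 2 * s ^ 2 ≤ (n ^ 2 * B ^ 2) ^ 2 * (n * w) := by gcongr
    have a4 : n * B ^ 4 * w ≤ n ^ 5 * B ^ 4 * w := by
      gcongr; exact le_self_pow₀ hn1 (by norm_num)
    have a5 : n ^ 3 * B ^ 4 * w ≤ n ^ 5 * B ^ 4 * w := by
      gcongr
      norm_num
    rw [hK2]
    linarith
  · have h1 := sp.G_key hα hβ
    have h2 : (f2 (S.erase k) x - α) * (3 * x k + f1 (S.erase k) x) ≤
        (f2 (S.erase k) x - α) * (6 * x k) :=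
      mul_le_mul_of_nonneg_left (by linarith) hA.le
    have h3 : m ≤ f1 (S.erase k) x := by
      have h4 := sp.s1_sq hα hβ
      by_contra hc
      push Not at hc
      have : f1 (S.erase k) x ^ 2 ≤ f1 (S.erase k) x := by
        have := mul_le_mul_of_nonneg_left (by linarith : f1 (S.erase k) x ≤ 1) sp.s1pos.le
        linarith
      linarith
    have h5 := mul_le_mul_of_nonneg_left h3 hα.le
    rw [hc0, gG]
    linarith
  · exact Finset.sum_nonneg fun i _ => sq_nonneg _
  · have h1 : ∀ i ∈ S.erase k, y i ^ 2 ≤ 2 * (y i - Y * x i) ^ 2 + 2 * Y ^ 2 * x i ^ 2 :=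
      fun i _ => by nlinarith [sq_nonneg (y i - Y * x i - Y * x i)]
    have h2 := Finset.sum_le_sum h1
    rw [Finset.sum_add_distrib, ← Finset.mul_sum, ← Finset.mul_sum] at h2
    have h3 : ∑ i ∈ S.erase k, x i ^ 2 ≤ n * B ^ 2 := by
      have h4 := mom_even_le hbd y 1
      have : ((S.erase k).card : ℝ) * B ^ 2 ≤ n * B ^ 2 := by gcongr
      simp only [mom, mul_one, pow_zero] at h4
      linarith
    have h5 : w = ∑ i ∈ S.erase k, y i ^ 2 := by rw [hw]; simp [mom]
    have h6 := mul_le_mul_of_nonneg_left h3 (sq_nonneg Y)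
    rw [h5]
    linarith

lemma Tail.mono {α C C' X : ℝ} {R : Finset ι} {x : ι → ℝ} (h : Tail α C R x X) (hC : C ≤ C') :
    Tail α C' R x X :=
  ⟨h.pos, h.small.trans hC, h.sq_le, fun i hi => (h.bdd i hi).trans hC, h.b2.trans hC,
    h.b3.trans hC⟩

include hα hβ hκ in
/-- The case in which the second largest entry is large. -/
lemma exists_star_unbounded : ∃ X0 : ℝ, ∀ x : ι → ℝ, Adm α β κ S x → ∀ k ∈ S, ∀ j ∈ S, j ≠ k →
    (∀ i ∈ S, i ≠ k → x i ≤ x j) → x j ≤ 3 * x k → X0 ≤ x j →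
    ∀ y : ι → ℝ, ∑ i ∈ S, gG α S x i * y i = 0 →
    (51 / 50) * gG α S x k * y k ^ 2 ≤
      x k * (-h3 S x y + 2 * ∑ i ∈ S.erase k, (f1 S x - x k - x i) * y i ^ 2) := by
  obtain ⟨X0, C1, hX0, hC1, hT⟩ := exists_tail hα hβ hκ S 3 (by norm_num)
  obtain ⟨C, hC⟩ : ∃ C : ℝ, C = C1 + α + 1 / α + β + (S.card : ℝ) := ⟨_, rfl⟩
  have hcn : (0:ℝ) ≤ S.card := Nat.cast_nonneg _
  have hαi : 0 < 1 / α := by positivity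
  have hCC1 : C1 ≤ C := by rw [hC]; linarith
  have hC1' : 1 ≤ C := hC1.trans hCC1
  have hC0 : 0 < C := by linarith
  have hαC : α ≤ C := by rw [hC]; linarith
  have hβC : β ≤ C := by rw [hC]; linarith
  have hnC : (S.card : ℝ) ≤ C := by rw [hC]; linarith
  have hCα : 1 ≤ C * α := by
    have h1 : 1 / α ≤ C := by rw [hC]; linarith
    rwa [div_le_iff₀ hα] at h1
  clear hC
  refine ⟨max X0 (100000 * C ^ 8), ?_⟩
  intro x hx k hk j hj hjk hmax h3 hlarge y hy
  have T := (hT x hx k hk j hj hjk hmax h3 ((le_max_left _ _).trans hlarge)).mono hCC1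
  have hlx : 100000 * C ^ 8 ≤ x j := (le_max_right _ _).trans hlarge
  have hx0 : 0 < x j := lt_of_lt_of_le (by positivity) hlx
  have hψ0 : 0 < x k := by linarith
  have hj' : j ∈ S.erase k := Finset.mem_erase.2 ⟨hjk, hj⟩
  have sp := hx.split hα hβ hk
  have hA : 0 < gG α S x k := hx.gG_pos hα hβ hk
  refine star_of_phi hk hψ0 hA sp.s1pos hy ?_
  intro w s l mm Y A' Nn hw hs hl hmm hY hA' hNn
  obtain ⟨R, hR⟩ : ∃ R, R = (S.erase k).erase j := ⟨_, rfl⟩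
  rw [← hR] at T
  have hx1 : 1 ≤ x j := pow_bound_le 0 (by norm_num) hC1' hlx (by norm_num)
  have hcard : (R.card : ℝ) ≤ C := by
    have h1 : R.card ≤ S.card := by
      rw [hR]; exact Finset.card_erase_le.trans Finset.card_erase_le
    have : (R.card : ℝ) ≤ S.card := by exact_mod_cast h1
    linarith
  have e1 : f1 (S.erase k) x = x j + f1 R x := hR ▸ f1_erase hj' x
  have e2 : f2 (S.erase k) x = x j * f1 R x + f2 R x := hR ▸ f2_erase hj' x
  have e3 : f3 (S.erase k) x = x j * f2 R x + f3 R x := hR ▸ f3_erase hj' x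
  have em : ∀ a b, mom (S.erase k) x y a b = x j ^ a * y j ^ b + mom R x y a b :=
    fun a b => hR ▸ mom_erase hj' x y a b
  have hgen : ∀ a, mom R x y a 1 ^ 2 ≤ C * C ^ (2 * a) * mom R x y 0 2 := fun a => by
    refine (mom_sq_le_of_bdd T.bdd y a).trans ?_
    have := mom_zero_two_nonneg R x y
    gcongr
  have hpC : f1 R x ≤ C := (le_mul_of_one_le_right T.pos.le hx1).trans T.small
  have hg : gG α S x k = x j * f1 R x - (α - f2 R x) := by unfold gG; rw [e2]; ring
  have heq : gG α S x k * x k = x j * (α - f2 R x) + (α * f1 R x + β - f3 R x) := by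
    have := sp.G_mul hα hβ
    unfold gG
    rw [this, e1, e3]; ring
  have hγ : |α * f1 R x + β - f3 R x| ≤ 3 * C ^ 2 := by
    have h4 := abs_le.1 T.b3
    have h5 : α * f1 R x ≤ C * C := by
      have := T.pos.le
      gcongr
    have h6 : C ≤ C ^ 2 := le_self_pow₀ hC1' (by norm_num)
    have h7 : 0 ≤ α * f1 R x := mul_nonneg hα.le T.pos.le
    rw [abs_le]; constructor <;> linarith
  have key := star_large_scalar (yj := y j) (t := mom R x y 0 1) (E := mom R x y 1 1)
    (E2 := mom R x y 2 1) (v := mom R x y 0 2) (m := mom R x y 1 2) (A' := A')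
    (N := gG α S x k * x k) (ψ := x k) hC1' hCα hαC T.pos T.small T.sq_le T.b2 (two_f2_le R x) rfl
    hγ (mom_zero_two_nonneg _ _ _) (by simpa using hgen 0)
    (by have := mom_sq_le R x y 1; rwa [mom_two_zero] at this)
    (by have := hgen 2; rwa [show C ^ 5 = C * C ^ (2 * 2) by ring])
    (by
      have := mom_le_of_bdd T.bdd y 1 1
      simpa using this)
    h3 heq (by rw [← hg]) (by rw [hA', hs, hl, e1, em, em]; ring) hlx
  have hN : (α - f2 R x) * y j + x j * mom R x y 1 1 + (f1 R x * mom R x y 1 1 - mom R x y 2 1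
      - (x j * f1 R x - (α - f2 R x)) * mom R x y 0 1) = Nn := by
    rw [hNn, hs, hl, hg, e1, em, em, em]; ring
  rw [hN] at key
  have hη : 0 ≤ x k * (∑ i ∈ S.erase k, (y i - Y * x i) ^ 2) :=
    mul_nonneg hψ0.le (Finset.sum_nonneg fun i _ => sq_nonneg _)
  have hY2 : 0 ≤ 2 * α * x k * Y ^ 2 := by positivity
  have e : 3 * (f1 (S.erase k) x * w - mm) - (mm - 2 * s * l + s ^ 2 * f1 (S.erase k) x) =
      2 * f1 R x * y j ^ 2 + 3 * x j * mom R x y 0 2 + 3 * f1 R x * mom R x y 0 2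
      - 4 * mom R x y 1 2 - x j * mom R x y 0 1 ^ 2 + 2 * mom R x y 0 1 * mom R x y 1 1
      - mom R x y 0 1 ^ 2 * f1 R x + 2 * y j * (mom R x y 1 1 - f1 R x * mom R x y 0 1) := by
    rw [hw, hs, hl, hmm, e1, em, em, em, em]; ring
  rw [e]
  generalize (26 / 25) * Nn ^ 2 / (gG α S x k * x k) = z1 at *
  generalize (23 / 50) * (x k ^ 2 / (gG α S x k * x k)) * A' ^ 2 = z2 at *
  generalize x k * (∑ i ∈ S.erase k, (y i - Y * x i) ^ 2) = z3 at *
  linarith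

include hα hβ hκ in
lemma exists_star : ∃ Ψ : ℝ, 1 ≤ Ψ ∧ ∀ x : ι → ℝ, Adm α β κ S x →
    ∀ k ∈ S, Ψ ≤ x k →
    (∀ i ∈ S, x i ≤ 3 * x k) → ∀ y : ι → ℝ, ∑ i ∈ S, gG α S x i * y i = 0 →
    (51 / 50) * gG α S x k * y k ^ 2 ≤
      x k * (-h3 S x y + 2 * ∑ i ∈ S.erase k, (f1 S x - x k - x i) * y i ^ 2) := by
  obtain ⟨X0, h1⟩ := exists_star_unbounded hα hβ hκ S
  obtain ⟨Ψ, hΨ, h2⟩ := exists_star_bounded hα hβ hκ S X0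
  refine ⟨Ψ, hΨ, fun x hx k hk hk1 hk3 y hy => ?_⟩
  by_cases hc : ∀ i ∈ S, i ≠ k → x i ≤ X0
  · exact h2 x hx k hk hk1 hc y hy
  push Not at hc
  obtain ⟨i, hi, hik, hiX⟩ := hc
  obtain ⟨j, hj, hjm⟩ := Finset.exists_max_image (S.erase k) x ⟨i, Finset.mem_erase.2 ⟨hik, hi⟩⟩
  refine h1 x hx k hk j (Finset.mem_of_mem_erase hj) (Finset.ne_of_mem_erase hj)
    (fun a ha hak => hjm a (Finset.mem_erase.2 ⟨hak, ha⟩)) (hk3 j (Finset.mem_of_mem_erase hj))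
    (hiX.le.trans (hjm i (Finset.mem_erase.2 ⟨hik, hi⟩))) y hy

end
end HessQuot

namespace HessQuot

variable {ι : Type*} [DecidableEq ι]

lemma weighted_cauchy {P v w y U : ℝ} (hP : 0 ≤ P) (hv : 0 ≤ v) (hU : U ^ 2 ≤ P * v) :
    (w * y + U) ^ 2 ≤ (P / 3 + w ^ 2) * (3 * v + y ^ 2) := by
  have h1 : 2 * (w * y * U) ≤ P / 3 * y ^ 2 + 3 * (w ^ 2 * v) := by
    refine (abs_le_of_sq_le_sq' ?_ (by positivity)).2
    have h2 := mul_le_mul_of_nonneg_left hU (sq_nonneg (2 * (w * y)))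
    have h3 := sq_nonneg (P / 3 * y ^ 2 - 3 * (w ^ 2 * v))
    nlinarith
  nlinarith

section
variable {α β κ : ℝ} (hα : 0 < α) (hβ : 0 ≤ β) (hκ : 0 ≤ κ) (S : Finset ι)

lemma Adm.neg_h3_nonneg (hα : 0 < α) (hβ : 0 ≤ β) {S : Finset ι} {x : ι → ℝ}
    (hx : Adm α β κ S x) {y : ι → ℝ} (hy : ∑ i ∈ S, gG α S x i * y i = 0) : 0 ≤ -h3 S x y := by
  have := h3_nonpos hα.le hx.pos1 hx.pos2 hx.pos3 (by rw [hx.eqn]; linarith) hy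
  linarith

lemma Adm.gap_pos {S : Finset ι} {x : ι → ℝ} (hx : Adm α β κ S x) {i k : ι} (hi : i ∈ S)
    (hk : k ∈ S) (hik : i ≠ k) : 0 < f1 S x - x k - x i := by
  have := f1_erase_erase_pos hx.pos1 hx.pos2 hx.pos3 hk hi hik
  rw [f1_erase hk x, f1_erase (Finset.mem_erase.2 ⟨hik, hi⟩) x]
  linarith

include hα hβ hκ in
lemma exists_jacobi_pointwise : ∃ Λ : ℝ, ∀ x : ι → ℝ, Adm α β κ S x →
    Λ ≤ ∑ i ∈ S, (x i + κ) ^ 2 → ∀ k ∈ S, ∀ y : ι → ℝ, ∑ i ∈ S, gG α S x i * y i = 0 →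
    (101 / 50) * (gG α S x k * (∑ i ∈ S, (x i + κ) * y i) ^ 2) ≤
      (∑ i ∈ S, (x i + κ) ^ 2) * ((x k + κ) * (-h3 S x y) +
        ∑ i ∈ S.erase k, (3 * gG α S x k + 2 * (x k + κ) * (f1 S x - x k - x i)) * y i ^ 2
        + gG α S x k * y k ^ 2) := by
  obtain ⟨Ψ, hΨ1, hΨ⟩ := exists_star hα hβ hκ S
  refine ⟨5 * (Ψ + 4 * κ) ^ 2, fun x hx hN k hk y hy => ?_⟩
  obtain ⟨N, hNd⟩ : ∃ N : ℝ, N = ∑ i ∈ S, (x i + κ) ^ 2 := ⟨_, rfl⟩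
  rw [← hNd] at hN ⊢
  have hQ := hx.neg_h3_nonneg hα hβ hy
  have hG : 0 < gG α S x k := hx.gG_pos hα hβ hk
  have hω : 1 ≤ x k + κ := hx.low k hk
  obtain ⟨v, hv⟩ : ∃ v : ℝ, v = ∑ i ∈ S.erase k, y i ^ 2 := ⟨_, rfl⟩
  have hv0 : 0 ≤ v := hv ▸ Finset.sum_nonneg fun i _ => sq_nonneg _
  obtain ⟨D, hD⟩ : ∃ D : ℝ, D = ∑ i ∈ S.erase k, (f1 S x - x k - x i) * y i ^ 2 := ⟨_, rfl⟩
  have hD0 : 0 ≤ D := hD ▸ Finset.sum_nonneg fun i hi => mul_nonneg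
    (hx.gap_pos (Finset.mem_of_mem_erase hi) hk (Finset.ne_of_mem_erase hi)).le (sq_nonneg _)
  have hsum : ∑ i ∈ S.erase k, (3 * gG α S x k + 2 * (x k + κ) * (f1 S x - x k - x i)) * y i ^ 2
      = 3 * gG α S x k * v + 2 * (x k + κ) * D := by
    rw [hv, hD, Finset.mul_sum, Finset.mul_sum, ← Finset.sum_add_distrib]
    exact Finset.sum_congr rfl fun i _ => by ring
  rw [hsum]
  have hN0 : 0 ≤ N := hNd ▸ Finset.sum_nonneg fun i _ => sq_nonneg _
  have hNk : N = (x k + κ) ^ 2 + ∑ i ∈ S.erase k, (x i + κ) ^ 2 := by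
    rw [hNd, Finset.add_sum_erase S (fun i => (x i + κ) ^ 2) hk]
  rcases le_or_gt (5 * (x k + κ) ^ 2) N with hc | hc
  · have hU := Finset.sum_mul_sq_le_sq_mul_sq (S.erase k) (fun i => x i + κ) y
    rw [← hv] at hU
    have hP : 0 ≤ ∑ i ∈ S.erase k, (x i + κ) ^ 2 := Finset.sum_nonneg fun i _ => sq_nonneg _
    have h1 := weighted_cauchy (w := x k + κ) (y := y k) hP hv0 hU
    rw [Finset.add_sum_erase S (fun i => (x i + κ) * y i) hk] at h1
    have h2 : (∑ i ∈ S.erase k, (x i + κ) ^ 2) / 3 + (x k + κ) ^ 2 ≤ (7 / 15) * N := by linarith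
    have q3 := mul_le_mul_of_nonneg_right h2 (by positivity : 0 ≤ 3 * v + y k ^ 2)
    have h4 := mul_le_mul_of_nonneg_left (h1.trans q3) hG.le
    have h5 : 0 ≤ gG α S x k * (N * (3 * v + y k ^ 2)) := by positivity
    have h6 : 0 ≤ N * ((x k + κ) * (-h3 S x y)) := by positivity
    have h7 : 0 ≤ N * (2 * (x k + κ) * D) := by positivity
    linarith
  · have hk1 : Ψ + 4 * κ ≤ x k + κ := by
      refine (abs_le_of_sq_le_sq' ?_ (by linarith)).2
      linarith
    have hmax : ∀ i ∈ S, x i ≤ 3 * x k := fun i hi => by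
      have h1 : (x i + κ) ^ 2 ≤ N := by
        rw [hNd]
        exact Finset.single_le_sum (f := fun i => (x i + κ) ^ 2) (fun i _ => sq_nonneg _) hi
      have h2 : x i + κ ≤ (5 / 2) * (x k + κ) := by
        refine (abs_le_of_sq_le_sq' ?_ (by linarith)).2
        nlinarith
      linarith
    have h1 := hΨ x hx k hk (by linarith) hmax y hy
    rw [← hD] at h1
    have h2 : x k * (-h3 S x y + 2 * D) ≤ (x k + κ) * (-h3 S x y + 2 * D) :=
      mul_le_mul_of_nonneg_right (by linarith) (by linarith)
    have q3 := Finset.sum_mul_sq_le_sq_mul_sq S (fun i => x i + κ) y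
    have h4 : ∑ i ∈ S, y i ^ 2 = y k ^ 2 + v := by
      rw [hv, Finset.add_sum_erase S (fun i => y i ^ 2) hk]
    rw [h4, ← hNd] at q3
    have h5 := mul_le_mul_of_nonneg_left q3 hG.le
    have h6 : (101 / 50) * (gG α S x k * (y k ^ 2 + v)) ≤ (x k + κ) * -h3 S x y +
        (3 * gG α S x k * v + 2 * (x k + κ) * D) + gG α S x k * y k ^ 2 := by
      have := mul_nonneg hG.le hv0
      linarith
    have h7 := mul_le_mul_of_nonneg_left h6 hN0
    linarith

lemma sum_double_ge {S : Finset ι} {k : ι} (hk : k ∈ S) (E : ι → ι → ℝ)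
    (hE : ∀ a ∈ S, ∀ b ∈ S, 0 ≤ E a b) :
    ∑ a ∈ S, E a a + ∑ a ∈ S.erase k, (E a k + E k a) ≤ ∑ a ∈ S, ∑ b ∈ S, E a b := by
  have h1 : ∑ a ∈ S, ∑ b ∈ S, E a b = ∑ a ∈ S, E a a + ∑ a ∈ S, ∑ b ∈ S.erase a, E a b := by
    rw [← Finset.sum_add_distrib]
    exact Finset.sum_congr rfl fun a ha => (Finset.add_sum_erase S (E a) ha).symm
  rw [h1, ← Finset.add_sum_erase S (fun a => ∑ b ∈ S.erase a, E a b) hk, Finset.sum_add_distrib]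
  have h2 : ∑ a ∈ S.erase k, E a k ≤ ∑ a ∈ S.erase k, ∑ b ∈ S.erase a, E a b := by
    refine Finset.sum_le_sum fun a ha => ?_
    exact Finset.single_le_sum (f := E a)
      (fun b hb => hE a (Finset.mem_of_mem_erase ha) b (Finset.mem_of_mem_erase hb))
      (Finset.mem_erase.2 ⟨(Finset.ne_of_mem_erase ha).symm, hk⟩)
  linarith

lemma h3_eq_double_sum (S : Finset ι) (x y : ι → ℝ) :
    h3 S x y = ∑ a ∈ S, ∑ b ∈ S, (if a = b then 0 else (f1 S x - x a - x b) * (y a * y b)) := by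
  have h : ∀ a ∈ S, ∑ b ∈ S, (if a = b then 0 else (f1 S x - x a - x b) * (y a * y b)) =
      f1 S x * mom S x y 0 1 * (x a ^ 0 * y a ^ 1) - mom S x y 0 1 * (x a ^ 1 * y a ^ 1)
      - mom S x y 1 1 * (x a ^ 0 * y a ^ 1) - f1 S x * (x a ^ 0 * y a ^ 2)
      + 2 * (x a ^ 1 * y a ^ 2) := fun a ha => by
    have h1 : ∀ b ∈ S, (if a = b then 0 else (f1 S x - x a - x b) * (y a * y b)) =
        (f1 S x - x a) * y a * (x b ^ 0 * y b ^ 1) - y a * (x b ^ 1 * y b ^ 1)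
        - (if a = b then (f1 S x - x a - x b) * (y a * y b) else 0) := fun b _ => by
      split_ifs <;> ring
    rw [Finset.sum_congr rfl h1, Finset.sum_sub_distrib, Finset.sum_sub_distrib,
      Finset.sum_ite_eq, if_pos ha, ← Finset.mul_sum, ← Finset.mul_sum]
    change (f1 S x - x a) * y a * mom S x y 0 1 - y a * mom S x y 1 1 - _ = _
    ring
  rw [Finset.sum_congr rfl h, Finset.sum_add_distrib, Finset.sum_sub_distrib,
    Finset.sum_sub_distrib, Finset.sum_sub_distrib, ← Finset.mul_sum, ← Finset.mul_sum,
    ← Finset.mul_sum, ← Finset.mul_sum, ← Finset.mul_sum]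
  change h3 S x y = f1 S x * mom S x y 0 1 * mom S x y 0 1 - mom S x y 0 1 * mom S x y 1 1
    - mom S x y 1 1 * mom S x y 0 1 - f1 S x * mom S x y 0 2 + 2 * mom S x y 1 2
  unfold h3; ring

include hα hβ hκ in
/-- The Jacobi inequality in a diagonalising frame. -/
lemma exists_jacobi_diag : ∃ Λ : ℝ, ∀ x : ι → ℝ, Adm α β κ S x →
    Λ ≤ ∑ i ∈ S, (x i + κ) ^ 2 → ∀ T : ι → ι → ι → ℝ,
    (∀ a b c, T a b c = T b a c) → (∀ a b c, T a b c = T a c b) →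
    (∀ k ∈ S, ∑ i ∈ S, gG α S x i * T i i k = 0) →
    (101 / 50) * ∑ k ∈ S, gG α S x k * (∑ i ∈ S, (x i + κ) * T i i k) ^ 2 ≤
      (∑ i ∈ S, (x i + κ) ^ 2) * ∑ k ∈ S, ∑ a ∈ S, ∑ b ∈ S, (gG α S x k * T a b k ^ 2 +
        (x k + κ) * (f1 S x - x a - x b) * (T a b k ^ 2 - T a a k * T b b k)) := by
  obtain ⟨Λ, hΛ⟩ := exists_jacobi_pointwise hα hβ hκ S
  refine ⟨Λ, fun x hx hN T hT1 hT2 hT => ?_⟩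
  have hN0 : 0 ≤ ∑ i ∈ S, (x i + κ) ^ 2 := Finset.sum_nonneg fun i _ => sq_nonneg _
  have h1 := Finset.sum_le_sum fun k hk => hΛ x hx hN k hk (fun i => T i i k) (hT k hk)
  rw [← Finset.mul_sum, ← Finset.mul_sum] at h1
  refine h1.trans (mul_le_mul_of_nonneg_left ?_ hN0)
  obtain ⟨E, hE⟩ : ∃ E : ι → ι → ι → ℝ, E = fun k a b => if a = b then gG α S x k * T a a k ^ 2
      else (gG α S x k + (x k + κ) * (f1 S x - x a - x b)) * T a b k ^ 2 := ⟨_, rfl⟩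
  have hE0 : ∀ k ∈ S, ∀ a ∈ S, ∀ b ∈ S, 0 ≤ E k a b := fun k hk a ha b hb => by
    rw [hE]
    have hG := hx.gG_pos hα hβ hk
    have hω := hx.low k hk
    dsimp only
    split_ifs with hab
    · positivity
    · have := hx.gap_pos hb ha (Ne.symm hab)
      have : 0 < (x k + κ) * (f1 S x - x a - x b) := mul_pos (by linarith) this
      positivity
  have h2 : ∀ k ∈ S, ∑ a ∈ S, ∑ b ∈ S, (gG α S x k * T a b k ^ 2 +
        (x k + κ) * (f1 S x - x a - x b) * (T a b k ^ 2 - T a a k * T b b k)) =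
      (x k + κ) * (-h3 S x (fun i => T i i k)) + ∑ a ∈ S, ∑ b ∈ S, E k a b := fun k _ => by
    rw [h3_eq_double_sum, ← Finset.sum_neg_distrib, Finset.mul_sum, ← Finset.sum_add_distrib]
    refine Finset.sum_congr rfl fun a _ => ?_
    rw [← Finset.sum_neg_distrib, Finset.mul_sum, ← Finset.sum_add_distrib]
    refine Finset.sum_congr rfl fun b _ => ?_
    rw [hE]
    dsimp only
    split_ifs with hab
    · subst hab; ring
    · ring
  rw [Finset.sum_congr rfl h2]
  have q3 : ∑ k ∈ S, ∑ a ∈ S.erase k, (E k a k + E k k a) =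
      ∑ k ∈ S, ∑ i ∈ S.erase k,
        2 * (gG α S x k + (x k + κ) * (f1 S x - x k - x i)) * T i i k ^ 2 := by
    rw [Finset.sum_comm' (t' := S) (s' := fun a => S.erase a)]
    · refine Finset.sum_congr rfl fun k hk => Finset.sum_congr rfl fun i hi => ?_
      have hik := Finset.ne_of_mem_erase hi
      rw [hE]
      dsimp only
      rw [if_neg (Ne.symm hik), if_neg hik, gG_eq hk, gG_eq (Finset.mem_of_mem_erase hi), hT1 k i i,
        hT2 i k i]
      ring
    · intro a b
      simp only [Finset.mem_erase]
      tauto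
  have h4 : ∑ k ∈ S, ((x k + κ) * (-h3 S x (fun i => T i i k)) + (∑ a ∈ S, E k a a
      + ∑ a ∈ S.erase k, (E k a k + E k k a))) ≤ ∑ k ∈ S,
      ((x k + κ) * (-h3 S x (fun i => T i i k)) + ∑ a ∈ S, ∑ b ∈ S, E k a b) :=
    Finset.sum_le_sum fun k hk => by
      have := sum_double_ge hk (E k) (hE0 k hk)
      linarith
  refine le_trans (le_of_eq ?_) h4
  have q4 : ∑ k ∈ S, ((x k + κ) * (-h3 S x (fun i => T i i k)) + (∑ a ∈ S, E k a a
      + ∑ a ∈ S.erase k, (E k a k + E k k a))) =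
      ∑ k ∈ S, ((x k + κ) * (-h3 S x (fun i => T i i k)) + (∑ a ∈ S, E k a a
      + ∑ i ∈ S.erase k,
        2 * (gG α S x k + (x k + κ) * (f1 S x - x k - x i)) * T i i k ^ 2)) := by
    rw [Finset.sum_add_distrib, Finset.sum_add_distrib, Finset.sum_add_distrib,
      Finset.sum_add_distrib, q3]
  rw [q4]
  refine Finset.sum_congr rfl fun k hk => ?_
  have h5 : ∑ a ∈ S, E k a a = gG α S x k * T k k k ^ 2 +
      ∑ i ∈ S.erase k, gG α S x k * T i i k ^ 2 := by
    rw [Finset.add_sum_erase S (fun i => gG α S x k * T i i k ^ 2) hk, hE]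
    simp
  have h6 : ∑ i ∈ S.erase k, (3 * gG α S x k + 2 * (x k + κ) * (f1 S x - x k - x i)) * T i i k ^ 2
      = ∑ i ∈ S.erase k, gG α S x k * T i i k ^ 2 + ∑ i ∈ S.erase k,
        2 * (gG α S x k + (x k + κ) * (f1 S x - x k - x i)) * T i i k ^ 2 := by
    rw [← Finset.sum_add_distrib]
    exact Finset.sum_congr rfl fun i _ => by ring
  rw [h5, h6]; ring

end
end HessQuot

namespace HessQuot
variable {ι : Type*} [Fintype ι] [DecidableEq ι]

open Matrix

/-- The linearised operator `D(σ₃ - α σ₁)` at the symmetric matrix `A`. -/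
def gM (α : ℝ) (A : Matrix ι ι ℝ) : Matrix ι ι ℝ :=
  ((A.trace ^ 2 - (A * A).trace) / 2 - α) • (1 : Matrix ι ι ℝ) - A.trace • A + A * A

/-- Minus the second derivative of `σ₃`. -/
def bM (A Y Z : Matrix ι ι ℝ) : ℝ :=
  A.trace * ((Y * Z).trace - Y.trace * Z.trace) - (A * (Y * Z + Z * Y)).trace
    + Y.trace * (A * Z).trace + Z.trace * (A * Y).trace

/-- The shifted matrix `A + κ I`. -/
def oM (κ : ℝ) (A : Matrix ι ι ℝ) : Matrix ι ι ℝ := A + κ • (1 : Matrix ι ι ℝ)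

/-- `A` is orthogonally diagonalisable with admissible spectrum. -/
def MAdm (α β κ : ℝ) (A : Matrix ι ι ℝ) : Prop :=
  ∃ (R : Matrix ι ι ℝ) (x : ι → ℝ), Rᵀ * R = 1 ∧ A = R * diagonal x * Rᵀ ∧
    Adm α β κ Finset.univ x

section conj
variable {R : Matrix ι ι ℝ} (hR : Rᵀ * R = 1)
include hR

lemma conj_mul (X Y : Matrix ι ι ℝ) : R * X * Rᵀ * (R * Y * Rᵀ) = R * (X * Y) * Rᵀ := by
  calc R * X * Rᵀ * (R * Y * Rᵀ) = R * X * (Rᵀ * R) * Y * Rᵀ := by simp only [Matrix.mul_assoc]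
    _ = _ := by rw [hR]; simp only [Matrix.mul_assoc, Matrix.one_mul]

lemma conj_trace (X : Matrix ι ι ℝ) : (R * X * Rᵀ).trace = X.trace := by
  rw [Matrix.trace_mul_comm, ← Matrix.mul_assoc, hR, Matrix.one_mul]

lemma conj_one : R * (1 : Matrix ι ι ℝ) * Rᵀ = 1 := by
  rw [Matrix.mul_one, mul_eq_one_comm.1 hR]

lemma conj_gM (α : ℝ) (X : Matrix ι ι ℝ) : gM α (R * X * Rᵀ) = R * gM α X * Rᵀ := by
  unfold gM
  rw [conj_mul hR, conj_trace hR, conj_trace hR]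
  nth_rw 1 [← conj_one hR]
  simp only [Matrix.mul_add, Matrix.mul_sub, Matrix.add_mul, Matrix.sub_mul, Matrix.mul_smul,
    Matrix.smul_mul, Matrix.mul_one]

lemma conj_oM (κ : ℝ) (X : Matrix ι ι ℝ) : oM κ (R * X * Rᵀ) = R * oM κ X * Rᵀ := by
  unfold oM
  nth_rw 1 [← conj_one hR]
  simp only [Matrix.mul_add, Matrix.add_mul, Matrix.mul_smul, Matrix.smul_mul, Matrix.mul_one]

lemma conj_bM (X Y Z : Matrix ι ι ℝ) :
    bM (R * X * Rᵀ) (R * Y * Rᵀ) (R * Z * Rᵀ) = bM X Y Z := by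
  unfold bM
  have h : R * (Y * Z) * Rᵀ + R * (Z * Y) * Rᵀ = R * (Y * Z + Z * Y) * Rᵀ := by
    rw [Matrix.mul_add, Matrix.add_mul]
  simp only [conj_mul hR, conj_trace hR, h]

lemma conj_eq (Y : Matrix ι ι ℝ) : R * (Rᵀ * Y * R) * Rᵀ = Y := by
  have h := mul_eq_one_comm.1 hR
  calc R * (Rᵀ * Y * R) * Rᵀ = (R * Rᵀ) * Y * (R * Rᵀ) := by simp only [Matrix.mul_assoc]
    _ = Y := by rw [h, Matrix.one_mul, Matrix.mul_one]

end conj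

lemma gM_diagonal (α : ℝ) (x : ι → ℝ) :
    gM α (diagonal x) = diagonal (gG α Finset.univ x) := by
  unfold gM
  have e1 : (diagonal x).trace = f1 Finset.univ x := by
    simp [Matrix.trace, f1, ps]
  have e2 : (diagonal x * diagonal x).trace = ps Finset.univ x 2 := by
    simp [Matrix.trace, ps, pow_two]
  have e3 : f2 Finset.univ x = ((diagonal x).trace ^ 2 - (diagonal x * diagonal x).trace) / 2 := by
    rw [e1, e2]; rfl
  rw [← e3, e1]
  ext i j
  by_cases hij : i = j
  · subst hij
    simp [gG_eq (Finset.mem_univ i)]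
    ring
  · simp [hij]

lemma oM_diagonal (κ : ℝ) (x : ι → ℝ) : oM κ (diagonal x) = diagonal (fun i => x i + κ) := by
  unfold oM
  ext i j
  by_cases hij : i = j
  · subst hij; simp
  · simp [hij]

lemma bM_diagonal_self (x : ι → ℝ) (Y : Matrix ι ι ℝ) (hY : Yᵀ = Y) :
    bM (diagonal x) Y Y = ∑ a, ∑ b, (f1 Finset.univ x - x a - x b) *
      (Y a b ^ 2 - Y a a * Y b b) := by
  have hY' : ∀ a b, Y a b = Y b a := fun a b => congrFun (congrFun hY b) a
  have e1 : (diagonal x).trace = f1 Finset.univ x := by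
    simp [Matrix.trace, f1, ps]
  have t2 : (Y * Y).trace = ∑ a, ∑ b, Y a b ^ 2 := by
    simp only [Matrix.trace, Matrix.diag_apply, Matrix.mul_apply]
    exact Finset.sum_congr rfl fun a _ => Finset.sum_congr rfl fun b _ => by rw [hY' b a]; ring
  have t3 : (diagonal x * (Y * Y)).trace = ∑ a, ∑ b, x a * Y a b ^ 2 := by
    simp only [Matrix.trace, Matrix.diag_apply, Matrix.diagonal_mul]
    simp only [Matrix.mul_apply, Finset.mul_sum]
    exact Finset.sum_congr rfl fun a _ => Finset.sum_congr rfl fun b _ => by rw [hY' b a]; ring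
  have t4 : ∑ a, ∑ b, x b * Y a b ^ 2 = ∑ a, ∑ b, x a * Y a b ^ 2 := by
    rw [Finset.sum_comm]
    exact Finset.sum_congr rfl fun a _ => Finset.sum_congr rfl fun b _ => by rw [hY' b a]
  have t5 : (diagonal x * Y).trace = ∑ a, x a * Y a a := by
    simp [Matrix.trace, Matrix.diagonal_mul]
  have t6 : Y.trace = ∑ a, Y a a := rfl
  have s1 : ∀ p q : ι → ℝ, (∑ a, p a) * (∑ b, q b) = ∑ a, ∑ b, p a * q b := fun p q =>
    Finset.sum_mul_sum _ _ _ _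
  unfold bM
  rw [Matrix.mul_add, Matrix.trace_add, e1, t2, t3, t5, t6]
  have e : ∑ a, ∑ b, (f1 Finset.univ x - x a - x b) * (Y a b ^ 2 - Y a a * Y b b) =
      f1 Finset.univ x * ∑ a, ∑ b, Y a b ^ 2 - f1 Finset.univ x * ∑ a, ∑ b, Y a a * Y b b
      - ∑ a, ∑ b, x a * Y a b ^ 2 - ∑ a, ∑ b, x b * Y a b ^ 2
      + ∑ a, ∑ b, x a * Y a a * Y b b + ∑ a, ∑ b, Y a a * (x b * Y b b) := by
    simp only [Finset.mul_sum, ← Finset.sum_sub_distrib, ← Finset.sum_add_distrib]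
    exact Finset.sum_congr rfl fun a _ => Finset.sum_congr rfl fun b _ => by ring
  rw [e, t4, ← s1, ← s1, ← s1]
  ring

/-- Rotating the first index of a family of matrices. -/
lemma sum_rot {R : Matrix ι ι ℝ} (d : ι → ℝ) (B : Matrix ι ι ℝ →ₗ[ℝ] Matrix ι ι ℝ →ₗ[ℝ] ℝ)
    (T : ι → Matrix ι ι ℝ) :
    ∑ c, d c * B (∑ k, R k c • T k) (∑ k, R k c • T k) =
      ∑ k, ∑ l, (R * diagonal d * Rᵀ) k l * B (T k) (T l) := by
  have h : ∀ k l, (R * diagonal d * Rᵀ) k l = ∑ c, R k c * d c * R l c := fun k l => by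
    simp [Matrix.mul_apply, Matrix.diagonal]
  simp only [h, Finset.sum_mul]
  have : ∀ c, d c * B (∑ k, R k c • T k) (∑ k, R k c • T k) =
      ∑ k, ∑ l, R k c * d c * R l c * B (T k) (T l) := fun c => by
    simp only [map_sum, LinearMap.map_smul, LinearMap.sum_apply, LinearMap.smul_apply,
      smul_eq_mul, Finset.mul_sum]
    rw [Finset.sum_comm]
    exact Finset.sum_congr rfl fun k _ => Finset.sum_congr rfl fun l _ => by ring
  rw [Finset.sum_congr rfl fun c _ => this c, Finset.sum_comm]
  exact Finset.sum_congr rfl fun k _ => by rw [Finset.sum_comm]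

/-- `(Y, Z) ↦ tr (Y Z)`. -/
def trB : Matrix ι ι ℝ →ₗ[ℝ] Matrix ι ι ℝ →ₗ[ℝ] ℝ :=
  LinearMap.mk₂ ℝ (fun Y Z => (Y * Z).trace)
    (fun a b c => by rw [Matrix.add_mul, Matrix.trace_add])
    (fun a b c => by rw [Matrix.smul_mul, Matrix.trace_smul])
    (fun a b c => by rw [Matrix.mul_add, Matrix.trace_add])
    (fun a b c => by rw [Matrix.mul_smul, Matrix.trace_smul])

/-- `(Y, Z) ↦ tr (W Y) tr (W Z)`. -/
def trW (W : Matrix ι ι ℝ) : Matrix ι ι ℝ →ₗ[ℝ] Matrix ι ι ℝ →ₗ[ℝ] ℝ :=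
  LinearMap.mk₂ ℝ (fun Y Z => (W * Y).trace * (W * Z).trace)
    (fun a b c => by rw [Matrix.mul_add, Matrix.trace_add, add_mul])
    (fun a b c => by rw [Matrix.mul_smul, Matrix.trace_smul, smul_eq_mul, smul_eq_mul, mul_assoc])
    (fun a b c => by rw [Matrix.mul_add, Matrix.trace_add, mul_add])
    (fun a b c => by
      rw [Matrix.mul_smul, Matrix.trace_smul, smul_eq_mul, smul_eq_mul]; ring)

/-- `bM A` as a bilinear map. -/
def bL (A : Matrix ι ι ℝ) : Matrix ι ι ℝ →ₗ[ℝ] Matrix ι ι ℝ →ₗ[ℝ] ℝ :=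
  LinearMap.mk₂ ℝ (bM A)
    (fun a b c => by
      unfold bM; simp only [Matrix.mul_add, Matrix.add_mul, Matrix.trace_add]; ring)
    (fun a b c => by
      unfold bM
      simp only [Matrix.mul_add, Matrix.mul_smul, Matrix.smul_mul, Matrix.trace_add,
        Matrix.trace_smul, smul_eq_mul]; ring)
    (fun a b c => by
      unfold bM; simp only [Matrix.mul_add, Matrix.add_mul, Matrix.trace_add]; ring)
    (fun a b c => by
      unfold bM
      simp only [Matrix.mul_add, Matrix.mul_smul, Matrix.smul_mul, Matrix.trace_add,
        Matrix.trace_smul, smul_eq_mul]; ring)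

lemma trB_apply (Y Z : Matrix ι ι ℝ) : trB Y Z = (Y * Z).trace := rfl
lemma trW_apply (W Y Z : Matrix ι ι ℝ) : trW W Y Z = (W * Y).trace * (W * Z).trace := rfl
lemma bL_apply (A Y Z : Matrix ι ι ℝ) : bL A Y Z = bM A Y Z := rfl

/-- The Jacobi inequality in matrix form. -/
lemma exists_jacobi {α β κ : ℝ} (hα : 0 < α) (hβ : 0 ≤ β) (hκ : 0 ≤ κ) :
    ∃ Λ : ℝ, ∀ A : Matrix ι ι ℝ, MAdm α β κ A → Λ ≤ (oM κ A * oM κ A).trace →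
    ∀ T : ι → Matrix ι ι ℝ, (∀ k i j, T k i j = T i k j) → (∀ k i j, T k i j = T k j i) →
    (∀ k, (gM α A * T k).trace = 0) →
    (101 / 50) * ∑ k, ∑ l, gM α A k l * ((oM κ A * T k).trace * (oM κ A * T l).trace) ≤
      (oM κ A * oM κ A).trace * ∑ k, ∑ l,
        (gM α A k l * (T k * T l).trace + oM κ A k l * bM A (T k) (T l)) := by
  obtain ⟨Λ, hΛ⟩ := exists_jacobi_diag hα hβ hκ (Finset.univ : Finset ι)
  refine ⟨Λ, ?_⟩
  rintro A ⟨R, x, hR, rfl, hx⟩ hN T hT1 hT2 hT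
  rw [conj_oM hR, conj_gM hR, gM_diagonal, oM_diagonal, conj_mul hR, conj_trace hR]
  rw [conj_oM hR, oM_diagonal, conj_mul hR, conj_trace hR] at hN
  rw [conj_gM hR, gM_diagonal] at hT
  have eN : (diagonal (fun i => x i + κ) * diagonal (fun i => x i + κ)).trace =
      ∑ i, (x i + κ) ^ 2 := by simp [Matrix.trace, pow_two]
  rw [eN] at hN ⊢
  obtain ⟨P, hP⟩ : ∃ P : ι → Matrix ι ι ℝ, P = fun c => ∑ k, R k c • T k := ⟨_, rfl⟩
  obtain ⟨Q, hQ⟩ : ∃ Q : ι → Matrix ι ι ℝ, Q = fun c => Rᵀ * P c * R := ⟨_, rfl⟩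
  have hPQ : ∀ c, P c = R * Q c * Rᵀ := fun c => by rw [hQ, conj_eq hR]
  have Qe : ∀ a b c, Q c a b = ∑ k, ∑ i, ∑ j, R k c * R i a * R j b * T k i j := fun a b c => by
    rw [hQ, hP]
    simp only [Matrix.mul_apply, Matrix.sum_apply, Matrix.smul_apply, smul_eq_mul,
      Matrix.transpose_apply, Finset.sum_mul, Finset.mul_sum]
    rw [Finset.sum_comm]
    rw [Finset.sum_congr rfl fun i _ => Finset.sum_comm, Finset.sum_comm]
    refine Eq.trans Finset.sum_comm ?_
    exact Finset.sum_congr rfl fun k _ => Finset.sum_congr rfl fun l _ =>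
      Finset.sum_congr rfl fun j _ => by ring
  have Q1 : ∀ a b c, Q c a b = Q c b a := fun a b c => by
    rw [Qe, Qe]
    refine Finset.sum_congr rfl fun k _ => ?_
    rw [Finset.sum_comm]
    exact Finset.sum_congr rfl fun l _ => Finset.sum_congr rfl fun j _ => by rw [hT2 k j l]; ring
  have Q2 : ∀ a b c, Q c a b = Q b a c := fun a b c => by
    rw [Q1, Qe, Q1, Qe, Finset.sum_comm]
    exact Finset.sum_congr rfl fun k _ => Finset.sum_congr rfl fun l _ =>
      Finset.sum_congr rfl fun j _ => by rw [hT1 k l j]; ring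
  have hz : ∀ c, (diagonal (gG α Finset.univ x) * Q c).trace = 0 := fun c => by
    have : (R * diagonal (gG α Finset.univ x) * Rᵀ * P c).trace = 0 := by
      rw [hP]
      simp only [Matrix.mul_sum, Matrix.mul_smul, Matrix.trace_sum, Matrix.trace_smul, hT,
        smul_zero, Finset.sum_const_zero]
    rwa [hPQ, conj_mul hR, conj_trace hR] at this
  have hmain := hΛ x hx hN (fun a b k => Q k a b) (fun a b c => Q1 a b c)
    (fun a b c => Q2 a b c) (fun k _ => by
      have := hz k
      simpa [Matrix.trace, Matrix.diagonal_mul] using this)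
  have E1 := sum_rot (R := R) (gG α Finset.univ x) (trW (R * diagonal (fun i => x i + κ) * Rᵀ)) T
  have E2 := sum_rot (R := R) (gG α Finset.univ x) trB T
  have E3 := sum_rot (R := R) (fun i => x i + κ) (bL (R * diagonal x * Rᵀ)) T
  simp only [trW_apply, trB_apply, bL_apply] at E1 E2 E3
  have hPc : ∀ c, ∑ k, R k c • T k = P c := fun c => by rw [hP]
  simp only [hPc, hPQ, conj_mul hR, conj_trace hR, conj_bM hR] at E1 E2 E3
  simp only [Finset.sum_add_distrib]
  rw [← E1, ← E2, ← E3]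
  have e1 : ∀ c, (diagonal (fun i => x i + κ) * Q c).trace = ∑ i, (x i + κ) * Q c i i :=
    fun c => by simp [Matrix.trace, Matrix.diagonal_mul]
  have e2 : ∀ c, (Q c * Q c).trace = ∑ a, ∑ b, Q c a b ^ 2 := fun c => by
    simp only [Matrix.trace, Matrix.diag_apply, Matrix.mul_apply]
    exact Finset.sum_congr rfl fun a _ => Finset.sum_congr rfl fun b _ => by rw [Q1 b a]; ring
  have e3 : ∀ c, bM (diagonal x) (Q c) (Q c) = _ := fun c =>
    bM_diagonal_self x (Q c) (by ext a b; exact Q1 b a c)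
  simp only [e2, e1, e3]
  simp only [← pow_two]
  refine hmain.trans (le_of_eq ?_)
  congr 1
  rw [← Finset.sum_add_distrib]
  refine Finset.sum_congr rfl fun c _ => ?_
  simp only [Finset.sum_add_distrib, Finset.mul_sum]
  congr 1
  exact Finset.sum_congr rfl fun a _ => Finset.sum_congr rfl fun b _ => by ring

end HessQuot

namespace HessQuot
variable {ι : Type*} [Fintype ι] [DecidableEq ι]

open Matrix

/-- `σ₂` of a matrix through traces. -/
def e2M (A : Matrix ι ι ℝ) : ℝ := (A.trace ^ 2 - (A * A).trace) / 2

/-- `σ₃` of a matrix through traces. -/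
def e3M (A : Matrix ι ι ℝ) : ℝ :=
  (A.trace ^ 3 - 3 * A.trace * (A * A).trace + 2 * (A * A * A).trace) / 6

lemma e2M_conj {R : Matrix ι ι ℝ} (hR : Rᵀ * R = 1) (x : ι → ℝ) :
    e2M (R * diagonal x * Rᵀ) = f2 Finset.univ x := by
  unfold e2M
  rw [conj_mul hR, conj_trace hR, conj_trace hR]
  simp [Matrix.trace, f2, ps, pow_two]

lemma e3M_conj {R : Matrix ι ι ℝ} (hR : Rᵀ * R = 1) (x : ι → ℝ) :
    e3M (R * diagonal x * Rᵀ) = f3 Finset.univ x := by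
  unfold e3M
  rw [conj_mul hR, conj_mul hR, conj_trace hR, conj_trace hR, conj_trace hR]
  simp [Matrix.trace, f3, ps, pow_succ]

lemma trace_conj_diagonal {R : Matrix ι ι ℝ} (hR : Rᵀ * R = 1) (x : ι → ℝ) :
    (R * diagonal x * Rᵀ).trace = f1 Finset.univ x := by
  rw [conj_trace hR]; simp [Matrix.trace, f1, ps]

lemma conj_transpose (R : Matrix ι ι ℝ) (d : ι → ℝ) :
    (R * diagonal d * Rᵀ)ᵀ = R * diagonal d * Rᵀ := by
  simp [Matrix.transpose_mul, Matrix.mul_assoc]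

lemma quad_conj (R : Matrix ι ι ℝ) (d ξ : ι → ℝ) :
    ξ ⬝ᵥ (R * diagonal d * Rᵀ) *ᵥ ξ = ∑ i, d i * ((Rᵀ *ᵥ ξ) i) ^ 2 := by
  rw [← Matrix.mulVec_mulVec, ← Matrix.mulVec_mulVec, Matrix.dotProduct_mulVec,
    ← Matrix.mulVec_transpose]
  simp only [dotProduct, Matrix.mulVec_diagonal]
  exact Finset.sum_congr rfl fun i _ => by ring

lemma dot_conj {R : Matrix ι ι ℝ} (hR : Rᵀ * R = 1) (ξ : ι → ℝ) :
    ξ ⬝ᵥ ξ = ∑ i, ((Rᵀ *ᵥ ξ) i) ^ 2 := by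
  have := quad_conj R (fun _ => (1 : ℝ)) ξ
  rw [show diagonal (fun _ : ι => (1 : ℝ)) = 1 from Matrix.diagonal_one, conj_one hR,
    Matrix.one_mulVec] at this
  simpa using this

lemma dot_mulVec_conj {R : Matrix ι ι ℝ} (hR : Rᵀ * R = 1) (d e ξ : ι → ℝ) :
    ((R * diagonal d * Rᵀ) *ᵥ ξ) ⬝ᵥ ((R * diagonal e * Rᵀ) *ᵥ ((R * diagonal d * Rᵀ) *ᵥ ξ))
      = ∑ i, e i * d i ^ 2 * ((Rᵀ *ᵥ ξ) i) ^ 2 := by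
  rw [quad_conj]
  refine Finset.sum_congr rfl fun i _ => ?_
  have : Rᵀ *ᵥ ((R * diagonal d * Rᵀ) *ᵥ ξ) = diagonal d *ᵥ (Rᵀ *ᵥ ξ) := by
    rw [Matrix.mulVec_mulVec, Matrix.mulVec_mulVec]
    congr 1
    rw [← Matrix.mul_assoc, ← Matrix.mul_assoc, hR, Matrix.one_mul]
  rw [this, Matrix.mulVec_diagonal]; ring

lemma det_conj {R : Matrix ι ι ℝ} (hR : Rᵀ * R = 1) (d : ι → ℝ) :
    (R * diagonal d * Rᵀ).det = ∏ i, d i := by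
  have h : R.det * Rᵀ.det = 1 := by
    rw [← Matrix.det_mul, mul_eq_one_comm.1 hR, Matrix.det_one]
  rw [Matrix.det_mul, Matrix.det_mul, Matrix.det_diagonal, mul_right_comm, h, one_mul]

lemma complM_conj {R : Matrix ι ι ℝ} (hR : Rᵀ * R = 1) (x : ι → ℝ) :
    f1 Finset.univ x • (1 : Matrix ι ι ℝ) - R * diagonal x * Rᵀ =
      R * diagonal (fun i => f1 (Finset.univ.erase i) x) * Rᵀ := by
  have : (diagonal (fun i => f1 (Finset.univ.erase i) x) : Matrix ι ι ℝ) =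
      f1 Finset.univ x • (1 : Matrix ι ι ℝ) - diagonal x := by
    ext i j
    by_cases hij : i = j
    · subst hij; simp [f1_erase (Finset.mem_univ i)]
    · simp [hij]
  rw [this, Matrix.mul_sub, Matrix.sub_mul, Matrix.mul_smul, Matrix.smul_mul, conj_one hR]

lemma prod_le_mean_pow [Nonempty ι] {z : ι → ℝ} (hz : ∀ i, 0 ≤ z i) :
    ∏ i, z i ≤ ((∑ i, z i) / Fintype.card ι) ^ Fintype.card ι := by
  have hn : (Fintype.card ι : ℝ) ≠ 0 := by simp
  have h := Real.geom_mean_le_arith_mean_weighted Finset.univ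
    (fun _ : ι => (1 : ℝ) / Fintype.card ι) z (fun _ _ => by positivity) (by simp [hn])
    (fun i _ => hz i)
  have h2 := pow_le_pow_left₀ (Finset.prod_nonneg fun i _ => Real.rpow_nonneg (hz i) _) h
    (Fintype.card ι)
  rw [← Finset.mul_sum, ← Finset.prod_pow] at h2
  have h3 : ∀ i, (z i ^ ((1 : ℝ) / Fintype.card ι)) ^ Fintype.card ι = z i := fun i => by
    rw [← Real.rpow_natCast, ← Real.rpow_mul (hz i), one_div, inv_mul_cancel₀ hn, Real.rpow_one]
  simp only [h3] at h2
  rwa [one_div, ← div_eq_inv_mul] at h2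

/-- AM–GM for `det G det M ≤ (tr (G M) / n) ^ n`. -/
lemma det_mul_le_trace [Nonempty ι] {R : Matrix ι ι ℝ} (hR : Rᵀ * R = 1) {g : ι → ℝ}
    (hg : ∀ i, 0 ≤ g i)
    {M : Matrix ι ι ℝ} (hM : M.PosSemidef) :
    (∏ i, g i) * M.det ≤ ((R * diagonal g * Rᵀ * M).trace / Fintype.card ι) ^ Fintype.card ι := by
  obtain ⟨B, hB⟩ : ∃ B : Matrix ι ι ℝ, B = R * diagonal (fun i => √(g i)) * Rᵀ := ⟨_, rfl⟩
  have hBB : B * B = R * diagonal g * Rᵀ := by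
    rw [hB, conj_mul hR, Matrix.diagonal_mul_diagonal]
    simp only [Real.mul_self_sqrt (hg _)]
  have hBt : Bᵀ = B := by rw [hB]; exact conj_transpose R _
  have hP : (B * M * B).PosSemidef := by
    have := hM.mul_mul_conjTranspose_same B
    rwa [Matrix.conjTranspose_eq_transpose_of_trivial, hBt] at this
  have htr : (B * M * B).trace = (R * diagonal g * Rᵀ * M).trace := by
    rw [Matrix.trace_mul_comm, ← Matrix.mul_assoc, hBB]
  have hdet : (B * M * B).det = (∏ i, g i) * M.det := by
    rw [← det_conj hR g, ← hBB]; simp only [Matrix.det_mul]; ring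
  rw [← htr, ← hdet, hP.1.det_eq_prod_eigenvalues, hP.1.trace_eq_sum_eigenvalues]
  exact prod_le_mean_pow hP.eigenvalues_nonneg

lemma trace_mul_nonneg (R : Matrix ι ι ℝ) {g : ι → ℝ} (hg : ∀ i, 0 ≤ g i)
    {M : Matrix ι ι ℝ} (hM : M.PosSemidef) : 0 ≤ (R * diagonal g * Rᵀ * M).trace := by
  have h1 : (R * diagonal g * Rᵀ * M).trace = (diagonal g * (Rᵀ * M * R)).trace := by
    rw [Matrix.mul_assoc R, Matrix.mul_assoc R, Matrix.trace_mul_comm]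
    simp only [Matrix.mul_assoc]
  have h2 := hM.conjTranspose_mul_mul_same R
  rw [Matrix.conjTranspose_eq_transpose_of_trivial] at h2
  rw [h1]
  simp only [Matrix.trace, Matrix.diag_apply, Matrix.diagonal_mul]
  exact Finset.sum_nonneg fun i _ => mul_nonneg (hg i) h2.diag_nonneg

section
variable {α β κ : ℝ} {A : Matrix ι ι ℝ}

lemma MAdm.transpose_eq (h : MAdm α β κ A) : Aᵀ = A := by
  obtain ⟨R, x, hR, rfl, hx⟩ := h; exact conj_transpose R x

lemma MAdm.symm (h : MAdm α β κ A) (i j : ι) : A i j = A j i :=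
  congrFun (congrFun h.transpose_eq j) i

lemma MAdm.gM_symm (h : MAdm α β κ A) (i j : ι) : gM α A i j = gM α A j i := by
  obtain ⟨R, x, hR, rfl, hx⟩ := h
  rw [conj_gM hR, gM_diagonal]
  exact congrFun (congrFun (conj_transpose R _) j) i

lemma MAdm.trace_pos (h : MAdm α β κ A) : 0 < A.trace := by
  obtain ⟨R, x, hR, rfl, hx⟩ := h
  rw [trace_conj_diagonal hR]; exact hx.pos1

lemma MAdm.e2M_pos (h : MAdm α β κ A) : 0 < e2M A := by
  obtain ⟨R, x, hR, rfl, hx⟩ := h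
  rw [e2M_conj hR]; exact hx.pos2

lemma MAdm.eqn (h : MAdm α β κ A) : e3M A - α * A.trace = β := by
  obtain ⟨R, x, hR, rfl, hx⟩ := h
  rw [e3M_conj hR, trace_conj_diagonal hR, hx.eqn]; ring

lemma MAdm.sq_le (h : MAdm α β κ A) (i j : ι) : A i j ^ 2 ≤ A.trace ^ 2 := by
  have h1 := h.e2M_pos
  have h2 : (A * A).trace = ∑ i, ∑ j, A i j ^ 2 := by
    simp only [Matrix.trace, Matrix.diag_apply, Matrix.mul_apply]
    exact Finset.sum_congr rfl fun a _ => Finset.sum_congr rfl fun b _ => by rw [h.symm b a]; ring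
  have h3 : A i j ^ 2 ≤ (A * A).trace := by
    rw [h2]
    refine le_trans ?_ (Finset.single_le_sum (f := fun i => ∑ j, A i j ^ 2)
      (fun i _ => Finset.sum_nonneg fun j _ => sq_nonneg _) (Finset.mem_univ i))
    exact Finset.single_le_sum (f := fun j => A i j ^ 2) (fun j _ => sq_nonneg _)
      (Finset.mem_univ j)
  unfold e2M at h1
  linarith

lemma MAdm.abs_le (h : MAdm α β κ A) (i j : ι) : |A i j| ≤ A.trace :=
  abs_le_of_sq_le_sq (h.sq_le i j) h.trace_pos.le

lemma MAdm.trace_gM_le (hα : 0 < α) (h : MAdm α β κ A) :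
    (gM α A).trace ≤ Fintype.card ι * e2M A := by
  obtain ⟨m, hm⟩ : ∃ m : ℝ, m = (Fintype.card ι : ℝ) := ⟨_, rfl⟩
  have e : (gM α A).trace = m * (e2M A - α) - A.trace ^ 2 + (A * A).trace := by
    unfold gM e2M
    rw [Matrix.trace_add, Matrix.trace_sub, Matrix.trace_smul, Matrix.trace_smul,
      Matrix.trace_one, smul_eq_mul, smul_eq_mul, hm]
    ring
  have hm0 : 0 ≤ m := by rw [hm]; positivity
  have h1 := h.e2M_pos
  have h2 : A.trace ^ 2 - (A * A).trace = 2 * e2M A := by unfold e2M; ring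
  rw [e, ← hm]
  nlinarith [mul_nonneg hm0 hα.le]

lemma MAdm.trace_sq_oM_ge (h : MAdm α β κ A) :
    (Fintype.card ι : ℝ) ≤ (oM κ A * oM κ A).trace := by
  obtain ⟨R, x, hR, rfl, hx⟩ := h
  rw [conj_oM hR, oM_diagonal, conj_mul hR, conj_trace hR]
  have eN : (diagonal (fun i => x i + κ) * diagonal (fun i => x i + κ)).trace =
      ∑ i, (x i + κ) ^ 2 := by simp [Matrix.trace, pow_two]
  rw [eN]
  have : (Fintype.card ι : ℝ) = ∑ i : ι, (1 : ℝ) := by simp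
  rw [this]
  exact Finset.sum_le_sum fun i hi => one_le_pow₀ (hx.low i hi)

variable (hα : 0 < α) (hβ : 0 ≤ β) (hκ : 0 ≤ κ)
include hα hβ

lemma MAdm.trace_sq_ge (h : MAdm α β κ A) : 6 * α ≤ A.trace ^ 2 := by
  obtain ⟨R, x, hR, rfl, hx⟩ := h
  rw [trace_conj_diagonal hR]; exact hx.f1_sq_ge hα hβ

lemma MAdm.gM_quad_nonneg (h : MAdm α β κ A) (ξ : ι → ℝ) : 0 ≤ ξ ⬝ᵥ gM α A *ᵥ ξ := by
  obtain ⟨R, x, hR, rfl, hx⟩ := h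
  rw [conj_gM hR, gM_diagonal, quad_conj]
  exact Finset.sum_nonneg fun i hi => mul_nonneg (hx.gG_pos hα hβ hi).le (sq_nonneg _)

include hκ

lemma MAdm.trace_sq_oM_le (h : MAdm α β κ A) : (oM κ A * oM κ A).trace ≤
    (2 + κ ^ 2 * (1 + Fintype.card ι) / (6 * α)) * A.trace ^ 2 := by
  have h1 := h.trace_sq_ge hα hβ
  have h2 := h.e2M_pos
  have h3 : (oM κ A * oM κ A).trace =
      (A * A).trace + 2 * κ * A.trace + κ ^ 2 * Fintype.card ι := by
    unfold oM
    simp only [Matrix.add_mul, Matrix.mul_add, Matrix.trace_add, Matrix.mul_smul, Matrix.smul_mul,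
      Matrix.trace_smul, Matrix.one_mul, Matrix.mul_one, Matrix.trace_one, smul_eq_mul]
    ring
  unfold e2M at h2
  have h4 : κ ^ 2 * (1 + Fintype.card ι) ≤
      κ ^ 2 * (1 + Fintype.card ι) / (6 * α) * A.trace ^ 2 := by
    rw [div_mul_eq_mul_div, le_div_iff₀ (by positivity)]
    exact mul_le_mul_of_nonneg_left h1 (by positivity)
  rw [h3]
  linarith [sq_nonneg (A.trace - κ)]

lemma exists_norm_sq_le_gM : ∃ C : ℝ, 0 ≤ C ∧ ∀ A : Matrix ι ι ℝ, MAdm α β κ A → ∀ ξ : ι → ℝ,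
    ξ ⬝ᵥ ξ ≤ C * A.trace * (ξ ⬝ᵥ gM α A *ᵥ ξ) := by
  obtain ⟨c, hc, H⟩ := exists_trace_gG_ge (κ := κ) hα hβ (Finset.univ : Finset ι)
  refine ⟨1 / c, by positivity, ?_⟩
  rintro A ⟨R, x, hR, rfl, hx⟩ ξ
  rw [conj_gM hR, gM_diagonal, quad_conj, dot_conj hR, trace_conj_diagonal hR, mul_assoc,
    Finset.mul_sum, Finset.mul_sum]
  refine Finset.sum_le_sum fun i hi => ?_
  have := mul_le_mul_of_nonneg_right (H x hx i hi) (sq_nonneg ((Rᵀ *ᵥ ξ) i))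
  rw [one_div, ← div_eq_inv_mul, le_div_iff₀ hc]
  linarith

lemma exists_compl_mulVec_le : ∃ C : ℝ, 0 ≤ C ∧ ∀ A : Matrix ι ι ℝ, MAdm α β κ A → ∀ ξ : ι → ℝ,
    ((A.trace • (1 : Matrix ι ι ℝ) - A) *ᵥ ξ) ⬝ᵥ ((A.trace • (1 : Matrix ι ι ℝ) - A) *ᵥ ξ) ≤
      C * e2M A * (ξ ⬝ᵥ gM α A *ᵥ ξ) := by
  obtain ⟨C, hC, H⟩ := exists_compl_sq_le hα hβ hκ (Finset.univ : Finset ι)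
  refine ⟨C, by linarith, ?_⟩
  rintro A ⟨R, x, hR, rfl, hx⟩ ξ
  have h1 := dot_mulVec_conj hR (fun i => f1 (Finset.univ.erase i) x) (fun _ => (1 : ℝ)) ξ
  rw [show diagonal (fun _ : ι => (1 : ℝ)) = 1 from Matrix.diagonal_one, conj_one hR,
    Matrix.one_mulVec] at h1
  rw [trace_conj_diagonal hR, complM_conj hR, h1, conj_gM hR, gM_diagonal, quad_conj,
    e2M_conj hR, Finset.mul_sum]
  refine Finset.sum_le_sum fun i hi => ?_
  have := mul_le_mul_of_nonneg_right (H x hx i hi) (sq_nonneg ((Rᵀ *ᵥ ξ) i))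
  linarith

variable (hcard : 2 ≤ Fintype.card ι)
include hcard

lemma exists_oM_quad_le : ∃ C : ℝ, 0 ≤ C ∧ ∀ A : Matrix ι ι ℝ, MAdm α β κ A → ∀ ξ : ι → ℝ,
    (oM κ A *ᵥ ξ) ⬝ᵥ (gM α A *ᵥ (oM κ A *ᵥ ξ)) ≤ C * e2M A * (ξ ⬝ᵥ ξ) := by
  obtain ⟨C, hC, H⟩ := exists_gomega_le hα hβ hκ (Finset.univ : Finset ι) hcard
  refine ⟨C, by linarith, ?_⟩
  rintro A ⟨R, x, hR, rfl, hx⟩ ξ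
  rw [conj_oM hR, oM_diagonal, conj_gM hR, gM_diagonal, dot_mulVec_conj hR, e2M_conj hR,
    dot_conj hR, Finset.mul_sum]
  exact Finset.sum_le_sum fun i hi =>
    mul_le_mul_of_nonneg_right (H x hx i hi) (sq_nonneg ((Rᵀ *ᵥ ξ) i))

/-- The determinant estimate behind the Alexandrov–Bakelman–Pucci argument. -/
lemma exists_det_le : ∃ C : ℝ, 0 ≤ C ∧ ∀ A : Matrix ι ι ℝ, MAdm α β κ A →
    ∀ (P : Matrix ι ι ℝ) (s : ℝ), (oM κ A * P).PosSemidef →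
      (gM α A * (oM κ A * P)).trace ≤ s * e2M A →
      |P.det| ≤ C * s ^ Fintype.card ι * e2M A := by
  obtain ⟨C, hC, H⟩ := exists_prod_le hα hβ hκ (Finset.univ : Finset ι) hcard
  obtain ⟨c, hc, H'⟩ := exists_gomega_ge hα hβ hκ (Finset.univ : Finset ι)
  have : Nonempty ι := Fintype.card_pos_iff.1 (by omega)
  obtain ⟨m, hm⟩ : ∃ m : ℕ, m = Fintype.card ι := ⟨_, rfl⟩
  refine ⟨C / c ^ m, by positivity, ?_⟩
  rintro A ⟨R, x, hR, rfl, hx⟩ P s hP htr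
  have h1 := det_mul_le_trace hR (fun i => (hx.gG_pos hα hβ (Finset.mem_univ i)).le) hP
  rw [conj_gM hR, gM_diagonal] at htr
  rw [← hm] at h1 ⊢
  have hm1 : (1 : ℝ) ≤ m := by rw [hm]; exact_mod_cast Fintype.card_pos
  have htr0 : 0 ≤
      (R * diagonal (gG α Finset.univ x) * Rᵀ * (oM κ (R * diagonal x * Rᵀ) * P)).trace :=
    trace_mul_nonneg R (fun i => (hx.gG_pos hα hβ (Finset.mem_univ i)).le) hP
  rw [e2M_conj hR] at htr ⊢
  have he2 := hx.pos2
  have h2 : (R * diagonal (gG α Finset.univ x) * Rᵀ * (oM κ (R * diagonal x * Rᵀ) * P)).trace / m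
      ≤ s * f2 Finset.univ x := (div_le_self htr0 hm1).trans htr
  have h3 := h1.trans (pow_le_pow_left₀ (by positivity) h2 m)
  have hdP : 0 ≤ (oM κ (R * diagonal x * Rᵀ) * P).det := hP.det_nonneg
  rw [Matrix.det_mul, conj_oM hR, oM_diagonal, det_conj hR] at h3 hdP
  obtain ⟨W, hW⟩ : ∃ W : ℝ, W = ∏ i, (x i + κ) := ⟨_, rfl⟩
  obtain ⟨Γ, hΓ⟩ : ∃ Γ : ℝ, Γ = ∏ i, gG α Finset.univ x i := ⟨_, rfl⟩
  have hW0 : 0 < W := by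
    rw [hW]; exact Finset.prod_pos fun i hi => by linarith [hx.low i hi]
  have hWle : W ≤ C * f2 Finset.univ x := by rw [hW]; exact H x hx
  have hΓW : (c * f2 Finset.univ x) ^ m ≤ Γ * W ^ 2 := by
    rw [hΓ, hW, ← Finset.prod_pow, ← Finset.prod_mul_distrib, hm, ← Finset.card_univ,
      ← Finset.prod_const]
    exact Finset.prod_le_prod (fun i _ => by positivity) fun i hi => H' x hx i hi
  rw [← hW] at h3 hdP
  rw [← hΓ] at h3
  have hPd : 0 ≤ P.det := nonneg_of_mul_nonneg_right hdP hW0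
  rw [abs_of_nonneg hPd]
  generalize f2 Finset.univ x = e at *
  have h4 : (c * e) ^ m * P.det ≤ W * (s * e) ^ m := by
    have h5 := mul_le_mul_of_nonneg_left h3 hW0.le
    have h6 := mul_le_mul_of_nonneg_right hΓW hPd
    calc (c * e) ^ m * P.det ≤ Γ * W ^ 2 * P.det := h6
      _ = W * (Γ * (W * P.det)) := by ring
      _ ≤ _ := h5
  rw [mul_pow, mul_pow] at h4
  have hs0 : 0 ≤ s := by
    have := htr0.trans htr
    exact nonneg_of_mul_nonneg_left this he2
  have hem : 0 < e ^ m := by positivity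
  have h5 : c ^ m * P.det ≤ W * s ^ m := by
    refine le_of_mul_le_mul_right ?_ hem
    linarith
  have h6 : W * s ^ m ≤ C * e * s ^ m := mul_le_mul_of_nonneg_right hWle (by positivity)
  rw [div_mul_eq_mul_div, div_mul_eq_mul_div, le_div_iff₀ (by positivity)]
  linarith

end

end HessQuot

namespace HessQuot
variable {ι : Type*} [DecidableEq ι]

open Matrix

lemma multiset_esymm_cons (a : ℝ) (s : Multiset ℝ) (k : ℕ) :
    (a ::ₘ s).esymm (k + 1) = s.esymm (k + 1) + a * s.esymm k := by
  simp [Multiset.esymm, Multiset.powersetCard_cons, Multiset.sum_map_mul_left]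

lemma esymm_eq (S : Finset ι) (x : ι → ℝ) : (S.val.map x).esymm 1 = f1 S x ∧
    (S.val.map x).esymm 2 = f2 S x ∧ (S.val.map x).esymm 3 = f3 S x := by
  induction S using Finset.induction_on with
  | empty => simp [Multiset.esymm, Multiset.powersetCard_zero_right, f1, f2, f3, ps]
  | insert a S ha ih =>
    obtain ⟨h1, h2, h3⟩ := ih
    have h0 : (S.val.map x).esymm 0 = 1 := by simp [Multiset.esymm]
    have hi := Finset.mem_insert_self a S
    rw [Finset.insert_val_of_notMem ha, Multiset.map_cons, multiset_esymm_cons,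
      multiset_esymm_cons, multiset_esymm_cons, h0, h1, h2, h3, f1_erase hi, f2_erase hi,
      f3_erase hi, Finset.erase_insert ha]
    refine ⟨?_, ?_, ?_⟩ <;> ring

lemma exists_diag {n : ℕ} {H : Matrix (Fin n) (Fin n) ℝ} (hH : Hᵀ = H) :
    ∃ (R : Matrix (Fin n) (Fin n) ℝ) (x : Fin n → ℝ), Rᵀ * R = 1 ∧ H = R * diagonal x * Rᵀ ∧
      ∀ k ≤ n, sigmaMat k H = (Finset.univ.val.map x).esymm k := by
  have hA : H.IsHermitian := by
    rw [Matrix.IsHermitian, Matrix.conjTranspose_eq_transpose_of_trivial, hH]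
  refine ⟨hA.eigenvectorUnitary, hA.eigenvalues, ?_, ?_, fun k hk => ?_⟩
  · have := Unitary.coe_star_mul_self hA.eigenvectorUnitary
    rwa [Matrix.star_eq_conjTranspose, Matrix.conjTranspose_eq_transpose_of_trivial] at this
  · have := hA.spectral_theorem
    rw [Unitary.conjStarAlgAut_apply, Matrix.star_eq_conjTranspose,
      Matrix.conjTranspose_eq_transpose_of_trivial] at this
    exact this
  · unfold sigmaMat
    have e : H.charpoly =
        ((Finset.univ.val.map hA.eigenvalues).map fun t => Polynomial.X - Polynomial.C t).prod := by
      rw [hA.charpoly_eq, Multiset.map_map]; rfl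
    rw [e, Multiset.prod_X_sub_C_coeff _ (by simp)]
    have h1 : Multiset.card (Finset.univ.val.map hA.eigenvalues) - (n - k) = k := by
      simp; omega
    rw [h1, ← mul_assoc, ← pow_add, ← two_mul, pow_mul]
    norm_num

/-- The shift turning `σ₃ = σ₂` into `σ₃ = α σ₁ + β`. -/
lemma adm_shift {S : Finset ι} {x : ι → ℝ} {m t : ℝ} (hm : m = S.card) (h3 : 3 ≤ m)
    (ht : t * (m - 2) = 1)
    (h1 : 0 < f1 S x) (h2 : 0 < f2 S x) (heq : f3 S x = f2 S x) {κ : ℝ}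
    (hlow : ∀ i ∈ S, 1 ≤ x i - t + κ) :
    Adm ((m - 1) / (2 * (m - 2))) (m * (m - 1) / (3 * (m - 2) ^ 2)) κ S (fun i => x i + -t) := by
  have hm2 : 0 < m - 2 := by linarith
  have htpos : 0 < t := by
    by_contra hneg
    nlinarith
  have n1 := newton_card S x
  have n2 := f2_card S x
  rw [← hm] at n1 n2
  rw [heq] at n1
  have a1 : 3 * m * f1 S x ≤ 2 * (m - 1) * f2 S x := by
    refine le_of_mul_le_mul_right ?_ h2
    linarith
  obtain ⟨p, hp⟩ : ∃ p, p = f1 S x := ⟨_, rfl⟩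
  obtain ⟨q, hq⟩ : ∃ q, q = f2 S x := ⟨_, rfl⟩
  have e1 := f1_add S x (-t)
  have e2 := f2_add S x (-t)
  have e3 := f3_add S x (-t)
  rw [heq] at e3
  rw [← hm, ← hp] at e1
  rw [← hm, ← hp, ← hq] at e2 e3
  rw [← hp, ← hq] at a1 n2
  rw [← hp] at h1
  rw [← hq] at h2
  have a2 : 3 * m ^ 2 ≤ (m - 1) ^ 2 * p := by
    refine le_of_mul_le_mul_right ?_ h1
    have := mul_le_mul_of_nonneg_left a1 (by linarith : 0 ≤ m)
    have := mul_le_mul_of_nonneg_left n2 (by linarith : 0 ≤ m - 1)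
    nlinarith
  have p1 : 0 < p + m * -t := by
    have h5 : m * (m - 1) ^ 2 < 3 * m ^ 2 * (m - 2) := by nlinarith
    have h6 : m * (m - 1) ^ 2 < (m - 1) ^ 2 * p * (m - 2) :=
      lt_of_lt_of_le h5 (mul_le_mul_of_nonneg_right a2 hm2.le)
    have h7 : m < p * (m - 2) := by
      have : 0 < (m - 1) ^ 2 := by nlinarith
      refine lt_of_mul_lt_mul_left ?_ this.le
      linarith
    refine pos_of_mul_pos_left ?_ hm2.le
    have : (p + m * -t) * (m - 2) = p * (m - 2) - m * (t * (m - 2)) := by ring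
    rw [this, ht]; linarith
  have htm : t * m = 1 + 2 * t := by linarith
  have f3e : f3 S (fun i => x i + -t) =
      (m - 1) / (2 * (m - 2)) * f1 S (fun i => x i + -t) + m * (m - 1) / (3 * (m - 2) ^ 2) := by
    have ht' : t = 1 / (m - 2) := by field_simp; linarith
    rw [e3, e1, ht']
    field_simp
    ring
  refine ⟨?_, ?_, ?_, f3e, fun i hi => by linarith [hlow i hi]⟩
  · rw [e1]; exact p1
  · rw [e2]
    have h8 : 0 < t * (m - 1) := by nlinarith
    have h9 : 2 * (m - 1) * (q + (m - 1) * -t * p + m * (m - 1) / 2 * (-t) ^ 2) =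
      2 * (m - 1) * q - 2 * (t * (m - 1)) * (m - 1) * p + m * (t * (m - 1)) ^ 2 := by ring
    have h10 : t * (m - 1) = 1 + t := by linarith
    have ht1 : t ≤ 1 := by nlinarith
    refine pos_of_mul_pos_left (b := 2 * (m - 1)) ?_ (by linarith)
    rw [mul_comm, h9, h10]
    have h11 : (1 + t) * (m - 1) = m + t := by linarith
    have h12 : 2 * (1 + t) * (m - 1) * p = 2 * (m + t) * p := by rw [← h11]; ring
    rw [h12]
    have h13 : 0 ≤ (m - 3) * p := mul_nonneg (by linarith) h1.le
    have h14 : 0 ≤ (1 - t) * p := mul_nonneg (by linarith) h1.le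
    have h15 : 0 < m * (1 + t) ^ 2 := by positivity
    linarith
  · rw [f3e, e1]
    have : 0 < m - 1 := by linarith
    have : 0 < m := by linarith
    positivity

/-- Admissibility of the (shifted) Hessian. -/
lemma exists_mAdm {n : ℕ} (hn : 3 ≤ n) {l : ℕ} (hl : l = 1 ∨ l = 2) :
    ∃ α β t : ℝ, 0 < α ∧ 0 ≤ β ∧ 0 ≤ t ∧ ∀ K κ : ℝ, K + t + 1 ≤ κ →
      ∀ H : Matrix (Fin n) (Fin n) ℝ, Hᵀ = H →
      (∀ i : ℕ, 1 ≤ i → i ≤ 3 → 0 < sigmaMat i H) → sigmaMat 3 H = sigmaMat l H →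
      (H + K • (1 : Matrix (Fin n) (Fin n) ℝ)).PosSemidef →
      MAdm α β κ (H - t • (1 : Matrix (Fin n) (Fin n) ℝ)) := by
  have hn' : (3 : ℝ) ≤ n := by exact_mod_cast hn
  have hlow : ∀ (K : ℝ) (R : Matrix (Fin n) (Fin n) ℝ) (x : Fin n → ℝ), Rᵀ * R = 1 →
      (R * diagonal x * Rᵀ + K • (1 : Matrix (Fin n) (Fin n) ℝ)).PosSemidef →
      ∀ i, 0 ≤ x i + K := fun K R x hR hP i => by
    have h1 := conj_oM hR K (diagonal x)
    rw [oM_diagonal] at h1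
    unfold oM at h1
    rw [h1] at hP
    have h2 := hP.conjTranspose_mul_mul_same R
    rw [Matrix.conjTranspose_eq_transpose_of_trivial] at h2
    have h3 : Rᵀ * (R * diagonal (fun i => x i + K) * Rᵀ) * R = diagonal (fun i => x i + K) := by
      calc _ = (Rᵀ * R) * diagonal (fun i => x i + K) * (Rᵀ * R) := by
            simp only [Matrix.mul_assoc]
        _ = _ := by rw [hR, Matrix.one_mul, Matrix.mul_one]
    rw [h3] at h2
    simpa using h2.diag_nonneg (i := i)
  rcases hl with rfl | rfl
  · refine ⟨1, 0, 0, one_pos, le_rfl, le_rfl, fun K κ hκ H hH hpos heq hP => ?_⟩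
    obtain ⟨R, x, hR, rfl, hs⟩ := exists_diag hH
    obtain ⟨s1, s2, s3⟩ := esymm_eq Finset.univ x
    have p1 := hpos 1 le_rfl (by norm_num)
    have p2 := hpos 2 (by norm_num) (by norm_num)
    have p3 := hpos 3 (by norm_num) le_rfl
    rw [hs 1 (by omega), s1] at p1 heq
    rw [hs 2 (by omega), s2] at p2
    rw [hs 3 (by omega), s3] at p3 heq
    refine ⟨R, x, hR, by simp, p1, p2, p3, by linarith, fun i _ => ?_⟩
    linarith [hlow K R x hR hP i]
  · have hm2 : (0 : ℝ) < n - 2 := by linarith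
    have hm1 : (0 : ℝ) < n - 1 := by linarith
    refine ⟨((n : ℝ) - 1) / (2 * (n - 2)), n * (n - 1) / (3 * (n - 2) ^ 2), 1 / ((n : ℝ) - 2),
      by positivity, by positivity, by positivity, fun K κ hκ H hH hpos heq hP => ?_⟩
    obtain ⟨R, x, hR, rfl, hs⟩ := exists_diag hH
    obtain ⟨s1, s2, s3⟩ := esymm_eq Finset.univ x
    have p1 := hpos 1 le_rfl (by norm_num)
    have p2 := hpos 2 (by norm_num) (by norm_num)
    rw [hs 1 (by omega), s1] at p1
    rw [hs 2 (by omega), s2] at p2 heq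
    rw [hs 3 (by omega), s3] at heq
    refine ⟨R, fun i => x i + -(1 / ((n : ℝ) - 2)), hR, ?_,
      adm_shift (by simp) hn' (by field_simp) p1 p2 heq fun i _ => ?_⟩
    · have h1 := conj_oM hR (-(1 / ((n : ℝ) - 2))) (diagonal x)
      rw [oM_diagonal] at h1
      rw [← h1]
      unfold oM
      rw [neg_smul, sub_eq_add_neg]
    · linarith [hlow K R x hR hP i]

end HessQuot

namespace HessQuot
variable {n : ℕ}

open Matrix

/-- Partial derivative in the `k`-th coordinate direction. -/
def pd (k : Fin n) (f : EuclideanSpace ℝ (Fin n) → ℝ) (x : EuclideanSpace ℝ (Fin n)) : ℝ :=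
  fderiv ℝ f x (EuclideanSpace.single k 1)

/-- `f` is differentiable at `x` with `k`-th partial derivative `d`. -/
def HasPD (k : Fin n) (f : EuclideanSpace ℝ (Fin n) → ℝ) (d : ℝ)
    (x : EuclideanSpace ℝ (Fin n)) : Prop :=
  DifferentiableAt ℝ f x ∧ pd k f x = d

section
variable {k : Fin n} {f g : EuclideanSpace ℝ (Fin n) → ℝ} {d e : ℝ}
  {x : EuclideanSpace ℝ (Fin n)}

lemma HasPD.pd_eq (h : HasPD k f d x) : pd k f x = d := h.2

lemma _root_.DifferentiableAt.hasPD (h : DifferentiableAt ℝ f x) : HasPD k f (pd k f x) x :=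
  ⟨h, rfl⟩

lemma _root_.HasFDerivAt.hasPD {f' : EuclideanSpace ℝ (Fin n) →L[ℝ] ℝ} (h : HasFDerivAt f f' x) :
    HasPD k f (f' (EuclideanSpace.single k 1)) x :=
  ⟨h.differentiableAt, by rw [pd, h.fderiv]⟩

lemma HasPD.congr_val (h : HasPD k f d x) (he : d = e) : HasPD k f e x := he ▸ h

lemma hasPD_const (c : ℝ) : HasPD k (fun _ => c) 0 x := (hasFDerivAt_const c x).hasPD

lemma HasPD.add (hf : HasPD k f d x) (hg : HasPD k g e x) :
    HasPD k (fun y => f y + g y) (d + e) x :=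
  ((hf.1.hasFDerivAt.add hg.1.hasFDerivAt).hasPD).congr_val (by
    rw [← hf.2, ← hg.2]; rfl)

lemma HasPD.sub (hf : HasPD k f d x) (hg : HasPD k g e x) :
    HasPD k (fun y => f y - g y) (d - e) x :=
  ((hf.1.hasFDerivAt.sub hg.1.hasFDerivAt).hasPD).congr_val (by
    rw [← hf.2, ← hg.2]; rfl)

lemma HasPD.neg (hf : HasPD k f d x) : HasPD k (fun y => -f y) (-d) x :=
  (hf.1.hasFDerivAt.neg.hasPD).congr_val (by rw [← hf.2]; rfl)

lemma HasPD.mul (hf : HasPD k f d x) (hg : HasPD k g e x) :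
    HasPD k (fun y => f y * g y) (d * g x + f x * e) x :=
  ((hf.1.hasFDerivAt.mul hg.1.hasFDerivAt).hasPD).congr_val (by
    rw [← hf.2, ← hg.2]
    simp [pd]; ring)

lemma HasPD.const_mul (c : ℝ) (hf : HasPD k f d x) : HasPD k (fun y => c * f y) (c * d) x :=
  ((hasPD_const c).mul hf).congr_val (by ring)

lemma HasPD.div_const (hf : HasPD k f d x) (c : ℝ) : HasPD k (fun y => f y / c) (d / c) x := by
  simp only [div_eq_inv_mul]; exact hf.const_mul _

lemma HasPD.sum {ι : Type*} {S : Finset ι} {F : ι → EuclideanSpace ℝ (Fin n) → ℝ} {D : ι → ℝ}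
    (h : ∀ i ∈ S, HasPD k (F i) (D i) x) :
    HasPD k (fun y => ∑ i ∈ S, F i y) (∑ i ∈ S, D i) x := by
  classical
  induction S using Finset.induction_on with
  | empty => simpa using hasPD_const 0
  | insert a S ha ih =>
    simp only [Finset.sum_insert ha]
    exact (h a (Finset.mem_insert_self a S)).add (ih fun i hi => h i (Finset.mem_insert_of_mem hi))

lemma HasPD.comp {φ : ℝ → ℝ} {φ' : ℝ} (hφ : HasDerivAt φ φ' (f x)) (hf : HasPD k f d x) :
    HasPD k (fun y => φ (f y)) (φ' * d) x :=
  ((hφ.comp_hasFDerivAt x hf.1.hasFDerivAt).hasPD).congr_val (by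
    rw [← hf.2]; simp [pd])

lemma HasPD.pow (hf : HasPD k f d x) (m : ℕ) :
    HasPD k (fun y => f y ^ m) (m * f x ^ (m - 1) * d) x :=
  HasPD.comp (φ := fun t => t ^ m) (hasDerivAt_pow m (f x)) hf

lemma hasPD_coord (j : Fin n) : HasPD k (fun y => y j) (if j = k then 1 else 0) x :=
  ((EuclideanSpace.proj (𝕜 := ℝ) j).hasFDerivAt (x := x)).hasPD.congr_val (by simp)

end

/-- Entrywise partial derivative of a matrix valued map. -/
def HasMD (k : Fin n) {ι : Type*} (Y : EuclideanSpace ℝ (Fin n) → Matrix ι ι ℝ) (Y' : Matrix ι ι ℝ)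
    (x : EuclideanSpace ℝ (Fin n)) : Prop :=
  ∀ i j, HasPD k (fun y => Y y i j) (Y' i j) x

section
variable {ι : Type*} [Fintype ι] [DecidableEq ι] {k : Fin n}
  {Y Z : EuclideanSpace ℝ (Fin n) → Matrix ι ι ℝ}
  {Y' Z' : Matrix ι ι ℝ} {x : EuclideanSpace ℝ (Fin n)} {f : EuclideanSpace ℝ (Fin n) → ℝ} {d : ℝ}

lemma hasMD_const (C : Matrix ι ι ℝ) : HasMD k (fun _ => C) 0 x := fun _ _ => hasPD_const _

lemma HasMD.congr_val (hY : HasMD k Y Y' x) (h : Y' = Z') : HasMD k Y Z' x := h ▸ hY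

lemma HasMD.add (hY : HasMD k Y Y' x) (hZ : HasMD k Z Z' x) :
    HasMD k (fun y => Y y + Z y) (Y' + Z') x := fun i j => (hY i j).add (hZ i j)

lemma HasMD.sub (hY : HasMD k Y Y' x) (hZ : HasMD k Z Z' x) :
    HasMD k (fun y => Y y - Z y) (Y' - Z') x := fun i j => (hY i j).sub (hZ i j)

lemma HasMD.smul (hf : HasPD k f d x) (hZ : HasMD k Z Z' x) :
    HasMD k (fun y => f y • Z y) (d • Z x + f x • Z') x := fun i j => hf.mul (hZ i j)

lemma HasMD.mul (hY : HasMD k Y Y' x) (hZ : HasMD k Z Z' x) :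
    HasMD k (fun y => Y y * Z y) (Y' * Z x + Y x * Z') x := fun i j => by
  simp only [Matrix.mul_apply, Matrix.add_apply, ← Finset.sum_add_distrib]
  exact HasPD.sum fun m _ => (hY i m).mul (hZ m j)

lemma HasMD.trace (hY : HasMD k Y Y' x) : HasPD k (fun y => (Y y).trace) Y'.trace x :=
  HasPD.sum fun i _ => hY i i

lemma HasMD.oM (κ : ℝ) (hY : HasMD k Y Y' x) : HasMD k (fun y => oM κ (Y y)) Y' x :=
  (hY.add (hasMD_const _)).congr_val (add_zero _)

lemma HasMD.gM (α : ℝ) (hY : HasMD k Y Y' x) : HasMD k (fun y => gM α (Y y))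
    (((Y x).trace * Y'.trace - (Y x * Y').trace) • (1 : Matrix ι ι ℝ)
      - (Y'.trace • Y x + (Y x).trace • Y') + (Y' * Y x + Y x * Y')) x := by
  have h1 : HasPD k (fun y => ((Y y).trace ^ 2 - (Y y * Y y).trace) / 2 - α)
      ((Y x).trace * Y'.trace - (Y x * Y').trace) x :=
    ((((hY.trace.pow 2).sub (hY.mul hY).trace).div_const 2).sub (hasPD_const α)).congr_val (by
      rw [Matrix.trace_add, Matrix.trace_mul_comm Y']; push_cast; ring)
  refine (((HasMD.smul h1 (hasMD_const 1)).sub (HasMD.smul hY.trace hY)).add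
    (hY.mul hY)).congr_val ?_
  rw [smul_zero, add_zero]

lemma HasMD.e3M_sub (α : ℝ) (hY : HasMD k Y Y' x) :
    HasPD k (fun y => e3M (Y y) - α * (Y y).trace) (HessQuot.gM α (Y x) * Y').trace x := by
  have h1 := hY.trace
  have h2 := (hY.mul hY).trace
  have h3 := ((hY.mul hY).mul hY).trace
  refine (((((h1.pow 3).sub ((h1.const_mul 3).mul h2)).add (h3.const_mul 2)).div_const 6).sub
    (h1.const_mul α)).congr_val ?_
  have c1 : (Y' * Y x).trace = (Y x * Y').trace := Matrix.trace_mul_comm _ _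
  have c2 : (Y' * Y x * Y x).trace = (Y x * Y x * Y').trace := by
    rw [Matrix.mul_assoc, Matrix.trace_mul_comm]
  have c3 : (Y x * Y' * Y x).trace = (Y x * Y x * Y').trace := by
    rw [Matrix.trace_mul_comm, Matrix.mul_assoc]
  unfold HessQuot.gM
  simp only [Matrix.add_mul, Matrix.sub_mul, Matrix.smul_mul, Matrix.trace_add, Matrix.trace_sub,
    Matrix.trace_smul, Matrix.one_mul, smul_eq_mul, c1, c2, c3]
  push_cast
  ring

lemma trace_gM_deriv (A Y Z : Matrix ι ι ℝ) :
    (((A.trace * Y.trace - (A * Y).trace) • (1 : Matrix ι ι ℝ)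
      - (Y.trace • A + A.trace • Y) + (Y * A + A * Y)) * Z).trace = -bM A Y Z := by
  unfold bM
  have c1 : (Y * A * Z).trace = (A * (Z * Y)).trace := by
    rw [Matrix.mul_assoc, Matrix.trace_mul_comm, Matrix.mul_assoc]
  simp only [Matrix.add_mul, Matrix.sub_mul, Matrix.smul_mul, Matrix.trace_add, Matrix.trace_sub,
    Matrix.trace_smul, Matrix.one_mul, smul_eq_mul, c1, Matrix.mul_add, Matrix.mul_assoc A]
  ring

end

section
variable {f : EuclideanSpace ℝ (Fin n) → ℝ} {U : Set (EuclideanSpace ℝ (Fin n))}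

lemma contDiffOn_pd (hU : IsOpen U) {m : ℕ} (hf : ContDiffOn ℝ (m + 1) f U) (k : Fin n) :
    ContDiffOn ℝ m (pd k f) U :=
  (hf.fderiv_of_isOpen hU le_rfl).clm_apply contDiffOn_const

lemma pd_comm (hU : IsOpen U) (hf : ContDiffOn ℝ 2 f U) {x : EuclideanSpace ℝ (Fin n)}
    (hx : x ∈ U) (i j : Fin n) : pd i (pd j f) x = pd j (pd i f) x := by
  have h1 := hf.contDiffAt (hU.mem_nhds hx)
  have hs : IsSymmSndFDerivAt ℝ f x := h1.isSymmSndFDerivAt (by simp)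
  have hd : DifferentiableAt ℝ (fderiv ℝ f) x :=
    (h1.fderiv_right (m := 1) (by norm_num)).differentiableAt (by norm_num)
  have key : ∀ a b : Fin n, pd a (pd b f) x =
      fderiv ℝ (fderiv ℝ f) x (EuclideanSpace.single a 1) (EuclideanSpace.single b 1) := by
    intro a b
    have : HasFDerivAt (pd b f) _ x := hd.hasFDerivAt.clm_apply
      (hasFDerivAt_const (EuclideanSpace.single b (1 : ℝ)) x)
    rw [pd, this.fderiv]
    simp
  rw [key, key, hs.eq]

end

end HessQuot

namespace HessQuot
variable {n : ℕ}

open Matrix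

/-- The ball of radius `5`. -/
abbrev bigBall (n : ℕ) : Set (EuclideanSpace ℝ (Fin n)) := Metric.ball 0 5

lemma isOpen_bigBall : IsOpen (bigBall n) := Metric.isOpen_ball

/-- Jacobian matrix of the map `w`. -/
def jac (w : Fin n → EuclideanSpace ℝ (Fin n) → ℝ) (x : EuclideanSpace ℝ (Fin n)) :
    Matrix (Fin n) (Fin n) ℝ := fun i j => pd i (w j) x

/-- Partial derivative of the Jacobian matrix of `w`. -/
def jacD (w : Fin n → EuclideanSpace ℝ (Fin n) → ℝ) (k : Fin n)
    (x : EuclideanSpace ℝ (Fin n)) : Matrix (Fin n) (Fin n) ℝ :=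
  fun i j => pd k (fun y => jac w y i j) x

/-- Second partial derivatives of the Jacobian matrix of `w`. -/
def jacDD (w : Fin n → EuclideanSpace ℝ (Fin n) → ℝ) (l k : Fin n)
    (x : EuclideanSpace ℝ (Fin n)) : Matrix (Fin n) (Fin n) ℝ :=
  fun i j => pd l (fun y => jacD w k y i j) x

/-- Gradient fields of admissible solutions on the ball of radius `5`. -/
structure Sol (α β κ M : ℝ) (w : Fin n → EuclideanSpace ℝ (Fin n) → ℝ) : Prop where
  smooth : ∀ j, ContDiffOn ℝ 3 (w j) (bigBall n)
  adm : ∀ x ∈ bigBall n, MAdm α β κ (jac w x)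
  bdd : ∀ j, ∀ x ∈ bigBall n, |w j x| ≤ M

/-- Squared Frobenius norm of the shifted Jacobian. -/
def sqN (κ : ℝ) (w : Fin n → EuclideanSpace ℝ (Fin n) → ℝ) (x : EuclideanSpace ℝ (Fin n)) : ℝ :=
  (oM κ (jac w x) * oM κ (jac w x)).trace

/-- Logarithm of `sqN`. -/
def logN (κ : ℝ) (w : Fin n → EuclideanSpace ℝ (Fin n) → ℝ) (x : EuclideanSpace ℝ (Fin n)) : ℝ :=
  Real.log (sqN κ w x)

lemma pd_congr {U : Set (EuclideanSpace ℝ (Fin n))} (hU : IsOpen U)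
    {f g : EuclideanSpace ℝ (Fin n) → ℝ} (h : ∀ y ∈ U, f y = g y) {x : EuclideanSpace ℝ (Fin n)}
    (hx : x ∈ U) (k : Fin n) : pd k f x = pd k g x := by
  have : f =ᶠ[nhds x] g := Filter.eventuallyEq_of_mem (hU.mem_nhds hx) h
  rw [pd, pd, this.fderiv_eq]

section
variable {m : WithTop ℕ∞} {Y Z : EuclideanSpace ℝ (Fin n) → Matrix (Fin n) (Fin n) ℝ}
  {U : Set (EuclideanSpace ℝ (Fin n))}

lemma contDiffOn_mul (hY : ∀ i j, ContDiffOn ℝ m (fun y => Y y i j) U)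
    (hZ : ∀ i j, ContDiffOn ℝ m (fun y => Z y i j) U) (i j : Fin n) :
    ContDiffOn ℝ m (fun y => (Y y * Z y) i j) U := by
  simp only [Matrix.mul_apply]
  exact ContDiffOn.sum fun k _ => (hY i k).mul (hZ k j)

lemma contDiffOn_trace (hY : ∀ i j, ContDiffOn ℝ m (fun y => Y y i j) U) :
    ContDiffOn ℝ m (fun y => (Y y).trace) U :=
  ContDiffOn.sum fun k _ => hY k k

lemma contDiffOn_oM (κ : ℝ) (hY : ∀ i j, ContDiffOn ℝ m (fun y => Y y i j) U) (i j : Fin n) :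
    ContDiffOn ℝ m (fun y => oM κ (Y y) i j) U :=
  (hY i j).add contDiffOn_const

lemma contDiffOn_gM (α : ℝ) (hY : ∀ i j, ContDiffOn ℝ m (fun y => Y y i j) U) (i j : Fin n) :
    ContDiffOn ℝ m (fun y => gM α (Y y) i j) U := by
  have h1 := contDiffOn_trace hY
  have h2 := contDiffOn_mul hY hY
  have h3 := contDiffOn_trace h2
  exact ((((((h1.pow 2).sub h3).div_const 2).sub contDiffOn_const).mul contDiffOn_const).sub
    (h1.mul (hY i j))).add (h2 i j)

end

namespace Sol
variable {α β κ M : ℝ} {w : Fin n → EuclideanSpace ℝ (Fin n) → ℝ} (h : Sol α β κ M w)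
  {x : EuclideanSpace ℝ (Fin n)}
include h

lemma contDiffOn_jac (i j : Fin n) : ContDiffOn ℝ 2 (fun y => jac w y i j) (bigBall n) :=
  contDiffOn_pd (m := 2) isOpen_bigBall ((h.smooth j).of_le (by norm_num)) i

lemma contDiffOn_jacD (k i j : Fin n) : ContDiffOn ℝ 1 (fun y => jacD w k y i j) (bigBall n) :=
  contDiffOn_pd (m := 1) isOpen_bigBall ((h.contDiffOn_jac i j).of_le (by norm_num)) k

lemma hasMD_jac (hx : x ∈ bigBall n) (k : Fin n) : HasMD k (jac w) (jacD w k x) x := fun i j =>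
  (((h.contDiffOn_jac i j).contDiffAt (isOpen_bigBall.mem_nhds hx)).differentiableAt
    (by norm_num)).hasPD

lemma hasMD_jacD (hx : x ∈ bigBall n) (l k : Fin n) :
    HasMD l (jacD w k) (jacDD w l k x) x := fun i j =>
  (((h.contDiffOn_jacD k i j).contDiffAt (isOpen_bigBall.mem_nhds hx)).differentiableAt
    (by norm_num)).hasPD

lemma hasPD_w (hx : x ∈ bigBall n) (k j : Fin n) : HasPD k (w j) (jac w x k j) x :=
  (((h.smooth j).contDiffAt (isOpen_bigBall.mem_nhds hx)).differentiableAt (by norm_num)).hasPD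

lemma jacD_symm (hx : x ∈ bigBall n) (k i j : Fin n) : jacD w k x i j = jacD w k x j i :=
  pd_congr isOpen_bigBall (fun y hy => (h.adm y hy).symm i j) hx k

lemma jacD_comm (hx : x ∈ bigBall n) (k i j : Fin n) : jacD w k x i j = jacD w i x k j :=
  pd_comm isOpen_bigBall ((h.smooth j).of_le (by norm_num)) hx k i

lemma jacDD_symm (hx : x ∈ bigBall n) (l k i j : Fin n) :
    jacDD w l k x i j = jacDD w l k x j i :=
  pd_congr isOpen_bigBall (fun _ hy => h.jacD_symm hy k i j) hx l

lemma jacDD_comm (hx : x ∈ bigBall n) (l k i j : Fin n) :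
    jacDD w l k x i j = jacDD w j i x k l := by
  have s1 := h.jacDD_symm hx
  have s2 : ∀ l k i j, jacDD w l k x i j = jacDD w l i x k j := fun l k i j =>
    pd_congr isOpen_bigBall (fun y hy => h.jacD_comm hy k i j) hx l
  have s3 : ∀ l k i j, jacDD w l k x i j = jacDD w k l x i j := fun l k i j =>
    pd_comm isOpen_bigBall (h.contDiffOn_jac i j) hx l k
  rw [s1 l k i j, s2 l k j i, s3 l j k i, s1 j l k i, s2 j l i k, s1 j i l k]

lemma trace_gM_jacD (hx : x ∈ bigBall n) (k : Fin n) : (gM α (jac w x) * jacD w k x).trace = 0 := by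
  have h1 := ((h.hasMD_jac hx k).e3M_sub α).pd_eq
  rw [← h1, pd_congr isOpen_bigBall (g := fun _ => β) (fun y hy => (h.adm y hy).eqn) hx k]
  exact (hasPD_const β).pd_eq

lemma trace_gM_jacDD (hx : x ∈ bigBall n) (l k : Fin n) :
    (gM α (jac w x) * jacDD w l k x).trace = bM (jac w x) (jacD w l x) (jacD w k x) := by
  have h1 := (((h.hasMD_jac hx l).gM α).mul (h.hasMD_jacD hx l k)).trace.pd_eq
  rw [pd_congr isOpen_bigBall (g := fun _ => 0) (fun y hy => h.trace_gM_jacD hy k) hx l,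
    (hasPD_const 0).pd_eq, Matrix.trace_add, trace_gM_deriv] at h1
  linarith

lemma sum_pd_compl (hx : x ∈ bigBall n) (j : Fin n) :
    ∑ i, ((jacD w i x).trace * (if i = j then 1 else 0) - jacD w i x i j) = 0 := by
  rw [Finset.sum_sub_distrib]
  simp only [mul_ite, mul_one, mul_zero, Finset.sum_ite_eq', Finset.mem_univ, if_true]
  rw [sub_eq_zero]
  refine Finset.sum_congr rfl fun i _ => ?_
  rw [Matrix.diag_apply, h.jacD_comm hx, h.jacD_symm hx]

lemma sum_pd_gM (hx : x ∈ bigBall n) (j : Fin n) :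
    ∑ i, (((jac w x).trace * (jacD w i x).trace -
      (jac w x * jacD w i x).trace) •
      (1 : Matrix (Fin n) (Fin n) ℝ) - ((jacD w i x).trace • jac w x + (jac w x).trace • jacD w i x)
      + (jacD w i x * jac w x + jac w x * jacD w i x)) i j = 0 := by
  have e1 : ∑ i, jacD w i x i j = (jacD w j x).trace := by
    refine Finset.sum_congr rfl fun i _ => ?_
    rw [Matrix.diag_apply, h.jacD_symm hx, h.jacD_comm hx, h.jacD_symm hx]
  have e2 : ∑ i, (jacD w i x * jac w x) i j = ∑ i, (jacD w i x).trace * jac w x i j := by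
    simp only [Matrix.mul_apply]
    refine Eq.trans Finset.sum_comm ?_
    refine Finset.sum_congr rfl fun k _ => ?_
    rw [← Finset.sum_mul]
    congr 1
    refine Finset.sum_congr rfl fun i _ => ?_
    rw [Matrix.diag_apply, h.jacD_symm hx, h.jacD_comm hx]
  have e3 : ∑ i, (jac w x * jacD w i x) i j = (jac w x * jacD w j x).trace := by
    simp only [Matrix.mul_apply, Matrix.trace, Matrix.diag_apply]
    refine Finset.sum_congr rfl fun i _ => Finset.sum_congr rfl fun k _ => ?_
    rw [h.jacD_symm hx, h.jacD_comm hx, h.jacD_symm hx]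
  simp only [Matrix.add_apply, Matrix.sub_apply, Matrix.smul_apply, smul_eq_mul,
    Matrix.one_apply, mul_ite, mul_one, mul_zero, Finset.sum_add_distrib, Finset.sum_sub_distrib,
    Finset.sum_ite_eq', Finset.mem_univ, if_true, e2, e3, ← Finset.mul_sum, e1]
  ring

lemma hasPD_sqN (hx : x ∈ bigBall n) (k : Fin n) :
    HasPD k (sqN κ w) (2 * (oM κ (jac w x) * jacD w k x).trace) x := by
  have h1 := (h.hasMD_jac hx k).oM κ
  refine (h1.mul h1).trace.congr_val ?_
  rw [Matrix.trace_add, Matrix.trace_mul_comm (jacD w k x)]; ring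

lemma card_le_sqN (hx : x ∈ bigBall n) : (n : ℝ) ≤ sqN κ w x := by
  have := (h.adm x hx).trace_sq_oM_ge
  rwa [Fintype.card_fin] at this

lemma contDiffOn_sqN : ContDiffOn ℝ 2 (sqN κ w) (bigBall n) :=
  contDiffOn_trace (contDiffOn_mul (contDiffOn_oM κ h.contDiffOn_jac)
    (contDiffOn_oM κ h.contDiffOn_jac))

end Sol

/-- Partial derivatives of `logN`. -/
def logD (κ : ℝ) (w : Fin n → EuclideanSpace ℝ (Fin n) → ℝ) (k : Fin n)
    (x : EuclideanSpace ℝ (Fin n)) : ℝ :=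
  (sqN κ w x)⁻¹ * (2 * (oM κ (jac w x) * jacD w k x).trace)

namespace Sol
variable {α β κ M : ℝ} {w : Fin n → EuclideanSpace ℝ (Fin n) → ℝ} (h : Sol α β κ M w)
  {x : EuclideanSpace ℝ (Fin n)} (hn : 3 ≤ n)
include h hn

lemma sqN_pos (hx : x ∈ bigBall n) : 0 < sqN κ w x := by
  have h1 := h.card_le_sqN hx
  have h2 : (3 : ℝ) ≤ n := by exact_mod_cast hn
  linarith

lemma one_lt_logN (hx : x ∈ bigBall n) : 1 < logN κ w x := by
  have h1 := h.card_le_sqN hx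
  have h2 : (3 : ℝ) ≤ n := by exact_mod_cast hn
  rw [logN, Real.lt_log_iff_exp_lt (by linarith)]
  linarith [Real.exp_one_lt_d9]

lemma contDiffOn_logN : ContDiffOn ℝ 2 (logN κ w) (bigBall n) :=
  h.contDiffOn_sqN.log fun _ hx => (h.sqN_pos hn hx).ne'

lemma contDiffOn_logD (k : Fin n) : ContDiffOn ℝ 1 (logD κ w k) (bigBall n) := by
  have h1 : ∀ i j, ContDiffOn ℝ 1 (fun y => jac w y i j) (bigBall n) := fun i j =>
    (h.contDiffOn_jac i j).of_le (by norm_num)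
  exact ((h.contDiffOn_sqN.of_le (by norm_num)).inv fun _ hx => (h.sqN_pos hn hx).ne').mul
    (contDiffOn_const.mul (contDiffOn_trace (contDiffOn_mul (contDiffOn_oM κ h1)
      (h.contDiffOn_jacD k))))

lemma hasPD_logN (hx : x ∈ bigBall n) (k : Fin n) : HasPD k (logN κ w) (logD κ w k x) x :=
  HasPD.comp (Real.hasDerivAt_log (h.sqN_pos hn hx).ne') (h.hasPD_sqN hx k)

lemma hasPD_logD (hx : x ∈ bigBall n) (l k : Fin n) : HasPD l (logD κ w k)
    ((sqN κ w x)⁻¹ * (2 * (jacD w k x * jacD w l x).trace)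
      + (sqN κ w x)⁻¹ * (2 * (oM κ (jac w x) * jacDD w l k x).trace)
      - logD κ w k x * logD κ w l x) x := by
  have h1 := (((h.hasMD_jac hx l).oM κ).mul (h.hasMD_jacD hx l k)).trace.const_mul 2
  have h2 := HasPD.comp (hasDerivAt_inv (h.sqN_pos hn hx).ne') (h.hasPD_sqN hx l)
  refine (h2.mul h1).congr_val ?_
  unfold logD
  rw [Matrix.trace_add, Matrix.trace_mul_comm (jacD w l x)]
  field_simp
  ring

end Sol

lemma exists_subsol {α β κ : ℝ} (hn : 3 ≤ n) (hα : 0 < α) (hβ : 0 ≤ β) (hκ : 0 ≤ κ) (M : ℝ) :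
    ∃ T₀ : ℝ, ∀ w : Fin n → EuclideanSpace ℝ (Fin n) → ℝ, Sol α β κ M w → ∀ x ∈ bigBall n,
      T₀ ≤ logN κ w x → (1 / 100) * ∑ k, ∑ l, gM α (jac w x) k l * (logD κ w k x * logD κ w l x) ≤
        ∑ k, ∑ l, gM α (jac w x) k l * pd l (logD κ w k) x := by
  obtain ⟨Λ, hΛ⟩ := exists_jacobi (ι := Fin n) hα hβ hκ
  refine ⟨Real.log (max Λ 1), fun w h x hx hT => ?_⟩
  have hN := h.sqN_pos hn hx
  have hΛN : Λ ≤ sqN κ w x := le_trans (le_max_left _ _)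
    ((Real.log_le_log_iff (by positivity) hN).1 hT)
  have key := hΛ (jac w x) (h.adm x hx) hΛN (fun k => jacD w k x) (h.jacD_comm hx)
    (h.jacD_symm hx) (h.trace_gM_jacD hx)
  have e1 : ∑ k, ∑ l, gM α (jac w x) k l * (oM κ (jac w x) * jacDD w l k x).trace =
      ∑ k, ∑ l, oM κ (jac w x) k l * bM (jac w x) (jacD w k x) (jacD w l x) := by
    have s1 : ∀ k l, bM (jac w x) (jacD w k x) (jacD w l x) =
        ∑ i, ∑ j, gM α (jac w x) i j * jacDD w k l x j i := fun k l => by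
      rw [← h.trace_gM_jacDD hx]; simp only [Matrix.trace, Matrix.diag_apply, Matrix.mul_apply]
    simp only [s1, Matrix.trace, Matrix.diag_apply, Matrix.mul_apply, Finset.mul_sum]
    have comm4 : ∀ F : Fin n → Fin n → Fin n → Fin n → ℝ,
        ∑ a, ∑ b, ∑ c, ∑ d, F a b c d = ∑ c, ∑ d, ∑ a, ∑ b, F a b c d := fun F => by
      have := Finset.sum_comm (s := (Finset.univ : Finset (Fin n × Fin n)))
        (t := (Finset.univ : Finset (Fin n × Fin n))) (f := fun p q => F p.1 p.2 q.1 q.2)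
      simpa only [Fintype.sum_prod_type] using this
    rw [comm4]
    refine Finset.sum_congr rfl fun c _ => Finset.sum_congr rfl fun d _ =>
      Finset.sum_congr rfl fun a _ => Finset.sum_congr rfl fun b _ => ?_
    rw [h.jacDD_comm hx b a d c, h.jacDD_symm hx c d a b]
    ring
  simp only [(h.hasPD_logD hn hx _ _).pd_eq]
  change _ ≤ sqN κ w x * _ at key
  simp only [mul_add, mul_sub, Finset.sum_add_distrib, Finset.sum_sub_distrib] at key ⊢
  rw [← e1] at key
  have f1 : ∀ F : Fin n → Fin n → ℝ, ∑ k, ∑ l, gM α (jac w x) k l *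
      ((sqN κ w x)⁻¹ * (2 * F k l)) = 2 / sqN κ w x * ∑ k, ∑ l, gM α (jac w x) k l * F k l := by
    intro F
    simp only [Finset.mul_sum]
    refine Finset.sum_congr rfl fun c _ => Finset.sum_congr rfl fun d _ => ?_
    ring
  have f2 : ∑ k, ∑ l, gM α (jac w x) k l * (logD κ w k x * logD κ w l x) =
      (2 / sqN κ w x) ^ 2 * ∑ k, ∑ l, gM α (jac w x) k l *
        ((oM κ (jac w x) * jacD w k x).trace * (oM κ (jac w x) * jacD w l x).trace) := by
    simp only [Finset.mul_sum]
    refine Finset.sum_congr rfl fun c _ => Finset.sum_congr rfl fun d _ => ?_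
    unfold logD
    ring
  rw [f1, f1, f2]
  generalize (∑ k, ∑ l, gM α (jac w x) k l *
    ((oM κ (jac w x) * jacD w k x).trace * (oM κ (jac w x) * jacD w l x).trace)) = q at *
  have hs : 0 < 2 / sqN κ w x := by positivity
  have hsN : 2 / sqN κ w x * sqN κ w x = 2 := by field_simp
  generalize sqN κ w x = N at *
  generalize 2 / N = s at *
  have := mul_le_mul_of_nonneg_left key (mul_nonneg hs.le hs.le)
  generalize (∑ x_1, ∑ x_2, gM α (jac w x) x_1 x_2 * (jacD w x_1 x * jacD w x_2 x).trace) = a at *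
  generalize (∑ k, ∑ l, gM α (jac w x) k l * (oM κ (jac w x) * jacDD w l k x).trace) = c at *
  have e : s * s * (N * a + N * c) = 2 * (s * a + s * c) := by rw [← hsN]; ring
  nlinarith

end HessQuot

namespace HessQuot
variable {n : ℕ}

open Matrix MeasureTheory

/-- Integral over the closed ball of radius `r`. -/
def ballInt (r : ℝ) (P : EuclideanSpace ℝ (Fin n) → ℝ) : ℝ :=
  ∫ x in Metric.closedBall 0 r, P x

lemma closedBall_subset_bigBall {r : ℝ} (hr : r < 5) :
    Metric.closedBall (0 : EuclideanSpace ℝ (Fin n)) r ⊆ bigBall n :=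
  Metric.closedBall_subset_ball hr

lemma integrableOn_closedBall {r : ℝ} (hr : r < 5) {P : EuclideanSpace ℝ (Fin n) → ℝ}
    (hP : ContinuousOn P (bigBall n)) : IntegrableOn P (Metric.closedBall 0 r) :=
  (hP.mono (closedBall_subset_bigBall hr)).integrableOn_compact (isCompact_closedBall _ _)

lemma ballInt_mono {r : ℝ} (hr : r < 5) {P Q : EuclideanSpace ℝ (Fin n) → ℝ}
    (hP : ContinuousOn P (bigBall n)) (hQ : ContinuousOn Q (bigBall n))
    (h : ∀ x ∈ bigBall n, P x ≤ Q x) : ballInt r P ≤ ballInt r Q :=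
  setIntegral_mono_on (integrableOn_closedBall hr hP) (integrableOn_closedBall hr hQ)
    Metric.isClosed_closedBall.measurableSet fun x hx => h x (closedBall_subset_bigBall hr hx)

lemma ballInt_add {r : ℝ} (hr : r < 5) {P Q : EuclideanSpace ℝ (Fin n) → ℝ}
    (hP : ContinuousOn P (bigBall n)) (hQ : ContinuousOn Q (bigBall n)) :
    ballInt r (fun x => P x + Q x) = ballInt r P + ballInt r Q :=
  integral_add (integrableOn_closedBall hr hP) (integrableOn_closedBall hr hQ)

lemma ballInt_const_mul (r c : ℝ) (P : EuclideanSpace ℝ (Fin n) → ℝ) :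
    ballInt r (fun x => c * P x) = c * ballInt r P :=
  integral_const_mul _ _

lemma continuousOn_pd {f : EuclideanSpace ℝ (Fin n) → ℝ} (hf : ContDiffOn ℝ 1 f (bigBall n))
    (k : Fin n) : ContinuousOn (pd k f) (bigBall n) :=
  (contDiffOn_pd (m := 0) isOpen_bigBall (by simpa using hf) k).continuousOn

lemma exists_cutoff {r s : ℝ} (hr : 0 < r) (hrs : r < s) :
    ∃ η : EuclideanSpace ℝ (Fin n) → ℝ, ContDiff ℝ 1 η ∧ (∀ x, 0 ≤ η x) ∧ (∀ x, η x ≤ 1) ∧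
      (∀ x ∈ Metric.closedBall 0 r, η x = 1) ∧ tsupport η = Metric.closedBall 0 s ∧
      ∃ c : ℝ, 0 ≤ c ∧ ∀ i x, |pd i η x| ≤ c := by
  obtain ⟨f, hf1, hf2⟩ :
      ∃ f : ContDiffBump (0 : EuclideanSpace ℝ (Fin n)), f.rIn = r ∧ f.rOut = s :=
    ⟨⟨r, s, hr, hrs⟩, rfl, rfl⟩
  have hC : ContDiff ℝ 1 f := f.contDiff
  refine ⟨f, hC, fun x => f.nonneg, fun x => f.le_one, fun x hx => f.one_of_mem_closedBall
    (hf1 ▸ hx), hf2 ▸ f.tsupport_eq, ?_⟩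
  have h1 : Continuous (fderiv ℝ f) := hC.continuous_fderiv (by norm_num)
  have h2 : HasCompactSupport (fderiv ℝ f) := f.hasCompactSupport.fderiv ℝ
  obtain ⟨c, hc⟩ := h1.bounded_above_of_compact_support h2
  refine ⟨c, le_trans (norm_nonneg _) (hc 0), fun i x => ?_⟩
  have := (fderiv ℝ f x).le_opNorm (EuclideanSpace.single i (1 : ℝ))
  rw [PiLp.norm_single, norm_one, mul_one] at this
  exact this.trans (hc x)

lemma integrable_mul_of_tsupport {η F : EuclideanSpace ℝ (Fin n) → ℝ} (hη : Continuous η) {s : ℝ}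
    (hs : s < 5) (hη2 : tsupport η ⊆ Metric.closedBall 0 s) (hF : ContinuousOn F (bigBall n)) :
    Integrable (fun x => η x * F x) := by
  have h1 : IntegrableOn (fun x => η x * F x) (Metric.closedBall 0 s) :=
    integrableOn_closedBall hs (hη.continuousOn.mul hF)
  rw [integrableOn_iff_integrable_of_support_subset] at h1
  · exact h1
  · intro x hx
    exact hη2 (subset_tsupport _ (left_ne_zero_of_mul hx))

lemma integral_mul_pd {η f : EuclideanSpace ℝ (Fin n) → ℝ} (hη : ContDiff ℝ 1 η) {s : ℝ}
    (hs : s < 5) (hη2 : tsupport η ⊆ Metric.closedBall 0 s) (hf : ContDiffOn ℝ 1 f (bigBall n))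
    (k : Fin n) : ∫ x, η x * pd k f x = - ∫ x, pd k η x * f x := by
  have hcd : Continuous (fun x => pd k η x) :=
    (hη.continuous_fderiv (by norm_num)).clm_apply continuous_const
  have hsd : tsupport (fun x => pd k η x) ⊆ Metric.closedBall 0 s :=
    (tsupport_fderiv_apply_subset ℝ _).trans hη2
  exact integral_bilinear_fderiv_right_eq_neg_left_of_integrable
    (B := ContinuousLinearMap.mul ℝ ℝ) (f := η) (g := f)
    (integrable_mul_of_tsupport hcd hs hsd hf.continuousOn)
    (integrable_mul_of_tsupport hη.continuous hs hη2 (continuousOn_pd hf k))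
    (integrable_mul_of_tsupport hη.continuous hs hη2 hf.continuousOn)
    (fun x _ => hη.differentiable (by norm_num) x)
    (fun x hx => (hf.contDiffAt (isOpen_bigBall.mem_nhds
      (closedBall_subset_bigBall hs (hη2 hx)))).differentiableAt (by norm_num))

lemma exists_ballInt_le_ballInt {r s : ℝ} (hr : 0 < r) (hrs : r < s) (hs : s < 5) :
    ∃ c : ℝ, 0 ≤ c ∧ ∀ (f : Fin n → EuclideanSpace ℝ (Fin n) → ℝ)
      (P Q : EuclideanSpace ℝ (Fin n) → ℝ), (∀ i, ContDiffOn ℝ 1 (f i) (bigBall n)) →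
      ContinuousOn P (bigBall n) → ContinuousOn Q (bigBall n) → (∀ x ∈ bigBall n, 0 ≤ P x) →
      (∀ x ∈ bigBall n, ∀ (t : ℝ) (ξ : Fin n → ℝ), 0 ≤ t → t ≤ 1 → (∀ i, |ξ i| ≤ c) →
        t ^ 2 * P x ≤ t ^ 2 * ∑ i, pd i (f i) x + 2 * t * ∑ i, ξ i * f i x + Q x) →
      ballInt r P ≤ ballInt s Q := by
  obtain ⟨η, hη, h0, h1, hone, hsupp, c, hc, hcb⟩ := exists_cutoff (n := n) hr hrs
  refine ⟨c, hc, fun f P Q hf hP hQ hP0 key => ?_⟩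
  obtain ⟨ζ, hζdef⟩ : ∃ ζ : EuclideanSpace ℝ (Fin n) → ℝ, ζ = fun x => η x ^ 2 := ⟨_, rfl⟩
  have hζ : ContDiff ℝ 1 ζ := hζdef ▸ hη.pow 2
  have hζs : tsupport ζ ⊆ Metric.closedBall 0 s := by
    rw [← hsupp]
    refine closure_mono fun x hx => ?_
    rw [hζdef] at hx
    exact ne_zero_pow two_ne_zero hx
  have hζd : ∀ k x, pd k ζ x = 2 * η x * pd k η x := fun k x => by
    rw [hζdef, ((hη.differentiable (by norm_num) x).hasPD.pow 2).pd_eq]; push_cast; ring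
  have hcd : ∀ k, Continuous (fun x => pd k ζ x) := fun k =>
    (hζ.continuous_fderiv (by norm_num)).clm_apply continuous_const
  have hsd : ∀ k, tsupport (fun x => pd k ζ x) ⊆ Metric.closedBall 0 s := fun k =>
    (tsupport_fderiv_apply_subset ℝ _).trans hζs
  have i1 : ∀ k, Integrable (fun x => ζ x * pd k (f k) x) := fun k =>
    integrable_mul_of_tsupport hζ.continuous hs hζs (continuousOn_pd (hf k) k)
  have i2 : ∀ k, Integrable (fun x => pd k ζ x * f k x) := fun k =>
    integrable_mul_of_tsupport (hcd k) hs (hsd k) (hf k).continuousOn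
  have i3 : Integrable (fun x => ζ x * P x) :=
    integrable_mul_of_tsupport hζ.continuous hs hζs hP
  have i12 : ∀ k, Integrable (fun x => ζ x * pd k (f k) x + pd k ζ x * f k x) := fun k =>
    (i1 k).add (i2 k)
  have hzero : ∫ x, ∑ k, (ζ x * pd k (f k) x + pd k ζ x * f k x) = 0 := by
    rw [integral_finsetSum _ fun k _ => i12 k]
    refine Finset.sum_eq_zero fun k _ => ?_
    rw [integral_add (i1 k) (i2 k), integral_mul_pd hζ hs hζs (hf k) k, neg_add_cancel]
  have iS : Integrable (fun x => ∑ k, (ζ x * pd k (f k) x + pd k ζ x * f k x)) :=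
    integrable_finsetSum _ fun k _ => i12 k
  have iQ := integrableOn_closedBall hs hQ
  have hvan : ∀ x, x ∉ Metric.closedBall (0 : EuclideanSpace ℝ (Fin n)) s → ζ x = 0 := fun x hx =>
    image_eq_zero_of_notMem_tsupport fun h => hx (hζs h)
  have hvan' : ∀ k x, x ∉ Metric.closedBall (0 : EuclideanSpace ℝ (Fin n)) s → pd k ζ x = 0 :=
    fun k x hx => image_eq_zero_of_notMem_tsupport (f := fun x => pd k ζ x) fun h => hx (hsd k h)
  have eS : ∫ x in Metric.closedBall 0 s, ∑ k, (ζ x * pd k (f k) x + pd k ζ x * f k x) = 0 := by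
    rw [← hzero]
    refine setIntegral_eq_integral_of_forall_compl_eq_zero fun x hx => ?_
    simp [hvan x hx, hvan' _ x hx]
  have step1 : ballInt r P ≤ ∫ x in Metric.closedBall 0 s, ζ x * P x := by
    have e : ballInt r P = ∫ x in Metric.closedBall 0 r, ζ x * P x := by
      refine setIntegral_congr_fun Metric.isClosed_closedBall.measurableSet fun x hx => ?_
      simp only [hζdef, hone x hx]; ring
    rw [e]
    refine setIntegral_mono_set i3.integrableOn ?_
      (Metric.closedBall_subset_closedBall hrs.le).eventuallyLE
    refine (ae_restrict_iff' Metric.isClosed_closedBall.measurableSet).2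
      (Filter.Eventually.of_forall fun x hx => ?_)
    exact mul_nonneg (by rw [hζdef]; positivity) (hP0 x (closedBall_subset_bigBall hs hx))
  have step2 : ∫ x in Metric.closedBall 0 s, ζ x * P x ≤
      ∫ x in Metric.closedBall 0 s,
        (∑ k, (ζ x * pd k (f k) x + pd k ζ x * f k x) + Q x) := by
    refine setIntegral_mono_on i3.integrableOn (iS.integrableOn.add iQ)
      Metric.isClosed_closedBall.measurableSet fun x hx => ?_
    have h3 := key x (closedBall_subset_bigBall hs hx) (η x) (fun i => pd i η x) (h0 x) (h1 x)
      (fun i => hcb i x)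
    simp only [hζd, Finset.sum_add_distrib, mul_assoc, ← Finset.mul_sum] at h3 ⊢
    rw [hζdef]
    simpa only [← mul_assoc] using h3
  rw [integral_add iS.integrableOn iQ, eS, zero_add] at step2
  exact step1.trans step2

end HessQuot

namespace HessQuot
variable {n : ℕ}

open Matrix MeasureTheory

section cutoffs

/-- The square of the positive part. -/
def posSq (s : ℝ) : ℝ := (max s 0) ^ 2

lemma hasDerivAt_posSq (s : ℝ) : HasDerivAt posSq (2 * max s 0) s := by
  rcases lt_trichotomy s 0 with h | h | h
  · rw [max_eq_right h.le, mul_zero]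
    refine (hasDerivAt_const s (0 : ℝ)).congr_of_eventuallyEq ?_
    filter_upwards [eventually_lt_nhds h] with y hy
    rw [posSq, max_eq_right hy.le]; ring
  · subst h
    rw [max_self, mul_zero]
    refine HasDerivAt.of_isLittleO ?_
    simp only [posSq, max_self, sub_zero, smul_zero]
    refine Asymptotics.IsBigO.trans_isLittleO (g := fun y : ℝ => y ^ 2) ?_ ?_
    · refine Asymptotics.IsBigO.of_bound 1 (Filter.Eventually.of_forall fun y => ?_)
      rw [Real.norm_eq_abs, Real.norm_eq_abs, one_mul]
      rcases le_total y 0 with hy | hy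
      · rw [max_eq_right hy]; simp; positivity
      · rw [max_eq_left hy]; simp
    · simpa using Asymptotics.isLittleO_pow_id (𝕜 := ℝ) (n := 2) (by norm_num)
  · rw [max_eq_left h.le]
    have := hasDerivAt_pow 2 s
    refine (this.congr_deriv (by push_cast; ring)).congr_of_eventuallyEq ?_
    filter_upwards [eventually_gt_nhds h] with y hy
    rw [posSq, max_eq_left hy.le]

lemma posSq_nonneg (s : ℝ) : 0 ≤ posSq s := sq_nonneg _

lemma contDiff_posSq : ContDiff ℝ 1 posSq := by
  refine contDiff_one_iff_deriv.2 ⟨fun s => (hasDerivAt_posSq s).differentiableAt, ?_⟩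
  have : deriv posSq = fun s => 2 * max s 0 := funext fun s => (hasDerivAt_posSq s).deriv
  rw [this]
  fun_prop

/-- A nondecreasing weight which vanishes on `(-∞, T]`. -/
def wt (T s : ℝ) : ℝ := posSq (s - T) / (1 + posSq (s - T))

/-- A function growing linearly whose squared derivative is `wt T`. -/
def gr (T s : ℝ) : ℝ := √(1 + posSq (s - T)) - 1

/-- The derivative of `gr T`. -/
def grD (T s : ℝ) : ℝ := max (s - T) 0 / √(1 + posSq (s - T))

variable (T s : ℝ)

lemma contDiff_wt : ContDiff ℝ 1 (wt T) := by
  have h : ContDiff ℝ 1 fun s => posSq (s - T) :=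
    contDiff_posSq.comp (contDiff_id.sub contDiff_const)
  exact h.div (contDiff_const.add h) fun s => by have := posSq_nonneg (s - T); positivity

lemma contDiff_gr : ContDiff ℝ 1 (gr T) := by
  have h : ContDiff ℝ 1 fun s => posSq (s - T) :=
    contDiff_posSq.comp (contDiff_id.sub contDiff_const)
  exact ((contDiff_const.add h).sqrt fun s => by
    have := posSq_nonneg (s - T); positivity).sub contDiff_const

lemma wt_nonneg : 0 ≤ wt T s := by have := posSq_nonneg (s - T); unfold wt; positivity

lemma wt_le_one : wt T s ≤ 1 := by
  have := posSq_nonneg (s - T)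
  rw [wt, div_le_one (by positivity)]; linarith

lemma wt_of_le {T s : ℝ} (h : s ≤ T) : wt T s = 0 := by
  rw [wt, posSq, max_eq_right (by linarith)]; simp

lemma exists_hasDerivAt_wt : ∃ d : ℝ, 0 ≤ d ∧ HasDerivAt (wt T) d s := by
  have h0 := posSq_nonneg (s - T)
  have h1 : HasDerivAt (fun s => posSq (s - T)) (2 * max (s - T) 0) s :=
    HasDerivAt.comp_sub_const s T (hasDerivAt_posSq (s - T))
  refine ⟨_, ?_, h1.div (h1.const_add 1) (by positivity)⟩
  have : 0 ≤ max (s - T) 0 := le_max_right _ _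
  refine div_nonneg ?_ (by positivity)
  have e : 2 * max (s - T) 0 * (1 + posSq (s - T)) - posSq (s - T) * (2 * max (s - T) 0) =
    2 * max (s - T) 0 := by ring
  rw [e]; positivity

lemma hasDerivAt_gr : HasDerivAt (gr T) (grD T s) s := by
  have h0 := posSq_nonneg (s - T)
  have h1 : HasDerivAt (fun s => posSq (s - T)) (2 * max (s - T) 0) s :=
    HasDerivAt.comp_sub_const s T (hasDerivAt_posSq (s - T))
  refine (((h1.const_add 1).sqrt (by positivity)).sub_const 1).congr_deriv ?_
  rw [grD, mul_div_mul_left _ _ two_ne_zero]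

lemma grD_sq : grD T s ^ 2 = wt T s := by
  have h0 := posSq_nonneg (s - T)
  rw [grD, div_pow, Real.sq_sqrt (by positivity)]; rfl

lemma gr_nonneg : 0 ≤ gr T s := by
  rw [gr, sub_nonneg, Real.one_le_sqrt]; linarith [posSq_nonneg (s - T)]

lemma gr_le {T s : ℝ} (hT : 0 ≤ T) (hs : 0 ≤ s) : gr T s ≤ s := by
  have h1 : max (s - T) 0 ≤ s := max_le (by linarith) hs
  have h2 : 0 ≤ max (s - T) 0 := le_max_right _ _
  have h3 : posSq (s - T) ≤ s ^ 2 := pow_le_pow_left₀ h2 h1 2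
  rw [gr, sub_le_iff_le_add]
  refine Real.sqrt_le_iff.2 ⟨by linarith, by nlinarith⟩

lemma le_gr : s ≤ gr T s + 1 + T := by
  have h1 : s - T ≤ √(1 + posSq (s - T)) := by
    rcases le_total (s - T) 0 with h | h
    · exact h.trans (Real.sqrt_nonneg _)
    · refine Real.le_sqrt_of_sq_le ?_
      rw [posSq, max_eq_left h]; linarith
  unfold gr; linarith

end cutoffs

end HessQuot

namespace HessQuot
variable {n : ℕ}

open Matrix MeasureTheory

lemma dot_mulVec_eq {ι : Type*} [Fintype ι] (G : Matrix ι ι ℝ) (ξ ζ : ι → ℝ) :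
    ξ ⬝ᵥ G *ᵥ ζ = ∑ k, ∑ l, G k l * (ξ k * ζ l) := by
  simp only [dotProduct, mulVec, Finset.mul_sum]
  exact Finset.sum_congr rfl fun k _ => Finset.sum_congr rfl fun l _ => by ring

lemma sq_le_dot_self {ι : Type*} [Fintype ι] (ξ : ι → ℝ) (i : ι) : ξ i ^ 2 ≤ ξ ⬝ᵥ ξ := by
  rw [pow_two]
  exact Finset.single_le_sum (f := fun i => ξ i * ξ i) (fun j _ => mul_self_nonneg _)
    (Finset.mem_univ i)

lemma MAdm.gM_quad_le {ι : Type*} [Fintype ι] [DecidableEq ι] {α β κ : ℝ} (hα : 0 < α)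
    (hβ : 0 ≤ β) {A : Matrix ι ι ℝ} (h : MAdm α β κ A) (ξ : ι → ℝ) :
    ξ ⬝ᵥ gM α A *ᵥ ξ ≤ Fintype.card ι * e2M A * (ξ ⬝ᵥ ξ) := by
  refine le_trans ?_ (mul_le_mul_of_nonneg_right (h.trace_gM_le hα)
    (Finset.sum_nonneg fun i _ => mul_self_nonneg _))
  obtain ⟨R, x, hR, rfl, hx⟩ := h
  rw [conj_gM hR, gM_diagonal, quad_conj, dot_conj hR, conj_trace hR, Matrix.trace_diagonal,
    Finset.sum_mul]
  refine Finset.sum_le_sum fun i hi => mul_le_mul_of_nonneg_left ?_ (hx.gG_pos hα hβ hi).le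
  exact Finset.single_le_sum (f := fun i => ((Rᵀ *ᵥ ξ) i) ^ 2) (fun j _ => sq_nonneg _)
    (Finset.mem_univ i)

lemma abs_two_mul_sum_le {t c F : ℝ} {ξ f : Fin n → ℝ} (ht0 : 0 ≤ t) (ht1 : t ≤ 1) (hc : 0 ≤ c)
    (hξ : ∀ i, |ξ i| ≤ c) (hf : ∀ i, |f i| ≤ F) :
    |2 * t * ∑ i, ξ i * f i| ≤ 2 * n * c * F := by
  have h1 : |∑ i, ξ i * f i| ≤ n * (c * F) := by
    refine (Finset.abs_sum_le_sum_abs _ _).trans ?_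
    refine (Finset.sum_le_card_nsmul _ _ (c * F) fun i _ => ?_).trans (by simp)
    rw [abs_mul]
    exact mul_le_mul (hξ i) (hf i) (abs_nonneg _) hc
  rw [abs_mul, abs_of_nonneg (by positivity : 0 ≤ 2 * t)]
  have h2 := mul_le_mul_of_nonneg_right ht1 (abs_nonneg (∑ i, ξ i * f i))
  linarith

namespace Sol
variable {α β κ M : ℝ} {w : Fin n → EuclideanSpace ℝ (Fin n) → ℝ} (h : Sol α β κ M w)
  {x : EuclideanSpace ℝ (Fin n)}
include h

lemma contDiffOn_trace_jac : ContDiffOn ℝ 1 (fun x => (jac w x).trace) (bigBall n) :=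
  contDiffOn_trace fun i j => (h.contDiffOn_jac i j).of_le (by norm_num)

lemma contDiffOn_e2M_jac : ContDiffOn ℝ 1 (fun x => e2M (jac w x)) (bigBall n) := by
  have h1 : ∀ i j, ContDiffOn ℝ 1 (fun y => jac w y i j) (bigBall n) := fun i j =>
    (h.contDiffOn_jac i j).of_le (by norm_num)
  exact (((contDiffOn_trace h1).pow 2).sub (contDiffOn_trace (contDiffOn_mul h1 h1))).div_const 2

end Sol

lemma exists_ballInt_trace_le {α β κ M r : ℝ} (hr : 0 < r) (hr5 : r < 5) :
    ∃ C : ℝ, ∀ w : Fin n → EuclideanSpace ℝ (Fin n) → ℝ, Sol α β κ M w →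
      ballInt r (fun x => (jac w x).trace) ≤ C := by
  obtain ⟨c, hc, H⟩ := exists_ballInt_le_ballInt (n := n) (s := (r + 5) / 2) hr (by linarith)
    (by linarith)
  refine ⟨ballInt ((r + 5) / 2) fun _ : EuclideanSpace ℝ (Fin n) => 2 * n * c * M, fun w h => ?_⟩
  refine H w _ _ (fun i => (h.smooth i).of_le (by norm_num)) h.contDiffOn_trace_jac.continuousOn
    continuousOn_const (fun x hx => (h.adm x hx).trace_pos.le) fun x hx t ξ h0 h1 hξ => ?_
  have key := abs_two_mul_sum_le h0 h1 hc hξ fun i => h.bdd i x hx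
  have e : (jac w x).trace = ∑ i, pd i (w i) x := rfl
  rw [e]
  linarith [(abs_le.1 key).1]

/-- The matrix `tr(Dw) I - Dw`. -/
def compl (w : Fin n → EuclideanSpace ℝ (Fin n) → ℝ) (x : EuclideanSpace ℝ (Fin n)) :
    Matrix (Fin n) (Fin n) ℝ := (jac w x).trace • (1 : Matrix (Fin n) (Fin n) ℝ) - jac w x

/-- The vector field `(tr(Dw) I - Dw) w`. -/
def complW (w : Fin n → EuclideanSpace ℝ (Fin n) → ℝ) (i : Fin n) (x : EuclideanSpace ℝ (Fin n)) :
    ℝ := ∑ j, compl w x i j * w j x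

namespace Sol
variable {α β κ M : ℝ} {w : Fin n → EuclideanSpace ℝ (Fin n) → ℝ} (h : Sol α β κ M w)
  {x : EuclideanSpace ℝ (Fin n)}
include h

lemma contDiffOn_complW (i : Fin n) : ContDiffOn ℝ 1 (complW w i) (bigBall n) :=
  ContDiffOn.sum fun j _ => (((h.contDiffOn_trace_jac).mul contDiffOn_const).sub
    ((h.contDiffOn_jac i j).of_le (by norm_num))).mul ((h.smooth j).of_le (by norm_num))

lemma abs_complW_le (hx : x ∈ bigBall n) (i : Fin n) :
    |complW w i x| ≤ 2 * n * M * (jac w x).trace := by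
  have htr := (h.adm x hx).trace_pos
  refine (Finset.abs_sum_le_sum_abs _ _).trans ?_
  refine (Finset.sum_le_card_nsmul _ _ (2 * (jac w x).trace * M) fun j _ => ?_).trans
    (le_of_eq (by simp; ring))
  rw [abs_mul]
  refine mul_le_mul ?_ (h.bdd j x hx) (abs_nonneg _) (by positivity)
  have h1 := (h.adm x hx).abs_le i j
  have h2 : |(jac w x).trace * (1 : Matrix (Fin n) (Fin n) ℝ) i j| ≤ (jac w x).trace := by
    rw [Matrix.one_apply]; split_ifs
    · rw [mul_one, abs_of_pos htr]
    · simpa using htr.le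
  refine (abs_sub _ _).trans ?_
  rw [two_mul]
  exact add_le_add h2 h1

lemma hasPD_complW (hx : x ∈ bigBall n) (k i : Fin n) : HasPD k (complW w i)
    (∑ j, (((jacD w k x).trace * (if i = j then 1 else 0) - jacD w k x i j) * w j x
      + compl w x i j * jac w x k j)) x := by
  refine HasPD.sum fun j _ => HasPD.mul ?_ (h.hasPD_w hx k j)
  have h1 := ((h.hasMD_jac hx k).trace.mul
    (hasPD_const ((1 : Matrix (Fin n) (Fin n) ℝ) i j))).sub (h.hasMD_jac hx k i j)
  exact h1.congr_val (by rw [mul_zero, add_zero, Matrix.one_apply])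

lemma sum_pd_complW (hx : x ∈ bigBall n) :
    ∑ i, pd i (complW w i) x = 2 * e2M (jac w x) := by
  simp only [(h.hasPD_complW hx _ _).pd_eq, Finset.sum_add_distrib]
  have e1 : ∑ i, ∑ j, ((jacD w i x).trace * (if i = j then 1 else 0) - jacD w i x i j) * w j x
      = 0 := by
    refine Eq.trans Finset.sum_comm (Finset.sum_eq_zero fun j _ => ?_)
    rw [← Finset.sum_mul, h.sum_pd_compl hx, zero_mul]
  have e2 : ∑ i, ∑ j, compl w x i j * jac w x i j =
      (jac w x).trace ^ 2 - (jac w x * jac w x).trace := by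
    simp only [compl, Matrix.sub_apply, Matrix.smul_apply, Matrix.one_apply, smul_eq_mul, sub_mul,
      Finset.sum_sub_distrib, mul_ite, ite_mul, mul_one, mul_zero, zero_mul, Finset.sum_ite_eq,
      Finset.mem_univ, if_true, ← Finset.mul_sum]
    have e3 : (jac w x * jac w x).trace = ∑ i, ∑ j, jac w x i j * jac w x i j := by
      simp only [Matrix.trace, Matrix.diag_apply, Matrix.mul_apply]
      refine Finset.sum_congr rfl fun i _ => Finset.sum_congr rfl fun j _ => ?_
      rw [(h.adm x hx).symm j i]
    rw [e3, pow_two]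
    rfl
  rw [e1, e2, e2M]
  ring

end Sol

lemma exists_ballInt_e2M_le {α β κ M r : ℝ} (hM : 0 ≤ M) (hr : 0 < r) (hr5 : r < 5) :
    ∃ C : ℝ, ∀ w : Fin n → EuclideanSpace ℝ (Fin n) → ℝ, Sol α β κ M w →
      ballInt r (fun x => e2M (jac w x)) ≤ C := by
  obtain ⟨c, hc, H⟩ := exists_ballInt_le_ballInt (n := n) (s := (r + 5) / 2) hr (by linarith)
    (by linarith)
  obtain ⟨C, hC⟩ := exists_ballInt_trace_le (n := n) (α := α) (β := β) (κ := κ) (M := M)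
    (show 0 < (r + 5) / 2 by linarith) (by linarith)
  refine ⟨2 * n * c * (2 * n * M) * C, fun w h => ?_⟩
  have hQ : ballInt ((r + 5) / 2) (fun x => 2 * n * c * (2 * n * M) * (jac w x).trace) ≤
      2 * n * c * (2 * n * M) * C := by
    rw [ballInt_const_mul]
    exact mul_le_mul_of_nonneg_left (hC w h) (by positivity)
  refine le_trans ?_ hQ
  refine H (complW w) _ _ h.contDiffOn_complW h.contDiffOn_e2M_jac.continuousOn
    (continuousOn_const.mul h.contDiffOn_trace_jac.continuousOn)
    (fun x hx => (h.adm x hx).e2M_pos.le) fun x hx t ξ h0 h1 hξ => ?_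
  have htr := (h.adm x hx).trace_pos
  have key := abs_two_mul_sum_le h0 h1 hc hξ fun i => h.abs_complW_le hx i
  rw [h.sum_pd_complW hx]
  have := mul_nonneg (sq_nonneg t) (h.adm x hx).e2M_pos.le
  linarith [(abs_le.1 key).1]

end HessQuot

namespace HessQuot
variable {n : ℕ}

open Matrix MeasureTheory

/-- The gradient of `logN` applied to the linearised operator. -/
def gDlog (α κ : ℝ) (w : Fin n → EuclideanSpace ℝ (Fin n) → ℝ) (i : Fin n)
    (x : EuclideanSpace ℝ (Fin n)) : ℝ := ∑ j, gM α (jac w x) i j * logD κ w j x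

/-- The gradient energy of `logN` with respect to the linearised operator. -/
def qD (α κ : ℝ) (w : Fin n → EuclideanSpace ℝ (Fin n) → ℝ) (x : EuclideanSpace ℝ (Fin n)) : ℝ :=
  (fun k => logD κ w k x) ⬝ᵥ gM α (jac w x) *ᵥ fun k => logD κ w k x

lemma two_mul_quad_ge {ι : Type*} [Fintype ι] [DecidableEq ι] {α β κ : ℝ} (hα : 0 < α)
    (hβ : 0 ≤ β) {A : Matrix ι ι ℝ} (h : MAdm α β κ A) (t c : ℝ) (hc : 0 < c) (ξ b : ι → ℝ) :
    -(t ^ 2 * (b ⬝ᵥ gM α A *ᵥ b) / c + c * (ξ ⬝ᵥ gM α A *ᵥ ξ)) ≤ 2 * t * (ξ ⬝ᵥ gM α A *ᵥ b) := by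
  have h1 := h.gM_quad_nonneg hα hβ (t • b + c • ξ)
  have h2 : b ⬝ᵥ gM α A *ᵥ ξ = ξ ⬝ᵥ gM α A *ᵥ b := by
    rw [dot_mulVec_eq, dot_mulVec_eq]
    refine Eq.trans Finset.sum_comm ?_
    refine Finset.sum_congr rfl fun k _ => Finset.sum_congr rfl fun l _ => ?_
    rw [h.gM_symm]; ring
  simp only [Matrix.mulVec_add, Matrix.mulVec_smul, dotProduct_add, add_dotProduct,
    smul_dotProduct, dotProduct_smul, smul_eq_mul, h2] at h1
  rw [neg_le_iff_add_nonneg]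
  have h3 := div_nonneg h1 hc.le
  refine h3.trans (le_of_eq ?_)
  field_simp
  ring

namespace Sol
variable {α β κ M : ℝ} {w : Fin n → EuclideanSpace ℝ (Fin n) → ℝ} (h : Sol α β κ M w)
  {x : EuclideanSpace ℝ (Fin n)}
include h

lemma contDiffOn_gM_jac (i j : Fin n) :
    ContDiffOn ℝ 1 (fun x => gM α (jac w x) i j) (bigBall n) :=
  contDiffOn_gM α (fun i j => (h.contDiffOn_jac i j).of_le (by norm_num)) i j

lemma qD_nonneg (hα : 0 < α) (hβ : 0 ≤ β) (hx : x ∈ bigBall n) : 0 ≤ qD α κ w x :=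
  (h.adm x hx).gM_quad_nonneg hα hβ _

variable (hn : 3 ≤ n)
include hn

lemma contDiffOn_gDlog (i : Fin n) : ContDiffOn ℝ 1 (gDlog α κ w i) (bigBall n) :=
  ContDiffOn.sum fun j _ => (h.contDiffOn_gM_jac i j).mul (h.contDiffOn_logD hn j)

lemma contDiffOn_qD : ContDiffOn ℝ 1 (qD α κ w) (bigBall n) := by
  have e : qD α κ w = fun x => ∑ j, logD κ w j x * gDlog α κ w j x := rfl
  rw [e]
  exact ContDiffOn.sum fun j _ => (h.contDiffOn_logD hn j).mul (h.contDiffOn_gDlog hn j)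

lemma contDiffOn_wt_logN (T : ℝ) : ContDiffOn ℝ 1 (fun x => wt T (logN κ w x)) (bigBall n) :=
  (contDiff_wt T).comp_contDiffOn ((h.contDiffOn_logN hn).of_le (by norm_num))

lemma contDiffOn_gr_logN (T : ℝ) : ContDiffOn ℝ 1 (fun x => gr T (logN κ w x)) (bigBall n) :=
  (contDiff_gr T).comp_contDiffOn ((h.contDiffOn_logN hn).of_le (by norm_num))

lemma sum_pd_gDlog (hx : x ∈ bigBall n) :
    ∑ i, pd i (gDlog α κ w i) x = ∑ k, ∑ l, gM α (jac w x) k l * pd l (logD κ w k) x := by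
  have h1 : ∀ i, HasPD i (gDlog α κ w i) _ x := fun i => HasPD.sum fun j _ =>
    ((h.hasMD_jac hx i).gM α i j).mul ((((h.contDiffOn_logD hn j).contDiffAt
      (isOpen_bigBall.mem_nhds hx)).differentiableAt (by norm_num)).hasPD (k := i))
  simp only [(h1 _).pd_eq, Finset.sum_add_distrib]
  have e1 := Finset.sum_comm (s := Finset.univ) (t := Finset.univ)
    (f := fun i j : Fin n => (((jac w x).trace * (jacD w i x).trace -
      (jac w x * jacD w i x).trace) •
      (1 : Matrix (Fin n) (Fin n) ℝ) - ((jacD w i x).trace • jac w x + (jac w x).trace • jacD w i x)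
      + (jacD w i x * jac w x + jac w x * jacD w i x)) i j * logD κ w j x)
  rw [e1]
  simp only [← Finset.sum_mul, h.sum_pd_gM hx, zero_mul, Finset.sum_const_zero, zero_add]
  refine Eq.trans Finset.sum_comm ?_
  refine Finset.sum_congr rfl fun k _ => Finset.sum_congr rfl fun l _ => ?_
  rw [(h.adm x hx).gM_symm]

lemma exists_sum_pd_wt (T : ℝ) (hx : x ∈ bigBall n) : ∃ d, 0 ≤ d ∧
    ∑ i, pd i (fun y => wt T (logN κ w y) * gDlog α κ w i y) x =
      d * qD α κ w x + wt T (logN κ w x) *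
        ∑ k, ∑ l, gM α (jac w x) k l * pd l (logD κ w k) x := by
  obtain ⟨d, hd, hd'⟩ := exists_hasDerivAt_wt T (logN κ w x)
  refine ⟨d, hd, ?_⟩
  have h1 : ∀ i, HasPD i (fun y => wt T (logN κ w y) * gDlog α κ w i y) _ x := fun i =>
    (HasPD.comp hd' (h.hasPD_logN hn hx i)).mul ((((h.contDiffOn_gDlog hn i).contDiffAt
      (isOpen_bigBall.mem_nhds hx)).differentiableAt (by norm_num)).hasPD (k := i))
  simp only [(h1 _).pd_eq, Finset.sum_add_distrib, mul_assoc, ← Finset.mul_sum,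
    h.sum_pd_gDlog hn hx]
  rfl

lemma sum_pd_gr (T : ℝ) {f : Fin n → EuclideanSpace ℝ (Fin n) → ℝ}
    (hf : ∀ i, ContDiffOn ℝ 1 (f i) (bigBall n)) (hx : x ∈ bigBall n) :
    ∑ i, pd i (fun y => gr T (logN κ w y) * f i y) x =
      grD T (logN κ w x) * ∑ i, logD κ w i x * f i x
        + gr T (logN κ w x) * ∑ i, pd i (f i) x := by
  have h1 : ∀ i, HasPD i (fun y => gr T (logN κ w y) * f i y) _ x := fun i =>
    (HasPD.comp (hasDerivAt_gr T _) (h.hasPD_logN hn hx i)).mul ((((hf i).contDiffAt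
      (isOpen_bigBall.mem_nhds hx)).differentiableAt (by norm_num)).hasPD (k := i))
  simp only [(h1 _).pd_eq, Finset.sum_add_distrib, mul_assoc, ← Finset.mul_sum]

end Sol

lemma exists_ballInt_energy_le {α β κ M : ℝ} (hn : 3 ≤ n) (hα : 0 < α) (hβ : 0 ≤ β)
    (hκ : 0 ≤ κ) (hM : 0 ≤ M) :
    ∃ T₀ : ℝ, ∀ T, T₀ ≤ T → ∀ r, 0 < r → r < 5 →
    ∃ C : ℝ, ∀ w : Fin n → EuclideanSpace ℝ (Fin n) → ℝ, Sol α β κ M w →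
      ballInt r (fun x => wt T (logN κ w x) * qD α κ w x) ≤ C := by
  obtain ⟨T₀, hT₀⟩ := exists_subsol (α := α) (β := β) (κ := κ) hn hα hβ hκ M
  refine ⟨T₀, fun T hT r hr hr5 => ?_⟩
  obtain ⟨c, hc, H⟩ := exists_ballInt_le_ballInt (n := n) (s := (r + 5) / 2) hr (by linarith)
    (by linarith)
  obtain ⟨C, hC⟩ := exists_ballInt_e2M_le (n := n) (α := α) (β := β) (κ := κ) hM
    (show 0 < (r + 5) / 2 by linarith) (by linarith)
  refine ⟨200 * (200 * (n * (n * c ^ 2)) * C), fun w h => ?_⟩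
  have hwt := (h.contDiffOn_wt_logN hn T)
  have hQ : ballInt ((r + 5) / 2) (fun x => 200 * (n * (n * c ^ 2)) * e2M (jac w x)) ≤
      200 * (n * (n * c ^ 2)) * C := by
    rw [ballInt_const_mul]
    exact mul_le_mul_of_nonneg_left (hC w h) (by positivity)
  have main : ballInt r (fun x => 1 / 200 * (wt T (logN κ w x) * qD α κ w x)) ≤
      ballInt ((r + 5) / 2) (fun x => 200 * (n * (n * c ^ 2)) * e2M (jac w x)) := by
    refine H (fun i y => wt T (logN κ w y) * gDlog α κ w i y) _ _
      (fun i => hwt.mul (h.contDiffOn_gDlog hn i))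
      (continuousOn_const.mul (hwt.mul (h.contDiffOn_qD hn)).continuousOn)
      (continuousOn_const.mul h.contDiffOn_e2M_jac.continuousOn)
      (fun x hx => by
        have := h.qD_nonneg hα hβ hx
        have := wt_nonneg T (logN κ w x)
        positivity) fun x hx t ξ h0 h1 hξ => ?_
    have hq := h.qD_nonneg hα hβ hx
    have hw := wt_nonneg T (logN κ w x)
    have hw1 := wt_le_one T (logN κ w x)
    obtain ⟨d, hd, hd'⟩ := h.exists_sum_pd_wt hn T hx
    rw [hd']
    have k1 := two_mul_quad_ge hα hβ (h.adm x hx) t 200 (by norm_num) ξ fun k => logD κ w k x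
    have k2 : ∑ i, ξ i * (wt T (logN κ w x) * gDlog α κ w i x) = wt T (logN κ w x) *
        (ξ ⬝ᵥ gM α (jac w x) *ᵥ fun k => logD κ w k x) := by
      rw [dotProduct, Finset.mul_sum]
      refine Finset.sum_congr rfl fun i _ => ?_
      rw [gDlog, mulVec, dotProduct]; ring
    have k3 := (h.adm x hx).gM_quad_le hα hβ ξ
    have k4 : ξ ⬝ᵥ ξ ≤ n * c ^ 2 := by
      refine (Finset.sum_le_card_nsmul _ _ (c ^ 2) fun i _ => ?_).trans (by simp)
      rw [← pow_two]; exact sq_le_sq' (abs_le.1 (hξ i)).1 (abs_le.1 (hξ i)).2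
    have he := (h.adm x hx).e2M_pos
    have k5 : ξ ⬝ᵥ gM α (jac w x) *ᵥ ξ ≤ n * (n * c ^ 2) * e2M (jac w x) := by
      rw [Fintype.card_fin] at k3
      refine k3.trans ((mul_le_mul_of_nonneg_left k4 (by positivity)).trans (le_of_eq (by ring)))
    have k6 : (1 / 100) * (wt T (logN κ w x) * qD α κ w x) ≤ wt T (logN κ w x) *
        ∑ k, ∑ l, gM α (jac w x) k l * pd l (logD κ w k) x := by
      rcases le_total (logN κ w x) T with hb | hb
      · simp [wt_of_le hb]
      · have := mul_le_mul_of_nonneg_left (hT₀ w h x hx (hT.trans hb)) hw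
        rw [qD, dot_mulVec_eq]
        linarith
    rw [k2]
    change -(t ^ 2 * qD α κ w x / 200 + _) ≤ _ at k1
    generalize (∑ k, ∑ l, gM α (jac w x) k l * pd l (logD κ w k) x) = S at *
    generalize (ξ ⬝ᵥ gM α (jac w x) *ᵥ fun k => logD κ w k x) = X at *
    have k0 := (h.adm x hx).gM_quad_nonneg hα hβ ξ
    generalize (ξ ⬝ᵥ gM α (jac w x) *ᵥ ξ) = Y at *
    generalize wt T (logN κ w x) = W at *
    generalize qD α κ w x = q at *
    have m1 := mul_le_mul_of_nonneg_left k1 hw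
    have m2 := mul_le_mul_of_nonneg_left k6 (sq_nonneg t)
    have m3 := mul_nonneg (sq_nonneg t) (mul_nonneg hd hq)
    have m4 := mul_le_mul_of_nonneg_right hw1 k0
    linarith
  rw [ballInt_const_mul] at main
  linarith

end HessQuot

namespace HessQuot
variable {n : ℕ}

open Matrix MeasureTheory

lemma abs_grD_mul_sum_le {T s X q M : ℝ} {v w : Fin n → ℝ} (hX : 0 ≤ X) (hq : 0 ≤ q)
    (hv : ∀ i, v i ^ 2 ≤ X * q) (hw : ∀ i, |w i| ≤ M) :
    |grD T s * ∑ i, v i * w i| ≤ n * ((X + wt T s * q) / 2 * M) := by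
  have hwt := wt_nonneg T s
  rw [Finset.mul_sum]
  refine (Finset.abs_sum_le_sum_abs _ _).trans ?_
  refine (Finset.sum_le_card_nsmul _ _ _ fun i _ => ?_).trans (by simp; exact le_rfl)
  rw [← mul_assoc, abs_mul]
  have h0 : 0 ≤ (X + wt T s * q) / 2 := by positivity
  refine mul_le_mul (abs_le_of_sq_le_sq ?_ h0) (hw i) (abs_nonneg _) h0
  rw [mul_pow, grD_sq]
  have h1 := mul_le_mul_of_nonneg_left (hv i) hwt
  nlinarith [sq_nonneg (X - wt T s * q)]

lemma exists_logN_le {α β κ : ℝ} (hn : 3 ≤ n) (hα : 0 < α) (hβ : 0 ≤ β) (hκ : 0 ≤ κ) (M : ℝ) :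
    ∃ C : ℝ, 0 ≤ C ∧ ∀ w : Fin n → EuclideanSpace ℝ (Fin n) → ℝ, Sol α β κ M w →
      ∀ x ∈ bigBall n, logN κ w x ≤ C * (jac w x).trace := by
  obtain ⟨C₀, hC₀⟩ : ∃ C₀, C₀ = 2 + κ ^ 2 * (1 + Fintype.card (Fin n)) / (6 * α) := ⟨_, rfl⟩
  have hpos : 0 ≤ C₀ := by rw [hC₀]; positivity
  refine ⟨2 * √C₀, by positivity, fun w h x hx => ?_⟩
  have h1 := (h.adm x hx).trace_sq_oM_le hα hβ hκ
  rw [← hC₀] at h1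
  have hN := h.sqN_pos hn hx
  have h2 : √(sqN κ w x) ≤ √C₀ * (jac w x).trace := by
    refine (Real.sqrt_le_sqrt h1).trans (le_of_eq ?_)
    rw [Real.sqrt_mul hpos, Real.sqrt_sq (h.adm x hx).trace_pos.le]
  have h3 := Real.log_le_sub_one_of_pos (Real.sqrt_pos.2 hN)
  rw [Real.log_sqrt hN.le] at h3
  unfold logN
  linarith

lemma ballInt_lin {r : ℝ} (hr : r < 5) {P Q : EuclideanSpace ℝ (Fin n) → ℝ}
    (hP : ContinuousOn P (bigBall n)) (hQ : ContinuousOn Q (bigBall n)) (a b : ℝ) :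
    ballInt r (fun x => a * P x + b * Q x) = a * ballInt r P + b * ballInt r Q := by
  have hP' : ContinuousOn (fun x => a * P x) (bigBall n) := continuousOn_const.mul hP
  have hQ' : ContinuousOn (fun x => b * Q x) (bigBall n) := continuousOn_const.mul hQ
  rw [ballInt_add hr hP' hQ', ballInt_const_mul, ballInt_const_mul]

lemma exists_ballInt_gr_trace_le {α β κ M T : ℝ} (hn : 3 ≤ n) (hα : 0 < α) (hβ : 0 ≤ β)
    (hκ : 0 ≤ κ) (hM : 0 ≤ M) (hT : 0 ≤ T)
    (hE : ∀ r, 0 < r → r < 5 → ∃ C : ℝ, ∀ w : Fin n → EuclideanSpace ℝ (Fin n) → ℝ,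
      Sol α β κ M w → ballInt r (fun x => wt T (logN κ w x) * qD α κ w x) ≤ C)
    {r : ℝ} (hr : 0 < r) (hr5 : r < 5) :
    ∃ C : ℝ, ∀ w : Fin n → EuclideanSpace ℝ (Fin n) → ℝ, Sol α β κ M w →
      ballInt r (fun x => gr T (logN κ w x) * (jac w x).trace) ≤ C := by
  have hs : 0 < (r + 5) / 2 := by linarith
  have hs5 : (r + 5) / 2 < 5 := by linarith
  obtain ⟨c, hc, H⟩ := exists_ballInt_le_ballInt (n := n) (s := (r + 5) / 2) hr (by linarith) hs5
  obtain ⟨Ct, hCt⟩ := exists_ballInt_trace_le (n := n) (α := α) (β := β) (κ := κ) (M := M) hs hs5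
  obtain ⟨Ce, hCe⟩ := hE _ hs hs5
  obtain ⟨C₁, h₁, hC₁⟩ := exists_norm_sq_le_gM (ι := Fin n) (κ := κ) hα hβ hκ
  obtain ⟨C₃, h₃, hC₃⟩ := exists_logN_le (n := n) hn hα hβ hκ M
  obtain ⟨a, ha⟩ : ∃ a, a = n * (C₁ / 2 * M) + 2 * n * c * (C₃ * M) := ⟨_, rfl⟩
  obtain ⟨b, hb⟩ : ∃ b, b = n * (1 / 2 * M) := ⟨_, rfl⟩
  have ha0 : 0 ≤ a := by rw [ha]; positivity
  have hb0 : 0 ≤ b := by rw [hb]; positivity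
  refine ⟨a * Ct + b * Ce, fun w h => ?_⟩
  have ctr := h.contDiffOn_trace_jac.continuousOn
  have cwt := ((h.contDiffOn_wt_logN hn T).mul (h.contDiffOn_qD hn)).continuousOn
  have cgr := h.contDiffOn_gr_logN hn T
  have hQ : ballInt ((r + 5) / 2) (fun x => a * (jac w x).trace +
      b * (wt T (logN κ w x) * qD α κ w x)) ≤ a * Ct + b * Ce := by
    have := ballInt_lin hs5 ctr cwt a b
    rw [this]
    exact add_le_add (mul_le_mul_of_nonneg_left (hCt w h) ha0)
      (mul_le_mul_of_nonneg_left (hCe w h) hb0)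
  refine le_trans ?_ hQ
  refine H (fun i y => gr T (logN κ w y) * w i y) _ _
    (fun i => cgr.mul ((h.smooth i).of_le (by norm_num))) (cgr.continuousOn.mul ctr)
    ((continuousOn_const.mul ctr).add (continuousOn_const.mul cwt))
    (fun x hx => mul_nonneg (gr_nonneg T _) (h.adm x hx).trace_pos.le) fun x hx t ξ h0 h1 hξ => ?_
  have htr := (h.adm x hx).trace_pos
  have hq := h.qD_nonneg hα hβ hx
  have hw := wt_nonneg T (logN κ w x)
  have hlog := h.one_lt_logN hn hx
  have hg0 := gr_nonneg T (logN κ w x)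
  have hg1 : gr T (logN κ w x) ≤ C₃ * (jac w x).trace :=
    (gr_le hT (by linarith)).trans (hC₃ w h x hx)
  rw [h.sum_pd_gr hn T (fun i => (h.smooth i).of_le (by norm_num)) hx]
  have k1 := abs_grD_mul_sum_le (T := T) (s := logN κ w x) (X := C₁ * (jac w x).trace)
    (q := qD α κ w x) (v := fun i => logD κ w i x) (w := fun i => w i x) (M := M)
    (by positivity) hq (fun i => (sq_le_dot_self (fun i => logD κ w i x) i).trans
      (hC₁ _ (h.adm x hx) _)) (fun i => h.bdd i x hx)
  have k2 := abs_two_mul_sum_le (f := fun i => gr T (logN κ w x) * w i x)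
    (F := C₃ * (jac w x).trace * M) h0 h1 hc hξ fun i => by
      rw [abs_mul, abs_of_nonneg hg0]
      exact mul_le_mul hg1 (h.bdd i x hx) (abs_nonneg _) (by positivity)
  have e : ∑ i, pd i (w i) x = (jac w x).trace := rfl
  rw [e]
  have k1' := (abs_le.1 k1).1
  have k2' := (abs_le.1 k2).1
  generalize grD T (logN κ w x) * ∑ i, logD κ w i x * w i x = S at *
  have ht2 : t ^ 2 ≤ 1 := pow_le_one₀ h0 h1
  have k3 : -(n * ((C₁ * (jac w x).trace + wt T (logN κ w x) * qD α κ w x) / 2 * M)) ≤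
      t ^ 2 * S := by
    have p : 0 ≤ n * ((C₁ * (jac w x).trace + wt T (logN κ w x) * qD α κ w x) / 2 * M) := by
      positivity
    nlinarith [sq_nonneg t]
  rw [ha, hb]
  linarith

lemma exists_ballInt_gr_e2M_le {α β κ M T : ℝ} (hn : 3 ≤ n) (hα : 0 < α) (hβ : 0 ≤ β)
    (hκ : 0 ≤ κ) (hM : 0 ≤ M) (hT : 0 ≤ T)
    (hE : ∀ r, 0 < r → r < 5 → ∃ C : ℝ, ∀ w : Fin n → EuclideanSpace ℝ (Fin n) → ℝ,
      Sol α β κ M w → ballInt r (fun x => wt T (logN κ w x) * qD α κ w x) ≤ C)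
    {r : ℝ} (hr : 0 < r) (hr5 : r < 5) :
    ∃ C : ℝ, ∀ w : Fin n → EuclideanSpace ℝ (Fin n) → ℝ, Sol α β κ M w →
      ballInt r (fun x => gr T (logN κ w x) * e2M (jac w x)) ≤ C := by
  have hs : 0 < (r + 5) / 2 := by linarith
  have hs5 : (r + 5) / 2 < 5 := by linarith
  obtain ⟨c, hc, H⟩ := exists_ballInt_le_ballInt (n := n) (s := (r + 5) / 2) hr (by linarith) hs5
  obtain ⟨Ct, hCt⟩ := exists_ballInt_gr_trace_le (n := n) (M := M) hn hα hβ hκ hM hT hE hs hs5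
  obtain ⟨C₂, hC₂⟩ := exists_ballInt_e2M_le (n := n) (α := α) (β := β) (κ := κ) hM hs hs5
  obtain ⟨Ce, hCe⟩ := hE _ hs hs5
  obtain ⟨C₁, h₁, hC₁⟩ := exists_compl_mulVec_le (ι := Fin n) (κ := κ) hα hβ hκ
  obtain ⟨a, ha⟩ : ∃ a, a = 2 * n * c * (2 * n * M) := ⟨_, rfl⟩
  obtain ⟨b, hb⟩ : ∃ b, b = n * (1 / 2 * M) := ⟨_, rfl⟩
  obtain ⟨d, hd⟩ : ∃ d, d = n * (C₁ / 2 * M) := ⟨_, rfl⟩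
  have ha0 : 0 ≤ a := by rw [ha]; positivity
  have hb0 : 0 ≤ b := by rw [hb]; positivity
  have hd0 : 0 ≤ d := by rw [hd]; positivity
  refine ⟨a * Ct + (b * Ce + d * C₂), fun w h => ?_⟩
  have ctr := h.contDiffOn_trace_jac.continuousOn
  have ce2 := h.contDiffOn_e2M_jac.continuousOn
  have cwt := ((h.contDiffOn_wt_logN hn T).mul (h.contDiffOn_qD hn)).continuousOn
  have cgr := h.contDiffOn_gr_logN hn T
  have hQ : ballInt ((r + 5) / 2) (fun x => a * (gr T (logN κ w x) * (jac w x).trace) +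
      (b * (wt T (logN κ w x) * qD α κ w x) + d * e2M (jac w x))) ≤
      a * Ct + (b * Ce + d * C₂) := by
    have ctg : ContinuousOn (fun x => gr T (logN κ w x) * (jac w x).trace) (bigBall n) :=
      cgr.continuousOn.mul ctr
    have cwe : ContinuousOn (fun x => b * (wt T (logN κ w x) * qD α κ w x) + d * e2M (jac w x))
        (bigBall n) := (continuousOn_const.mul cwt).add (continuousOn_const.mul ce2)
    have h1 := ballInt_lin hs5 ctg cwe a 1
    have h2 := ballInt_lin hs5 cwt ce2 b d
    simp only [one_mul] at h1
    rw [h1, h2]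
    exact add_le_add (mul_le_mul_of_nonneg_left (hCt w h) ha0)
      (add_le_add (mul_le_mul_of_nonneg_left (hCe w h) hb0)
        (mul_le_mul_of_nonneg_left (hC₂ w h) hd0))
  refine le_trans ?_ hQ
  refine H (fun i y => gr T (logN κ w y) * complW w i y) _ _
    (fun i => cgr.mul (h.contDiffOn_complW i)) (cgr.continuousOn.mul ce2)
    ((continuousOn_const.mul (cgr.continuousOn.mul ctr)).add
      ((continuousOn_const.mul cwt).add (continuousOn_const.mul ce2)))
    (fun x hx => mul_nonneg (gr_nonneg T _) (h.adm x hx).e2M_pos.le) fun x hx t ξ h0 h1 hξ => ?_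
  have htr := (h.adm x hx).trace_pos
  have he2 := (h.adm x hx).e2M_pos
  have hq := h.qD_nonneg hα hβ hx
  have hw := wt_nonneg T (logN κ w x)
  have hg0 := gr_nonneg T (logN κ w x)
  rw [h.sum_pd_gr hn T h.contDiffOn_complW hx, h.sum_pd_complW hx]
  have e : ∑ i, logD κ w i x * complW w i x =
      ∑ j, (compl w x *ᵥ fun i => logD κ w i x) j * w j x := by
    simp only [complW, mulVec, dotProduct, Finset.mul_sum, Finset.sum_mul]
    refine Eq.trans Finset.sum_comm ?_
    refine Finset.sum_congr rfl fun k _ => Finset.sum_congr rfl fun l _ => ?_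
    have : compl w x l k = compl w x k l := by
      simp only [compl, Matrix.sub_apply, Matrix.smul_apply, (h.adm x hx).symm l k,
        Matrix.one_apply, eq_comm (a := l)]
    rw [this]; ring
  rw [e]
  have k1 := abs_grD_mul_sum_le (T := T) (s := logN κ w x) (X := C₁ * e2M (jac w x))
    (q := qD α κ w x) (v := compl w x *ᵥ fun i => logD κ w i x) (w := fun i => w i x) (M := M)
    (by positivity) hq (fun i => (sq_le_dot_self _ i).trans
      (hC₁ _ (h.adm x hx) _)) (fun i => h.bdd i x hx)
  have k2 := abs_two_mul_sum_le (f := fun i => gr T (logN κ w x) * complW w i x)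
    (F := gr T (logN κ w x) * (2 * n * M * (jac w x).trace)) h0 h1 hc hξ fun i => by
      rw [abs_mul, abs_of_nonneg hg0]
      exact mul_le_mul_of_nonneg_left (h.abs_complW_le hx i) hg0
  have k1' := (abs_le.1 k1).1
  have k2' := (abs_le.1 k2).1
  generalize grD T (logN κ w x) * ∑ j, (compl w x *ᵥ fun i => logD κ w i x) j * w j x = S at *
  have ht2 : t ^ 2 ≤ 1 := pow_le_one₀ h0 h1
  have k3 : -(n * ((C₁ * e2M (jac w x) + wt T (logN κ w x) * qD α κ w x) / 2 * M)) ≤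
      t ^ 2 * S := by
    have p : 0 ≤ n * ((C₁ * e2M (jac w x) + wt T (logN κ w x) * qD α κ w x) / 2 * M) := by
      positivity
    nlinarith [sq_nonneg t]
  have k4 := mul_nonneg (sq_nonneg t) (mul_nonneg hg0 he2.le)
  rw [ha, hb, hd]
  linarith

lemma exists_ballInt_logN_le {α β κ M : ℝ} (hn : 3 ≤ n) (hα : 0 < α) (hβ : 0 ≤ β)
    (hκ : 0 ≤ κ) (hM : 0 ≤ M) :
    ∃ C : ℝ, ∀ w : Fin n → EuclideanSpace ℝ (Fin n) → ℝ, Sol α β κ M w →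
      ballInt 1 (fun x => logN κ w x * e2M (jac w x)) ≤ C := by
  obtain ⟨T₀, hT₀⟩ := exists_ballInt_energy_le (n := n) (α := α) (β := β) (κ := κ) hn hα hβ hκ hM
  obtain ⟨T, hT⟩ : ∃ T, T = max T₀ 0 := ⟨_, rfl⟩
  have hT0 : 0 ≤ T := hT ▸ le_max_right _ _
  obtain ⟨C₁, hC₁⟩ := exists_ballInt_gr_e2M_le (n := n) (M := M) hn hα hβ hκ hM hT0
    (hT₀ T (hT ▸ le_max_left _ _)) one_pos (by norm_num)
  obtain ⟨C₂, hC₂⟩ := exists_ballInt_e2M_le (n := n) (α := α) (β := β) (κ := κ) hM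
    one_pos (by norm_num)
  refine ⟨C₁ + (1 + T) * C₂, fun w h => ?_⟩
  have ce2 := h.contDiffOn_e2M_jac.continuousOn
  have cgr := (h.contDiffOn_gr_logN hn T).continuousOn
  have h1 : ballInt 1 (fun x => logN κ w x * e2M (jac w x)) ≤ ballInt 1
      (fun x => gr T (logN κ w x) * e2M (jac w x) + (1 + T) * e2M (jac w x)) := by
    refine ballInt_mono (by norm_num) ((h.contDiffOn_logN hn).continuousOn.mul ce2)
      ((cgr.mul ce2).add (continuousOn_const.mul ce2)) fun x hx => ?_
    have := mul_le_mul_of_nonneg_right (le_gr T (logN κ w x)) (h.adm x hx).e2M_pos.le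
    linarith
  have cge : ContinuousOn (fun x => gr T (logN κ w x) * e2M (jac w x)) (bigBall n) :=
    cgr.mul ce2
  have h2 := ballInt_lin (r := 1) (by norm_num) cge ce2 1 (1 + T)
  simp only [one_mul] at h2
  rw [h2] at h1
  have := mul_le_mul_of_nonneg_left (hC₂ w h) (by linarith : 0 ≤ 1 + T)
  linarith [hC₁ w h]

end HessQuot

namespace HessQuot
variable {n : ℕ}

open Matrix

lemma fderiv_eq_sum_pd (f : EuclideanSpace ℝ (Fin n) → ℝ) (x ξ : EuclideanSpace ℝ (Fin n)) :
    fderiv ℝ f x ξ = ∑ k, ξ k * pd k f x := by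
  have e : ξ = ∑ k, ξ k • EuclideanSpace.single k (1 : ℝ) := by
    ext j
    simp [Finset.sum_apply, Pi.single_apply]
  conv_lhs => rw [e]
  rw [map_sum]
  simp only [map_smul, smul_eq_mul, pd]

lemma hasDerivAt_line {f : EuclideanSpace ℝ (Fin n) → ℝ} {d : Fin n → ℝ}
    {x ξ : EuclideanSpace ℝ (Fin n)} {t : ℝ} (hf : DifferentiableAt ℝ f (x + t • ξ))
    (h : ∀ k, pd k f (x + t • ξ) = d k) :
    HasDerivAt (fun s : ℝ => f (x + s • ξ)) (∑ k, ξ k * d k) t := by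
  have h1 : HasDerivAt (fun s : ℝ => x + s • ξ) ξ t := by
    simpa using ((hasDerivAt_id t).smul_const ξ).const_add x
  have h2 := hf.hasFDerivAt.comp_hasDerivAt t h1
  rw [fderiv_eq_sum_pd] at h2
  simp only [h] at h2
  exact h2

lemma deriv_deriv_nonpos_of_isLocalMax {f : ℝ → ℝ} {a : ℝ} (hc : ContinuousAt f a)
    (h : IsLocalMax f a) : deriv (deriv f) a ≤ 0 := by
  by_contra! hpos
  have hmin := isLocalMin_of_deriv_deriv_pos hpos h.deriv_eq_zero hc
  have he : f =ᶠ[nhds a] fun _ => f a := by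
    filter_upwards [h, hmin] with y h1 h2 using le_antisymm h1 h2
  have h2 : deriv (deriv f) a = 0 := by
    rw [he.deriv.deriv_eq]; simp
  linarith

lemma pd_eq_zero_of_isLocalMax {F : EuclideanSpace ℝ (Fin n) → ℝ} {x : EuclideanSpace ℝ (Fin n)}
    (h : IsLocalMax F x) (i : Fin n) : pd i F x = 0 := by
  rw [pd, h.fderiv_eq_zero]; rfl

lemma posSemidef_neg_hess_of_isLocalMax {U : Set (EuclideanSpace ℝ (Fin n))} (hU : IsOpen U)
    {F : EuclideanSpace ℝ (Fin n) → ℝ} (hF : ContDiffOn ℝ 2 F U) {x : EuclideanSpace ℝ (Fin n)}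
    (hx : x ∈ U) (h : IsLocalMax F x) :
    (Matrix.of fun i k => -pd k (pd i F) x).PosSemidef := by
  refine Matrix.PosSemidef.of_dotProduct_mulVec_nonneg ?_ fun ζ => ?_
  · ext i k
    simp only [conjTranspose_apply, of_apply, star_trivial]
    rw [pd_comm hU hF hx i k]
  obtain ⟨ξ, hξ⟩ : ∃ ξ : EuclideanSpace ℝ (Fin n), ξ = WithLp.toLp 2 ζ := ⟨_, rfl⟩
  have hx0 : x + (0 : ℝ) • ξ = x := by simp
  have hcl : Continuous fun s : ℝ => x + s • ξ := by fun_prop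
  have hev : ∀ᶠ s : ℝ in nhds 0, x + s • ξ ∈ U :=
    hcl.continuousAt.preimage_mem_nhds (hU.mem_nhds (by rwa [hx0]))
  have hdF : ∀ y ∈ U, DifferentiableAt ℝ F y := fun y hy =>
    (hF.contDiffAt (hU.mem_nhds hy)).differentiableAt (by norm_num)
  have hd1 : deriv (fun s : ℝ => F (x + s • ξ)) =ᶠ[nhds 0]
      fun s => ∑ k, ξ k * pd k F (x + s • ξ) := by
    filter_upwards [hev] with s hs
    exact (hasDerivAt_line (hdF _ hs) fun k => rfl).deriv
  have hd2 : deriv (deriv (fun s : ℝ => F (x + s • ξ))) 0 =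
      ∑ i, ξ i * ∑ k, ξ k * pd k (pd i F) x := by
    rw [hd1.deriv_eq]
    refine HasDerivAt.deriv (HasDerivAt.fun_sum fun i _ => HasDerivAt.const_mul _ ?_)
    have h1 : DifferentiableAt ℝ (pd i F) x :=
      ((contDiffOn_pd (m := 1) hU (by exact hF) i).contDiffAt (hU.mem_nhds hx)).differentiableAt
        (by norm_num)
    exact hasDerivAt_line (by rwa [hx0]) fun k => by rw [hx0]
  have hmax : IsLocalMax (fun s : ℝ => F (x + s • ξ)) 0 := by
    have ht : Filter.Tendsto (fun s : ℝ => x + s • ξ) (nhds 0) (nhds x) := by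
      have := hcl.tendsto 0
      rwa [hx0] at this
    filter_upwards [ht.eventually h] with s hs
    simpa [hx0] using hs
  have hcont : ContinuousAt (fun s : ℝ => F (x + s • ξ)) 0 :=
    ContinuousAt.comp (by rw [hx0]; exact (hdF x hx).continuousAt) hcl.continuousAt
  have h3 := deriv_deriv_nonpos_of_isLocalMax hcont hmax
  rw [hd2] at h3
  have e : star ζ ⬝ᵥ (Matrix.of fun i k => -pd k (pd i F) x) *ᵥ ζ =
      -∑ i, ξ i * ∑ k, ξ k * pd k (pd i F) x := by
    simp only [dotProduct, mulVec, of_apply, star_trivial, hξ, ← Finset.sum_neg_distrib,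
      Finset.mul_sum, Pi.star_apply]
    exact Finset.sum_congr rfl fun i _ => Finset.sum_congr rfl fun k _ => by ring
  rw [e]; linarith

end HessQuot

namespace HessQuot
variable {n : ℕ}

open Matrix

lemma MAdm.det_oM_pos {ι : Type*} [Fintype ι] [DecidableEq ι] {α β κ : ℝ} {A : Matrix ι ι ℝ}
    (h : MAdm α β κ A) : 0 < (oM κ A).det := by
  obtain ⟨R, x, hR, rfl, hx⟩ := h
  rw [conj_oM hR, oM_diagonal, det_conj hR]
  exact Finset.prod_pos fun i hi => by linarith [hx.low i hi]

/-- The open unit ball. -/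
abbrev unitBall (n : ℕ) : Set (EuclideanSpace ℝ (Fin n)) := Metric.ball 0 1

/-- The defining function of the unit ball. -/
def rho (x : EuclideanSpace ℝ (Fin n)) : ℝ := 1 - ∑ i, x i ^ 2

lemma rho_eq (x : EuclideanSpace ℝ (Fin n)) : rho x = 1 - ‖x‖ ^ 2 := by
  rw [rho, EuclideanSpace.real_norm_sq_eq]

lemma rho_pos {x : EuclideanSpace ℝ (Fin n)} (hx : x ∈ unitBall n) : 0 < rho x := by
  have h1 : ‖x‖ < 1 := by simpa using hx
  rw [rho_eq]; nlinarith [norm_nonneg x]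

lemma rho_le_one (x : EuclideanSpace ℝ (Fin n)) : rho x ≤ 1 := by
  rw [rho_eq]; nlinarith [norm_nonneg x]

lemma unitBall_subset : unitBall n ⊆ bigBall n := Metric.ball_subset_ball (by norm_num)

lemma contDiff_rho {m : WithTop ℕ∞} : ContDiff ℝ m (rho (n := n)) := by
  unfold rho; fun_prop

lemma hasPD_rho (k : Fin n) (x : EuclideanSpace ℝ (Fin n)) : HasPD k rho (-2 * x k) x := by
  refine ((hasPD_const 1).sub (HasPD.sum fun i _ => (hasPD_coord i).pow 2)).congr_val ?_
  simp

/-- The linear tilt of the shifted gradient field by a slope `p`. -/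
def tilt (κ : ℝ) (w : Fin n → EuclideanSpace ℝ (Fin n) → ℝ) (p x : EuclideanSpace ℝ (Fin n)) : ℝ :=
  ∑ j, p j * (w j x + κ * x j)

/-- Logarithm of the tilted test function. -/
def tiltLog (κ : ℝ) (w : Fin n → EuclideanSpace ℝ (Fin n) → ℝ) (p x : EuclideanSpace ℝ (Fin n)) :
    ℝ := Real.log (logN κ w x) + n * Real.log (rho x) + tilt κ w p x

/-- Gradient of the untilted logarithmic test function. -/
def logG (κ : ℝ) (w : Fin n → EuclideanSpace ℝ (Fin n) → ℝ) (i : Fin n)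
    (x : EuclideanSpace ℝ (Fin n)) : ℝ :=
  (logN κ w x)⁻¹ * logD κ w i x - 2 * n * (x i * (rho x)⁻¹)

/-- The slope whose tilt is critical at `x`. -/
def slope (κ : ℝ) (w : Fin n → EuclideanSpace ℝ (Fin n) → ℝ) (j : Fin n)
    (x : EuclideanSpace ℝ (Fin n)) : ℝ :=
  -((oM κ (jac w x)).det⁻¹ * ∑ i, (oM κ (jac w x)).adjugate j i * logG κ w i x)

lemma contDiffOn_det {U : Set (EuclideanSpace ℝ (Fin n))} {m : WithTop ℕ∞}
    {Y : EuclideanSpace ℝ (Fin n) → Matrix (Fin n) (Fin n) ℝ}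
    (hY : ∀ i j, ContDiffOn ℝ m (fun y => Y y i j) U) : ContDiffOn ℝ m (fun y => (Y y).det) U := by
  simp only [Matrix.det_apply']
  exact ContDiffOn.sum fun σ _ => contDiffOn_const.mul (contDiffOn_prod fun i _ => hY _ _)

lemma contDiffOn_adjugate {U : Set (EuclideanSpace ℝ (Fin n))} {m : WithTop ℕ∞}
    {Y : EuclideanSpace ℝ (Fin n) → Matrix (Fin n) (Fin n) ℝ}
    (hY : ∀ i j, ContDiffOn ℝ m (fun y => Y y i j) U) (i j : Fin n) :
    ContDiffOn ℝ m (fun y => (Y y).adjugate i j) U := by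
  simp only [Matrix.adjugate_apply]
  refine contDiffOn_det fun k l => ?_
  by_cases hk : k = j
  · subst hk
    simp only [Matrix.updateRow_self]
    exact contDiffOn_const
  · simp only [Matrix.updateRow_ne hk]
    exact hY k l

namespace Sol
variable {α β κ M : ℝ} {w : Fin n → EuclideanSpace ℝ (Fin n) → ℝ} (h : Sol α β κ M w)
  {x : EuclideanSpace ℝ (Fin n)} (hn : 3 ≤ n)
include h

lemma contDiffOn_tilt (p : EuclideanSpace ℝ (Fin n)) :
    ContDiffOn ℝ 2 (tilt κ w p) (bigBall n) := by
  refine ContDiffOn.sum fun j _ => contDiffOn_const.mul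
    (((h.smooth j).of_le (by norm_num)).add (contDiffOn_const.mul ?_))
  fun_prop

include hn

lemma contDiffOn_tiltLog (p : EuclideanSpace ℝ (Fin n)) :
    ContDiffOn ℝ 2 (tiltLog κ w p) (unitBall n) := by
  refine (ContDiffOn.add (((h.contDiffOn_logN hn).mono unitBall_subset).log fun x hx => ?_)
    (contDiffOn_const.mul (contDiff_rho.contDiffOn.log fun x hx => (rho_pos hx).ne'))).add
    ((h.contDiffOn_tilt p).mono unitBall_subset)
  linarith [h.one_lt_logN hn (unitBall_subset hx)]

lemma contDiffOn_logG (i : Fin n) : ContDiffOn ℝ 1 (logG κ w i) (unitBall n) := by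
  refine ((((h.contDiffOn_logN hn).mono unitBall_subset).of_le (by norm_num)).inv
    fun x hx => ?_).mul ((h.contDiffOn_logD hn i).mono unitBall_subset) |>.sub
    (contDiffOn_const.mul (ContDiffOn.mul (by fun_prop)
      (contDiff_rho.contDiffOn.inv fun x hx => (rho_pos hx).ne')))
  linarith [h.one_lt_logN hn (unitBall_subset hx)]

lemma contDiffOn_slope (j : Fin n) : ContDiffOn ℝ 1 (slope κ w j) (unitBall n) := by
  have h1 : ∀ i j, ContDiffOn ℝ 1 (fun y => oM κ (jac w y) i j) (unitBall n) :=
    contDiffOn_oM κ fun i j => ((h.contDiffOn_jac i j).of_le (by norm_num)).mono unitBall_subset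
  exact (((contDiffOn_det h1).inv fun x hx =>
    (h.adm x (unitBall_subset hx)).det_oM_pos.ne').mul
    (ContDiffOn.sum fun i _ => (contDiffOn_adjugate h1 j i).mul (h.contDiffOn_logG hn i))).neg

omit hn in
lemma hasPD_tilt (hx : x ∈ bigBall n) (p : EuclideanSpace ℝ (Fin n)) (k : Fin n) :
    HasPD k (tilt κ w p) (∑ j, p j * oM κ (jac w x) k j) x := by
  refine HasPD.sum fun j _ => (((h.hasPD_w hx k j).add ((hasPD_coord j).const_mul κ)).const_mul
    (p j)).congr_val ?_
  simp only [oM, Matrix.add_apply, Matrix.smul_apply, Matrix.one_apply, smul_eq_mul, eq_comm]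

lemma pd_tiltLog (hx : x ∈ unitBall n) (p : EuclideanSpace ℝ (Fin n)) (k : Fin n) :
    pd k (tiltLog κ w p) x = logG κ w k x + ∑ j, p j * oM κ (jac w x) k j := by
  have hb := h.one_lt_logN hn (unitBall_subset hx)
  have hr := rho_pos hx
  refine (((HasPD.comp (Real.hasDerivAt_log (by linarith))
    (h.hasPD_logN hn (unitBall_subset hx) k)).add ((HasPD.comp (Real.hasDerivAt_log hr.ne')
    (hasPD_rho k x)).const_mul (n : ℝ))).add (h.hasPD_tilt (unitBall_subset hx) p k)).pd_eq.trans ?_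
  rw [logG]; ring

lemma pd_pd_tiltLog (hx : x ∈ unitBall n) (p : EuclideanSpace ℝ (Fin n)) (i k : Fin n) :
    pd k (pd i (tiltLog κ w p)) x =
      pd k (logG κ w i) x + ∑ j, p j * jacD w k x i j := by
  rw [pd_congr Metric.isOpen_ball (fun y hy => h.pd_tiltLog hn hy p i) hx k]
  have h1 : HasPD k (logG κ w i) (pd k (logG κ w i) x) x :=
    (((h.contDiffOn_logG hn i).contDiffAt (Metric.isOpen_ball.mem_nhds hx)).differentiableAt
      (by norm_num)).hasPD
  exact (h1.add (HasPD.sum fun j _ =>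
    (((h.hasMD_jac (unitBall_subset hx) k).oM κ) i j).const_mul (p j))).pd_eq

omit hn in
lemma oM_mulVec_slope (hx : x ∈ bigBall n) (k : Fin n) :
    ∑ j, oM κ (jac w x) k j * slope κ w j x = -logG κ w k x := by
  have hd := (h.adm x hx).det_oM_pos.ne'
  have e : (fun j => slope κ w j x) = -((oM κ (jac w x)).det⁻¹ •
      ((oM κ (jac w x)).adjugate *ᵥ fun i => logG κ w i x)) := by
    ext j; simp [slope, mulVec, dotProduct]
  have e2 : oM κ (jac w x) *ᵥ (fun j => slope κ w j x) = -fun i => logG κ w i x := by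
    rw [e, mulVec_neg, mulVec_smul, mulVec_mulVec, mul_adjugate, smul_mulVec, one_mulVec,
      smul_smul, inv_mul_cancel₀ hd, one_smul]
  exact congrFun e2 k

lemma slope_eq (hx : x ∈ unitBall n) {p : EuclideanSpace ℝ (Fin n)}
    (hp : ∀ k, pd k (tiltLog κ w p) x = 0) (j : Fin n) : slope κ w j x = p j := by
  have hd := (h.adm x (unitBall_subset hx)).det_oM_pos.ne'
  have e : oM κ (jac w x) *ᵥ (fun j => slope κ w j x) = oM κ (jac w x) *ᵥ fun j => p j := by
    ext k
    have h1 := h.oM_mulVec_slope (unitBall_subset hx) k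
    have h2 := hp k
    rw [h.pd_tiltLog hn hx] at h2
    simp only [mulVec, dotProduct]
    rw [h1, show ∑ j, oM κ (jac w x) k j * p j = ∑ j, p j * oM κ (jac w x) k j from
      Finset.sum_congr rfl fun _ _ => mul_comm _ _]
    linarith
  exact congrFun (Matrix.mulVec_injective_of_isUnit
    ((Matrix.isUnit_iff_isUnit_det _).2 hd.isUnit) e) j

lemma oM_mul_slopeD (hx : x ∈ unitBall n) {p : EuclideanSpace ℝ (Fin n)}
    (hp : ∀ k, pd k (tiltLog κ w p) x = 0) (i k : Fin n) :
    ∑ j, oM κ (jac w x) i j * pd k (slope κ w j) x = -pd k (pd i (tiltLog κ w p)) x := by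
  have h0 : pd k (fun y => ∑ j, oM κ (jac w y) i j * slope κ w j y) x =
      pd k (fun y => -logG κ w i y) x :=
    pd_congr Metric.isOpen_ball (fun y hy => h.oM_mulVec_slope (unitBall_subset hy) i) hx k
  have h1 : HasPD k (logG κ w i) (pd k (logG κ w i) x) x :=
    (((h.contDiffOn_logG hn i).contDiffAt (Metric.isOpen_ball.mem_nhds hx)).differentiableAt
      (by norm_num)).hasPD
  have h2 : ∀ j, HasPD k (slope κ w j) (pd k (slope κ w j) x) x := fun j =>
    (((h.contDiffOn_slope hn j).contDiffAt (Metric.isOpen_ball.mem_nhds hx)).differentiableAt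
      (by norm_num)).hasPD
  rw [h1.neg.pd_eq, (HasPD.sum fun j _ => (((h.hasMD_jac (unitBall_subset hx) k).oM κ) i j).mul
    (h2 j)).pd_eq, Finset.sum_add_distrib] at h0
  rw [h.pd_pd_tiltLog hn hx]
  simp only [h.slope_eq hn hx hp] at h0
  rw [show ∑ j, p j * jacD w k x i j = ∑ j, jacD w k x i j * p j from
    Finset.sum_congr rfl fun _ _ => mul_comm _ _]
  linarith

end Sol

end HessQuot

namespace HessQuot
variable {n : ℕ}

open Matrix

lemma MAdm.gM_quad_add_le {ι : Type*} [Fintype ι] [DecidableEq ι] {α β κ : ℝ} (hα : 0 < α)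
    (hβ : 0 ≤ β) {A : Matrix ι ι ℝ} (h : MAdm α β κ A) (u v : ι → ℝ) :
    (u + v) ⬝ᵥ gM α A *ᵥ (u + v) ≤ 2 * (u ⬝ᵥ gM α A *ᵥ u) + 2 * (v ⬝ᵥ gM α A *ᵥ v) := by
  have h1 := h.gM_quad_nonneg hα hβ (u - v)
  simp only [mulVec_add, mulVec_sub, dotProduct_add, add_dotProduct, dotProduct_sub,
    sub_dotProduct] at h1 ⊢
  linarith

namespace Sol
variable {α β κ M : ℝ} {w : Fin n → EuclideanSpace ℝ (Fin n) → ℝ} (h : Sol α β κ M w)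
  {x : EuclideanSpace ℝ (Fin n)} (hn : 3 ≤ n)
include h hn

lemma pd_logG (hx : x ∈ unitBall n) (k l : Fin n) :
    pd l (logG κ w k) x = (logN κ w x)⁻¹ * pd l (logD κ w k) x
      - (logN κ w x)⁻¹ ^ 2 * (logD κ w k x * logD κ w l x)
      - 2 * n * (rho x)⁻¹ * (if k = l then 1 else 0)
      - 4 * n * (rho x)⁻¹ ^ 2 * (x k * x l) := by
  have hb := h.one_lt_logN hn (unitBall_subset hx)
  have hr := rho_pos hx
  have h1 : HasPD l (logD κ w k) (pd l (logD κ w k) x) x :=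
    (((h.contDiffOn_logD hn k).contDiffAt
      (isOpen_bigBall.mem_nhds (unitBall_subset hx))).differentiableAt (by norm_num)).hasPD
  refine (((HasPD.comp (hasDerivAt_inv (by linarith)) (h.hasPD_logN hn (unitBall_subset hx) l)).mul
    h1).sub (((hasPD_coord k).mul (HasPD.comp (hasDerivAt_inv hr.ne')
      (hasPD_rho l x))).const_mul (2 * (n : ℝ)))).pd_eq.trans ?_
  field_simp
  ring

lemma sum_gM_pd_pd_tiltLog (hx : x ∈ unitBall n) (p : EuclideanSpace ℝ (Fin n)) :
    ∑ k, ∑ l, gM α (jac w x) k l * pd l (pd k (tiltLog κ w p)) x =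
      (logN κ w x)⁻¹ * (∑ k, ∑ l, gM α (jac w x) k l * pd l (logD κ w k) x)
      - (logN κ w x)⁻¹ ^ 2 * qD α κ w x - 2 * n * (rho x)⁻¹ * (gM α (jac w x)).trace
      - 4 * n * (rho x)⁻¹ ^ 2 * ((fun k => x k) ⬝ᵥ gM α (jac w x) *ᵥ fun k => x k) := by
  have hX := unitBall_subset hx
  have h0 : ∑ k, ∑ l, gM α (jac w x) k l * ∑ j, p j * jacD w l x k j = 0 := by
    have e : ∀ j, ∑ k, ∑ l, gM α (jac w x) k l * jacD w l x k j = 0 := fun j => by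
      rw [← h.trace_gM_jacD hX j]
      simp only [Matrix.trace, diag_apply, mul_apply]
      refine Finset.sum_congr rfl fun k _ => Finset.sum_congr rfl fun l _ => ?_
      rw [h.jacD_symm hX l k j, h.jacD_comm hX l j k]
    calc _ = ∑ j, p j * ∑ k, ∑ l, gM α (jac w x) k l * jacD w l x k j := by
          simp only [Finset.mul_sum]
          refine Eq.trans ?_ Finset.sum_comm
          refine Finset.sum_congr rfl fun k _ => ?_
          refine Eq.trans ?_ Finset.sum_comm
          exact Finset.sum_congr rfl fun l _ => Finset.sum_congr rfl fun j _ => by ring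
      _ = 0 := by simp [e]
  have h1 : (gM α (jac w x)).trace =
      ∑ k, ∑ l, gM α (jac w x) k l * (if k = l then (1 : ℝ) else 0) := by
    simp [Matrix.trace]
  rw [h1, qD, dot_mulVec_eq, dot_mulVec_eq]
  simp only [h.pd_pd_tiltLog hn hx, mul_add, Finset.sum_add_distrib, h0, add_zero]
  simp only [h.pd_logG hn hx, Finset.mul_sum, ← Finset.sum_sub_distrib]
  exact Finset.sum_congr rfl fun k _ => Finset.sum_congr rfl fun l _ => by ring

end Sol

lemma trace_bound_scalar {m b ρ q S τ ζ C e z : ℝ} (hm : 1 ≤ m) (hb : 300 ≤ b) (hρ : 0 < ρ)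
    (hρ1 : ρ ≤ 1) (hq : 0 ≤ q) (hC : 0 ≤ C) (he : 0 ≤ e) (hS : 1 / 100 * q ≤ S)
    (hτ : τ ≤ m * e) (hζ0 : 0 ≤ ζ) (hζ : 4 * m ^ 2 * ρ⁻¹ ^ 2 * ζ ≤ 2 * (b⁻¹ ^ 2 * q) + 2 * z)
    (hz : z ≤ C * e) :
    -(b⁻¹ * S - b⁻¹ ^ 2 * q - 2 * m * ρ⁻¹ * τ - 4 * m * ρ⁻¹ ^ 2 * ζ) ≤
      (2 * m ^ 2 + 2 * C) * ρ⁻¹ * e := by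
  have hb0 : 0 < b⁻¹ := by positivity
  have hr : 1 ≤ ρ⁻¹ := (one_le_inv₀ hρ).2 hρ1
  have h1 : b⁻¹ * (1 / 100 * q) ≤ b⁻¹ * S := mul_le_mul_of_nonneg_left hS hb0.le
  have hb3 : b⁻¹ ≤ 1 / 300 := by
    rw [one_div]; exact inv_anti₀ (by norm_num) hb
  have h2 : b⁻¹ ^ 2 * q ≤ b⁻¹ * (1 / 300 * q) := by
    have := mul_le_mul_of_nonneg_left (mul_le_mul_of_nonneg_right hb3 hq) hb0.le
    linarith [show b⁻¹ ^ 2 * q = b⁻¹ * (b⁻¹ * q) by ring]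
  have h3 : 2 * m * ρ⁻¹ * τ ≤ 2 * m * ρ⁻¹ * (m * e) :=
    mul_le_mul_of_nonneg_left hτ (by positivity)
  have h4 : 4 * m * ρ⁻¹ ^ 2 * ζ ≤ 4 * m ^ 2 * ρ⁻¹ ^ 2 * ζ := by
    have : 0 ≤ (m - 1) * (4 * m * ρ⁻¹ ^ 2 * ζ) := mul_nonneg (by linarith) (by positivity)
    linarith [show (m - 1) * (4 * m * ρ⁻¹ ^ 2 * ζ) =
      4 * m ^ 2 * ρ⁻¹ ^ 2 * ζ - 4 * m * ρ⁻¹ ^ 2 * ζ by ring]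
  have h5 : C * e ≤ C * e * ρ⁻¹ := le_mul_of_one_le_right (by positivity) hr
  linarith

lemma exists_det_slopeD_le {α β κ : ℝ} (hn : 3 ≤ n) (hα : 0 < α) (hβ : 0 ≤ β) (hκ : 0 ≤ κ)
    (M : ℝ) : ∃ C T : ℝ, 0 ≤ C ∧ ∀ w : Fin n → EuclideanSpace ℝ (Fin n) → ℝ, Sol α β κ M w →
      ∀ x ∈ unitBall n, ∀ p : EuclideanSpace ℝ (Fin n), ‖p‖ ≤ 1 → IsLocalMax (tiltLog κ w p) x →
      T ≤ logN κ w x →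
      |(Matrix.of fun j k => pd k (slope κ w j) x).det| ≤
        C * (rho x)⁻¹ ^ n * e2M (jac w x) := by
  have hcard : 2 ≤ Fintype.card (Fin n) := by simp; omega
  obtain ⟨C₁, h₁, hC₁⟩ := exists_oM_quad_le (ι := Fin n) hα hβ hκ hcard
  obtain ⟨C₂, h₂, hC₂⟩ := exists_det_le (ι := Fin n) hα hβ hκ hcard
  obtain ⟨T₀, hT₀⟩ := exists_subsol (n := n) hn hα hβ hκ M
  refine ⟨C₂ * (2 * (n : ℝ) ^ 2 + 2 * C₁) ^ n, max T₀ 300, by positivity, ?_⟩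
  intro w h x hx p hp hmax hT
  have hX := unitBall_subset hx
  have hA := h.adm x hX
  have hρ := rho_pos hx
  have hcrit : ∀ k, pd k (tiltLog κ w p) x = 0 := pd_eq_zero_of_isLocalMax hmax
  have hpsd := posSemidef_neg_hess_of_isLocalMax Metric.isOpen_ball (h.contDiffOn_tiltLog hn p)
    hx hmax
  have e1 : oM κ (jac w x) * (Matrix.of fun j k => pd k (slope κ w j) x) =
      Matrix.of fun i k => -pd k (pd i (tiltLog κ w p)) x := by
    ext i k
    rw [mul_apply, of_apply, ← h.oM_mul_slopeD hn hx hcrit i k]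
    rfl
  have htr : (gM α (jac w x) * (oM κ (jac w x) *
      (Matrix.of fun j k => pd k (slope κ w j) x))).trace ≤
      (2 * (n : ℝ) ^ 2 + 2 * C₁) * (rho x)⁻¹ * e2M (jac w x) := by
    have e2 : (gM α (jac w x) * (oM κ (jac w x) *
        (Matrix.of fun j k => pd k (slope κ w j) x))).trace =
        -∑ k, ∑ l, gM α (jac w x) k l * pd l (pd k (tiltLog κ w p)) x := by
      rw [e1]
      simp only [Matrix.trace, diag_apply, mul_apply, of_apply, ← Finset.sum_neg_distrib]
      refine Eq.trans Finset.sum_comm ?_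
      refine Finset.sum_congr rfl fun k _ => Finset.sum_congr rfl fun l _ => ?_
      rw [hA.gM_symm l k]; ring
    rw [e2, h.sum_gM_pd_pd_tiltLog hn hx p]
    have hS := hT₀ w h x hX ((le_max_left _ _).trans hT)
    rw [← dot_mulVec_eq] at hS
    refine trace_bound_scalar (C := C₁) (z := (oM κ (jac w x) *ᵥ fun j => p j) ⬝ᵥ
      gM α (jac w x) *ᵥ (oM κ (jac w x) *ᵥ fun j => p j)) (by exact_mod_cast (by omega : 1 ≤ n))
      ((le_max_right _ _).trans hT) hρ (rho_le_one x) (h.qD_nonneg hα hβ hX) h₁ hA.e2M_pos.le hS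
      (by simpa using hA.trace_gM_le hα) (hA.gM_quad_nonneg hα hβ _) ?_ ?_
    · have e3 : ((2 * n * (rho x)⁻¹) • fun k => x k) =
          ((logN κ w x)⁻¹ • fun k => logD κ w k x) + oM κ (jac w x) *ᵥ fun j => p j := by
        ext k
        have := hcrit k
        rw [h.pd_tiltLog hn hx, logG] at this
        simp only [Pi.smul_apply, smul_eq_mul, Pi.add_apply, mulVec, dotProduct]
        rw [show ∑ j, oM κ (jac w x) k j * p j = ∑ j, p j * oM κ (jac w x) k j from
          Finset.sum_congr rfl fun _ _ => mul_comm _ _]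
        linarith
      have h3 := hA.gM_quad_add_le hα hβ ((logN κ w x)⁻¹ • fun k => logD κ w k x)
        (oM κ (jac w x) *ᵥ fun j => p j)
      rw [← e3] at h3
      simp only [mulVec_smul, dotProduct_smul, smul_dotProduct, smul_eq_mul] at h3
      rw [qD]
      linarith
    · refine (hC₁ _ hA _).trans ?_
      have hpp : (fun j => p j) ⬝ᵥ (fun j => p j) ≤ 1 := by
        have : (fun j => p j) ⬝ᵥ (fun j => p j) = ‖p‖ ^ 2 := by
          rw [EuclideanSpace.real_norm_sq_eq]
          exact Finset.sum_congr rfl fun _ _ => by ring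
        rw [this]
        exact pow_le_one₀ (norm_nonneg _) hp
      exact mul_le_of_le_one_right (mul_nonneg h₁ hA.e2M_pos.le) hpp
  have h5 := hC₂ _ hA _ _ (by rw [e1]; exact hpsd) htr
  rw [Fintype.card_fin, mul_pow] at h5
  linarith

end HessQuot

namespace HessQuot
variable {n : ℕ}

open Matrix MeasureTheory

/-- The closed unit ball. -/
abbrev closedUnitBall (n : ℕ) : Set (EuclideanSpace ℝ (Fin n)) := Metric.closedBall 0 1

/-- The tilted test function. -/
def tiltExp (κ : ℝ) (w : Fin n → EuclideanSpace ℝ (Fin n) → ℝ) (p x : EuclideanSpace ℝ (Fin n)) :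
    ℝ := logN κ w x * rho x ^ n * Real.exp (tilt κ w p x)

/-- Points of the closed unit ball at which some tilted test function is maximal. -/
def contactSet (κ : ℝ) (w : Fin n → EuclideanSpace ℝ (Fin n) → ℝ) :
    Set (EuclideanSpace ℝ (Fin n)) :=
  {x ∈ closedUnitBall n | ∃ p ∈ closedUnitBall n, ∀ y ∈ closedUnitBall n,
    tiltExp κ w p y ≤ tiltExp κ w p x}

/-- The map sending a point to its critical slope. -/
def slopeMap (κ : ℝ) (w : Fin n → EuclideanSpace ℝ (Fin n) → ℝ) (x : EuclideanSpace ℝ (Fin n)) :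
    EuclideanSpace ℝ (Fin n) := WithLp.toLp 2 fun j => slope κ w j x

lemma rho_nonneg {x : EuclideanSpace ℝ (Fin n)} (hx : x ∈ closedUnitBall n) : 0 ≤ rho x := by
  have h1 : ‖x‖ ≤ 1 := by simpa using hx
  rw [rho_eq]; nlinarith [norm_nonneg x]

lemma mem_unitBall_of_rho_pos {x : EuclideanSpace ℝ (Fin n)} (hx : 0 < rho x) :
    x ∈ unitBall n := by
  rw [rho_eq] at hx
  have : ‖x‖ < 1 := by nlinarith [norm_nonneg x]
  simpa using this

lemma abs_coord_le {x : EuclideanSpace ℝ (Fin n)} (hx : x ∈ closedUnitBall n) (j : Fin n) :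
    |x j| ≤ 1 :=
  (PiLp.norm_apply_le x j).trans (by simpa using hx)

lemma isCompact_setOf_exists_isMaxOn {X Y : Type*} [TopologicalSpace X] [T2Space X]
    [TopologicalSpace Y] [T2Space Y] {A : Set X} {B : Set Y} (hA : IsCompact A)
    (hB : IsCompact B) (Φ : Y → X → ℝ) (hΦ : ContinuousOn (fun z : X × Y => Φ z.2 z.1) (A ×ˢ B)) :
    IsCompact {x ∈ A | ∃ p ∈ B, ∀ y ∈ A, Φ p y ≤ Φ p x} := by
  have hAB := hA.prod hB
  have hK : IsCompact ((A ×ˢ B) ∩ ⋂ y ∈ A, {z ∈ A ×ˢ B | Φ z.2 y ≤ Φ z.2 z.1}) := by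
    refine hAB.inter_right (isClosed_biInter fun y hy => ?_)
    have c1 : ContinuousOn (fun z : X × Y => (y, z.2)) (A ×ˢ B) :=
      (continuous_const.prodMk continuous_snd).continuousOn
    have c2 : ContinuousOn (fun z : X × Y => Φ z.2 y) (A ×ˢ B) :=
      hΦ.comp c1 fun z hz => ⟨hy, hz.2⟩
    exact hAB.isClosed.isClosed_le c2 hΦ
  refine (congrArg IsCompact ?_).mp (hK.image continuous_fst)
  ext x
  constructor
  · rintro ⟨⟨x, p⟩, ⟨⟨hx, hp⟩, hm⟩, rfl⟩
    exact ⟨hx, p, hp, fun y hy => (Set.mem_iInter₂.1 hm y hy).2⟩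
  · rintro ⟨hx, p, hp, hm⟩
    exact ⟨(x, p), ⟨⟨hx, hp⟩, Set.mem_iInter₂.2 fun y hy => ⟨⟨hx, hp⟩, hm y hy⟩⟩, rfl⟩

lemma det_fderiv_eq {P : EuclideanSpace ℝ (Fin n) → EuclideanSpace ℝ (Fin n)}
    {x : EuclideanSpace ℝ (Fin n)} (hP : DifferentiableAt ℝ P x) :
    (fderiv ℝ P x).det = (Matrix.of fun j k => pd k (fun y => P y j) x).det := by
  rw [ContinuousLinearMap.det, ← LinearMap.det_toMatrix (EuclideanSpace.basisFun (Fin n) ℝ).toBasis]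
  congr 1
  ext j k
  rw [LinearMap.toMatrix_apply, of_apply, pd]
  have h1 : HasFDerivAt (fun y => P y j)
      ((EuclideanSpace.proj (𝕜 := ℝ) j).comp (fderiv ℝ P x)) x :=
    (EuclideanSpace.proj (𝕜 := ℝ) j).hasFDerivAt.comp x hP.hasFDerivAt
  rw [h1.fderiv]
  simp

namespace Sol
variable {α β κ M : ℝ} {w : Fin n → EuclideanSpace ℝ (Fin n) → ℝ} (h : Sol α β κ M w)
  {x p : EuclideanSpace ℝ (Fin n)}
include h

lemma abs_tilt_le (hκ : 0 ≤ κ) (hp : p ∈ closedUnitBall n) (hx : x ∈ closedUnitBall n) :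
    |tilt κ w p x| ≤ n * (M + κ) := by
  refine (Finset.abs_sum_le_sum_abs _ _).trans ?_
  rw [show (n : ℝ) * (M + κ) = ∑ _j : Fin n, (M + κ) by simp; ring]
  refine Finset.sum_le_sum fun j _ => ?_
  have h1 := abs_coord_le hp j
  have h2 := abs_coord_le hx j
  have h3 := h.bdd j x (closedBall_subset_bigBall (by norm_num) hx)
  have h4 : |w j x + κ * x j| ≤ M + κ := by
    refine (abs_add_le _ _).trans (add_le_add h3 ?_)
    rw [abs_mul, abs_of_nonneg hκ]
    exact mul_le_of_le_one_right hκ h2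
  rw [abs_mul]
  calc |p j| * |w j x + κ * x j| ≤ 1 * (M + κ) :=
        mul_le_mul h1 h4 (abs_nonneg _) zero_le_one
    _ = M + κ := one_mul _

lemma continuousOn_tilt_prod : ContinuousOn
    (fun z : EuclideanSpace ℝ (Fin n) × EuclideanSpace ℝ (Fin n) => tilt κ w z.2 z.1)
    (bigBall n ×ˢ Set.univ) := by
  refine continuousOn_finsetSum _ fun j _ => ContinuousOn.mul (by fun_prop)
    (ContinuousOn.add ((h.smooth j).continuousOn.comp continuousOn_fst fun z hz => hz.1)
      (by fun_prop))

lemma continuousOn_tiltExp_prod (hn : 3 ≤ n) : ContinuousOn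
    (fun z : EuclideanSpace ℝ (Fin n) × EuclideanSpace ℝ (Fin n) => tiltExp κ w z.2 z.1)
    (bigBall n ×ˢ Set.univ) := by
  refine (ContinuousOn.mul ((h.contDiffOn_logN hn).continuousOn.comp continuousOn_fst
    fun z hz => hz.1) ?_).mul (Real.continuous_exp.comp_continuousOn h.continuousOn_tilt_prod)
  exact (((contDiff_rho (m := 0)).continuous.comp continuous_fst).pow n).continuousOn

lemma continuousOn_tiltExp (hn : 3 ≤ n) (p : EuclideanSpace ℝ (Fin n)) :
    ContinuousOn (tiltExp κ w p) (bigBall n) :=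
  (h.continuousOn_tiltExp_prod hn).comp (f := fun x => (x, p)) (by fun_prop)
    fun _ hx => ⟨hx, Set.mem_univ _⟩

lemma isCompact_contactSet (hn : 3 ≤ n) : IsCompact (contactSet κ w) :=
  isCompact_setOf_exists_isMaxOn (isCompact_closedBall _ _) (isCompact_closedBall _ _)
    (tiltExp κ w) ((h.continuousOn_tiltExp_prod hn).mono fun _ hz =>
      ⟨closedBall_subset_bigBall (by norm_num) hz.1, Set.mem_univ _⟩)

lemma logN_mul_rho_ge (hn : 3 ≤ n) (hκ : 0 ≤ κ) (hp : p ∈ closedUnitBall n)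
    (hx : x ∈ closedUnitBall n) (hm : tiltExp κ w p 0 ≤ tiltExp κ w p x) :
    logN κ w 0 * Real.exp (-(2 * (n * (M + κ)))) ≤ logN κ w x * rho x ^ n := by
  obtain ⟨m, hmdef⟩ : ∃ m : ℝ, m = n * (M + κ) := ⟨_, rfl⟩
  have h0 : (0 : EuclideanSpace ℝ (Fin n)) ∈ closedUnitBall n := by simp
  have hs : closedUnitBall n ⊆ bigBall n := closedBall_subset_bigBall (by norm_num)
  have h1 := (abs_le.1 (h.abs_tilt_le hκ hp h0)).1
  have h2 := (abs_le.1 (h.abs_tilt_le hκ hp hx)).2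
  have hr := rho_nonneg hx
  have hb0 := h.one_lt_logN hn (hs h0)
  have hb := h.one_lt_logN hn (hs hx)
  rw [← hmdef] at h1 h2 ⊢
  rw [tiltExp, tiltExp, show rho (0 : EuclideanSpace ℝ (Fin n)) = 1 by simp [rho], one_pow,
    mul_one] at hm
  have h3 : logN κ w 0 * Real.exp (-m) ≤ logN κ w 0 * Real.exp (tilt κ w p 0) :=
    mul_le_mul_of_nonneg_left (Real.exp_le_exp.2 h1) (by linarith)
  have h4 : logN κ w x * rho x ^ n * Real.exp (tilt κ w p x) ≤
      logN κ w x * rho x ^ n * Real.exp m :=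
    mul_le_mul_of_nonneg_left (Real.exp_le_exp.2 h2) (by positivity)
  have h5 := mul_le_mul_of_nonneg_right (h3.trans (hm.trans h4)) (Real.exp_pos (-m)).le
  rw [mul_assoc, ← Real.exp_add, mul_assoc, ← Real.exp_add, add_neg_cancel, Real.exp_zero,
    mul_one] at h5
  rwa [show -(2 * m) = -m + -m by ring]

lemma rho_pos_of_contact (hn : 3 ≤ n) (hκ : 0 ≤ κ) (hp : p ∈ closedUnitBall n)
    (hx : x ∈ closedUnitBall n) (hm : tiltExp κ w p 0 ≤ tiltExp κ w p x) : 0 < rho x := by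
  refine (rho_nonneg hx).lt_of_ne fun h0 => ?_
  have h1 := h.logN_mul_rho_ge hn hκ hp hx hm
  rw [← h0, zero_pow (by omega), mul_zero] at h1
  have h2 := h.one_lt_logN hn (x := 0) (by simp)
  have h3 := Real.exp_pos (-(2 * (n * (M + κ))))
  linarith [mul_pos (by linarith : 0 < logN κ w 0) h3]

lemma log_tiltExp (hn : 3 ≤ n) (hx : x ∈ unitBall n) (p : EuclideanSpace ℝ (Fin n)) :
    Real.log (tiltExp κ w p x) = tiltLog κ w p x := by
  have hb := h.one_lt_logN hn (unitBall_subset hx)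
  have hr := rho_pos hx
  rw [tiltExp, tiltLog, Real.log_mul (by positivity) (Real.exp_pos _).ne', Real.log_exp,
    Real.log_mul (by positivity) (by positivity), Real.log_pow]

lemma isLocalMax_tiltLog (hn : 3 ≤ n) (hx : x ∈ unitBall n)
    (hm : ∀ y ∈ closedUnitBall n, tiltExp κ w p y ≤ tiltExp κ w p x) :
    IsLocalMax (tiltLog κ w p) x := by
  filter_upwards [Metric.isOpen_ball.mem_nhds hx] with y hy
  have hb := h.one_lt_logN hn (unitBall_subset hy)
  have hr := rho_pos hy
  rw [← h.log_tiltExp hn hx, ← h.log_tiltExp hn hy]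
  exact Real.log_le_log (mul_pos (by positivity) (Real.exp_pos _))
    (hm y (Metric.ball_subset_closedBall hy))

lemma differentiableAt_slopeMap (hn : 3 ≤ n) (hx : x ∈ unitBall n) :
    DifferentiableAt ℝ (slopeMap κ w) x := by
  rw [differentiableAt_euclidean]
  exact fun j => ((h.contDiffOn_slope hn j).contDiffAt
    (Metric.isOpen_ball.mem_nhds hx)).differentiableAt (by norm_num)

lemma closedUnitBall_subset_image (hn : 3 ≤ n) (hκ : 0 ≤ κ) :
    closedUnitBall n ⊆ slopeMap κ w '' contactSet κ w := by
  intro p hp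
  have h0 : (0 : EuclideanSpace ℝ (Fin n)) ∈ closedUnitBall n := by simp
  obtain ⟨x, hx, hm⟩ := (isCompact_closedBall (0 : EuclideanSpace ℝ (Fin n)) 1).exists_isMaxOn
    ⟨0, h0⟩ ((h.continuousOn_tiltExp hn p).mono (closedBall_subset_bigBall (by norm_num)))
  have hxu := mem_unitBall_of_rho_pos (h.rho_pos_of_contact hn hκ hp hx (hm h0))
  refine ⟨x, ⟨hx, p, hp, fun y hy => hm hy⟩, ?_⟩
  ext j
  exact h.slope_eq hn hxu (pd_eq_zero_of_isLocalMax
    (h.isLocalMax_tiltLog hn hxu fun y hy => hm hy)) j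

end Sol

lemma exists_logN_zero_le {α β κ M : ℝ} (hn : 3 ≤ n) (hα : 0 < α) (hβ : 0 ≤ β) (hκ : 0 ≤ κ)
    (hM : 0 ≤ M) : ∃ C : ℝ, ∀ w : Fin n → EuclideanSpace ℝ (Fin n) → ℝ, Sol α β κ M w →
      logN κ w 0 ≤ C := by
  obtain ⟨C₁, T, h₁, hC₁⟩ := exists_det_slopeD_le (n := n) hn hα hβ hκ M
  obtain ⟨C₂, hC₂⟩ := exists_ballInt_logN_le (n := n) hn hα hβ hκ hM
  obtain ⟨m, hm⟩ : ∃ m : ℝ, m = Real.exp (-(2 * (n * (M + κ)))) := ⟨_, rfl⟩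
  have hm0 : 0 < m := hm ▸ Real.exp_pos _
  obtain ⟨v, hv⟩ : ∃ v : ℝ, v = (volume (closedUnitBall n)).toReal := ⟨_, rfl⟩
  have hvol : volume (closedUnitBall n) = ENNReal.ofReal v := by
    rw [hv, ENNReal.ofReal_toReal measure_closedBall_lt_top.ne]
  have hv0 : 0 < v := by
    rw [hv]
    exact ENNReal.toReal_pos (Metric.measure_closedBall_pos _ _ one_pos).ne'
      measure_closedBall_lt_top.ne
  refine ⟨max (T / m) (C₁ * max C₂ 0 / (m * v)), fun w h => ?_⟩
  rcases le_total (logN κ w 0) (T / m) with hT | hT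
  · exact hT.trans (le_max_left _ _)
  refine le_trans ?_ (le_max_right _ _)
  rw [div_le_iff₀ hm0] at hT
  have h0 : (0 : EuclideanSpace ℝ (Fin n)) ∈ closedUnitBall n := by simp
  have hs : closedUnitBall n ⊆ bigBall n := closedBall_subset_bigBall (by norm_num)
  have hb0 := h.one_lt_logN hn (hs h0)
  obtain ⟨c, hc⟩ : ∃ c : ℝ, c = C₁ / (logN κ w 0 * m) := ⟨_, rfl⟩
  have hc0 : 0 ≤ c := by rw [hc]; positivity
  have hle : ∀ x ∈ contactSet κ w,
      |(fderiv ℝ (slopeMap κ w) x).det| ≤ c * (logN κ w x * e2M (jac w x)) := by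
    rintro x ⟨hx, p, hp, hmax⟩
    have hρ := h.rho_pos_of_contact hn hκ hp hx (hmax 0 h0)
    have hxu := mem_unitBall_of_rho_pos hρ
    have hge := h.logN_mul_rho_ge hn hκ hp hx (hmax 0 h0)
    rw [← hm] at hge
    have hb := h.one_lt_logN hn (hs hx)
    have hρ1 : rho x ^ n ≤ 1 := pow_le_one₀ hρ.le (rho_le_one x)
    have hT' : T ≤ logN κ w x :=
      hT.trans (hge.trans (mul_le_of_le_one_right (by linarith) hρ1))
    have hd := hC₁ w h x hxu p (by simpa using hp) (h.isLocalMax_tiltLog hn hxu hmax) hT'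
    rw [det_fderiv_eq (h.differentiableAt_slopeMap hn hxu)]
    refine hd.trans ?_
    have he := (h.adm x (hs hx)).e2M_pos
    have hinv : (rho x)⁻¹ ^ n ≤ logN κ w x / (logN κ w 0 * m) := by
      rw [inv_pow, inv_eq_one_div, div_le_div_iff₀ (by positivity) (by positivity)]
      linarith
    calc C₁ * (rho x)⁻¹ ^ n * e2M (jac w x)
        ≤ C₁ * (logN κ w x / (logN κ w 0 * m)) * e2M (jac w x) := by gcongr
      _ = c * (logN κ w x * e2M (jac w x)) := by rw [hc]; ring
  have hcont : ContinuousOn (fun x => c * (logN κ w x * e2M (jac w x))) (bigBall n) :=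
    continuousOn_const.mul ((h.contDiffOn_logN hn).continuousOn.mul
      h.contDiffOn_e2M_jac.continuousOn)
  have hmeas : MeasurableSet (contactSet κ w) :=
    (h.isCompact_contactSet hn).isClosed.measurableSet
  have hbound : ENNReal.ofReal v ≤ ENNReal.ofReal (c * max C₂ 0) := by
    rw [← hvol]
    calc volume (closedUnitBall n) ≤ volume (slopeMap κ w '' contactSet κ w) :=
          measure_mono (h.closedUnitBall_subset_image hn hκ)
      _ ≤ ∫⁻ x in contactSet κ w, ENNReal.ofReal |(fderiv ℝ (slopeMap κ w) x).det| := by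
          refine addHaar_image_le_lintegral_abs_det_fderiv _ hmeas fun x hx => ?_
          obtain ⟨hx, p, hp, hmax⟩ := hx
          exact (h.differentiableAt_slopeMap hn (mem_unitBall_of_rho_pos
            (h.rho_pos_of_contact hn hκ hp hx (hmax 0 h0)))).hasFDerivAt.hasFDerivWithinAt
      _ ≤ ∫⁻ x in contactSet κ w, ENNReal.ofReal (c * (logN κ w x * e2M (jac w x))) :=
          setLIntegral_mono' hmeas fun x hx => ENNReal.ofReal_le_ofReal (hle x hx)
      _ ≤ ∫⁻ x in closedUnitBall n, ENNReal.ofReal (c * (logN κ w x * e2M (jac w x))) :=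
          lintegral_mono_set (Set.sep_subset _ _)
      _ = ENNReal.ofReal (∫ x in closedUnitBall n, c * (logN κ w x * e2M (jac w x))) := by
          refine (ofReal_integral_eq_lintegral_ofReal
            (integrableOn_closedBall (by norm_num) hcont) ?_).symm
          refine (ae_restrict_iff' Metric.isClosed_closedBall.measurableSet).2
            (Filter.Eventually.of_forall fun x hx => ?_)
          have hb := h.one_lt_logN hn (hs hx)
          have he := (h.adm x (hs hx)).e2M_pos
          exact mul_nonneg hc0 (mul_nonneg (by linarith) he.le)
      _ ≤ ENNReal.ofReal (c * max C₂ 0) := by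
          refine ENNReal.ofReal_le_ofReal ?_
          have := ballInt_const_mul 1 c (fun x => logN κ w x * e2M (jac w x))
          rw [ballInt] at this
          rw [this]
          exact mul_le_mul_of_nonneg_left ((hC₂ w h).trans (le_max_left _ _)) hc0
  rw [ENNReal.ofReal_le_ofReal_iff (by positivity), hc, div_mul_eq_mul_div,
    le_div_iff₀ (by positivity)] at hbound
  rw [le_div_iff₀ (by positivity)]
  linarith

end HessQuot

namespace HessQuot
variable {n : ℕ}

open Matrix

lemma opNorm_le_of_abs_le {A : Matrix (Fin n) (Fin n) ℝ} {c : ℝ} (hc : 0 ≤ c)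
    (hA : ∀ i j, |A i j| ≤ c) : opNorm A ≤ n * (n * c) := by
  refine ContinuousLinearMap.opNorm_le_bound _ (by positivity) fun x => ?_
  have hcoord : ∀ i, |(Matrix.toEuclideanCLM (𝕜 := ℝ) A x) i| ≤ n * c * ‖x‖ := fun i => by
    have h1 : (Matrix.toEuclideanCLM (𝕜 := ℝ) A x) i = ∑ j, A i j * x j := by
      simp [Matrix.mulVec, dotProduct]
    rw [h1]
    calc |∑ j, A i j * x j| ≤ ∑ j, |A i j * x j| := Finset.abs_sum_le_sum_abs _ _
      _ ≤ ∑ _j : Fin n, c * ‖x‖ := Finset.sum_le_sum fun j _ => by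
          rw [abs_mul]
          exact mul_le_mul (hA i j) (by simpa using PiLp.norm_apply_le x j) (abs_nonneg _) hc
      _ = n * c * ‖x‖ := by simp; ring
  generalize Matrix.toEuclideanCLM (𝕜 := ℝ) A x = y at hcoord
  calc ‖y‖ = ‖∑ i, y i • EuclideanSpace.single i (1 : ℝ)‖ := by
        congr 1
        ext j
        simp [Finset.sum_apply, Pi.single_apply]
    _ ≤ ∑ i, ‖y i • EuclideanSpace.single i (1 : ℝ)‖ := norm_sum_le _ _
    _ ≤ ∑ _i : Fin n, n * c * ‖x‖ := Finset.sum_le_sum fun i _ => by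
        rw [norm_smul]; simpa using hcoord i
    _ = n * (n * c) * ‖x‖ := by simp; ring

/-- Gradient field of `u`, tilted by `t`. -/
def tiltGrad (t : ℝ) (u : EuclideanSpace ℝ (Fin n) → ℝ) (j : Fin n)
    (x : EuclideanSpace ℝ (Fin n)) : ℝ := pd j u x - t * x j

lemma transpose_hess {u : EuclideanSpace ℝ (Fin n) → ℝ} (hu : ContDiffOn ℝ 4 u (bigBall n))
    {x : EuclideanSpace ℝ (Fin n)} (hx : x ∈ bigBall n) : (hess u x)ᵀ = hess u x := by
  ext i j
  exact pd_comm isOpen_bigBall (hu.of_le (by norm_num)) hx j i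

lemma jac_tiltGrad (t : ℝ) {u : EuclideanSpace ℝ (Fin n) → ℝ}
    (hu : ContDiffOn ℝ 4 u (bigBall n)) {x : EuclideanSpace ℝ (Fin n)} (hx : x ∈ bigBall n) :
    jac (tiltGrad t u) x = hess u x - t • (1 : Matrix (Fin n) (Fin n) ℝ) := by
  ext i j
  have h3 : ContDiffOn ℝ (3 : ℕ) (pd j u) (bigBall n) :=
    contDiffOn_pd (m := 3) isOpen_bigBall (hu.of_le (by norm_num)) j
  have hd : DifferentiableAt ℝ (pd j u) x :=
    (h3.contDiffAt (isOpen_bigBall.mem_nhds hx)).differentiableAt (by norm_num)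
  refine ((hd.hasPD (k := i)).sub ((hasPD_coord j).const_mul t)).pd_eq.trans ?_
  simp only [Matrix.sub_apply, Matrix.smul_apply, Matrix.one_apply, smul_eq_mul, eq_comm (a := j)]
  rfl

lemma abs_pd_le_norm_gradient (u : EuclideanSpace ℝ (Fin n) → ℝ) (j : Fin n)
    (x : EuclideanSpace ℝ (Fin n)) : |pd j u x| ≤ ‖gradient u x‖ := by
  rw [gradient, LinearIsometryEquiv.norm_map]
  simpa [pd] using (fderiv ℝ u x).le_opNorm (EuclideanSpace.single j 1)

lemma sq_le_trace_mul_self {A : Matrix (Fin n) (Fin n) ℝ} (hA : Aᵀ = A) (i j : Fin n) :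
    A i j ^ 2 ≤ (A * A).trace := by
  have h1 : (A * A).trace = ∑ a, ∑ b, A a b ^ 2 := by
    simp only [Matrix.trace, Matrix.diag_apply, Matrix.mul_apply]
    refine Finset.sum_congr rfl fun a _ => Finset.sum_congr rfl fun b _ => ?_
    rw [sq]; congr 1
    exact congrFun (congrFun hA a) b
  rw [h1]
  exact (Finset.single_le_sum (f := fun b => A i b ^ 2) (fun b _ => sq_nonneg _)
    (Finset.mem_univ j)).trans (Finset.single_le_sum (f := fun a => ∑ b, A a b ^ 2)
      (fun a _ => Finset.sum_nonneg fun b _ => sq_nonneg _) (Finset.mem_univ i))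

end HessQuot

theorem interior_C2_estimate_hessian_quotient
    (n : ℕ) (hn : 3 ≤ n) (l : ℕ) (hl : l = 1 ∨ l = 2)
    (K M : ℝ) (hK : 0 < K) (hM : 0 < M) :
    ∃ C : ℝ, 0 < C ∧
      ∀ u : EuclideanSpace ℝ (Fin n) → ℝ,
        -- u is C⁴ on B₅
        ContDiffOn ℝ 4 u (Metric.ball (0 : EuclideanSpace ℝ (Fin n)) 5) →
        -- admissibility: λ(D²u(x)) ∈ Γ₃ on B₅
        (∀ x ∈ Metric.ball (0 : EuclideanSpace ℝ (Fin n)) 5,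
          ∀ i : ℕ, 1 ≤ i → i ≤ 3 → 0 < sigmaMat i (hess u x)) →
        -- the equation σ₃(D²u) = σ_l(D²u) on B₅
        (∀ x ∈ Metric.ball (0 : EuclideanSpace ℝ (Fin n)) 5,
          sigmaMat 3 (hess u x) = sigmaMat l (hess u x)) →
        -- K-semi-convexity: every eigenvalue of D²u ≥ -K, i.e. D²u + K·I ⪰ 0
        (∀ x ∈ Metric.ball (0 : EuclideanSpace ℝ (Fin n)) 5,
          (hess u x + K • (1 : Matrix (Fin n) (Fin n) ℝ)).PosSemidef) →
        -- C¹ bound: |u| + |Du| ≤ M on B₅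
        (∀ x ∈ Metric.ball (0 : EuclideanSpace ℝ (Fin n)) 5,
          |u x| + ‖gradient u x‖ ≤ M) →
        opNorm (hess u 0) ≤ C := by
  obtain ⟨α, β, t, hα, hβ, ht, hadm⟩ := HessQuot.exists_mAdm hn hl
  obtain ⟨κ, hκ⟩ : ∃ κ : ℝ, κ = K + t + 1 := ⟨_, rfl⟩
  obtain ⟨C, hC⟩ := HessQuot.exists_logN_zero_le (n := n) (α := α) (β := β) (κ := κ)
    (M := M + 5 * t) hn hα hβ (by linarith) (by linarith)
  refine ⟨n * (n * (Real.exp (C / 2) + K + 1)), by positivity, fun u hu hσ heq hconv hbd => ?_⟩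
  have h : HessQuot.Sol α β κ (M + 5 * t) (HessQuot.tiltGrad t u) := by
    refine ⟨fun j => ?_, fun x hx => ?_, fun j x hx => ?_⟩
    · have h3 : ContDiffOn ℝ (3 : ℕ) (HessQuot.pd j u) (HessQuot.bigBall n) :=
        HessQuot.contDiffOn_pd (m := 3) HessQuot.isOpen_bigBall (hu.of_le (by norm_num)) j
      exact ContDiffOn.sub h3 (contDiffOn_const.mul
        (EuclideanSpace.proj (𝕜 := ℝ) j).contDiff.contDiffOn)
    · rw [HessQuot.jac_tiltGrad t hu hx]
      exact hadm K κ hκ.ge _ (HessQuot.transpose_hess hu hx) (hσ x hx) (heq x hx) (hconv x hx)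
    · have h1 := HessQuot.abs_pd_le_norm_gradient u j x
      have h2 := hbd x hx
      have h3 := PiLp.norm_apply_le x j
      rw [Real.norm_eq_abs] at h3
      have h4 : ‖x‖ < 5 := by simpa using hx
      have h5 : |t * x j| ≤ t * 5 := by
        rw [abs_mul, abs_of_nonneg ht]
        exact mul_le_mul_of_nonneg_left (by linarith) ht
      have h6 := abs_sub (HessQuot.pd j u x) (t * x j)
      have h7 := abs_nonneg (u x)
      rw [HessQuot.tiltGrad]
      linarith
  have h0 : (0 : EuclideanSpace ℝ (Fin n)) ∈ HessQuot.bigBall n := by simp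
  have hN : HessQuot.sqN κ (HessQuot.tiltGrad t u) 0 ≤ Real.exp C :=
    (Real.log_le_iff_le_exp (h.sqN_pos hn h0)).1 (hC _ h)
  have hshift : HessQuot.oM κ (HessQuot.jac (HessQuot.tiltGrad t u) 0)
      = hess u 0 + (K + 1) • (1 : Matrix (Fin n) (Fin n) ℝ) := by
    rw [HessQuot.jac_tiltGrad t hu h0, HessQuot.oM, hκ]
    module
  rw [HessQuot.sqN, hshift] at hN
  refine HessQuot.opNorm_le_of_abs_le (by positivity) fun i j => ?_
  have hsq := (HessQuot.sq_le_trace_mul_self (A := hess u 0 + (K + 1) • 1)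
    (by rw [Matrix.transpose_add, HessQuot.transpose_hess hu h0]; simp) i j).trans hN
  have hexp : Real.exp C = Real.exp (C / 2) ^ 2 := by
    rw [← Real.exp_nat_mul]; congr 1; push_cast; ring
  rw [hexp] at hsq
  have h1 := abs_le_of_sq_le_sq hsq (Real.exp_pos _).le
  have h2 : |((K + 1) • (1 : Matrix (Fin n) (Fin n) ℝ)) i j| ≤ K + 1 := by
    rw [Matrix.smul_apply, Matrix.one_apply]
    split_ifs
    · simpa using (abs_of_pos (by linarith : 0 < K + 1)).le
    · simp; linarith
  rw [Matrix.add_apply] at h1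
  rw [abs_le] at h1 h2 ⊢
  constructor <;> linarith
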